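/- Let k be a field and X = (V,U,T) an indecomposable object of S_k(6), and let End(X) denote the k-algebra of all k-linear maps f : V → V with f(U) ⊆ U and f∘T = T∘f. Then there exists a two-sided ideal I of End(X) with I^8 = 0 such that the quotient ring End(X)/I is a local uniserial ring, i.e. a local ring whose ideals are totally ordered by inclusion. -/

import Mathlib

universe u

/-- An object of the category `S_k(n)`: a finite-dimensional `k`-vector space `V`,
a `k`-subspace `U ⊆ V`, and a linear operator `T : V → V` with `T ^ n = 0` and
`T (U) ⊆ U`. -/
structure SObj (k : Type u) [Field k] (n : ℕ) : Type (u + 1) where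
  carrier : Type u
  [instAddCommGroup : AddCommGroup carrier]
  [instModule : Module k carrier]
  [instFin : FiniteDimensional k carrier]
  U : Submodule k carrier
  T : carrier →ₗ[k] carrier
  pow_eq_zero : T ^ n = 0
  maps_U : ∀ x ∈ U, T x ∈ U

namespace SObj

attribute [instance] instAddCommGroup instModule instFin

variable {k : Type u} [Field k] {n : ℕ}

/-- Isomorphism of objects of `S_k(n)`: a linear bijection intertwining the operators
and carrying one invariant subspace onto the other. -/
def Iso (X Y : SObj k n) : Prop :=
  ∃ e : X.carrier ≃ₗ[k] Y.carrier,
    (∀ v, e (X.T v) = Y.T (e v)) ∧ X.U.map e.toLinearMap = Y.U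

/-- Indecomposability: the object is nonzero and there is no decomposition
`V = V₁ ⊕ V₂` into two nonzero `T`-invariant subspaces with
`U = (U ∩ V₁) ⊕ (U ∩ V₂)`. -/
def Indec (X : SObj k n) : Prop :=
  (∃ v : X.carrier, v ≠ 0) ∧
    ¬∃ V₁ V₂ : Submodule k X.carrier,
        V₁ ≠ ⊥ ∧ V₂ ≠ ⊥ ∧ IsCompl V₁ V₂ ∧
          (∀ x ∈ V₁, X.T x ∈ V₁) ∧ (∀ x ∈ V₂, X.T x ∈ V₂) ∧
            X.U = X.U ⊓ V₁ ⊔ X.U ⊓ V₂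

/-- The dimension pair `(dim_k V, dim_k U)` of an object of `S_k(n)`. -/
noncomputable def dimPair (X : SObj k n) : ℕ × ℕ :=
  (Module.finrank k X.carrier, Module.finrank k X.U)

end SObj

/-- The endomorphism algebra of an object `X = (V,U,T)` of `S_k(n)`: all linear maps
`f : V → V` with `f(U) ⊆ U` and `f ∘ T = T ∘ f`. -/
def SObj.endAlg {k : Type u} [Field k] {n : ℕ} (X : SObj k n) :
    Subalgebra k (Module.End k X.carrier) where
  carrier := {f | (∀ x ∈ X.U, f x ∈ X.U) ∧ f * X.T = X.T * f}
  mul_mem' := by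
    rintro f g ⟨hf1, hf2⟩ ⟨hg1, hg2⟩
    refine ⟨fun x hx => hf1 _ (hg1 x hx), ?_⟩
    rw [mul_assoc, hg2, ← mul_assoc, hf2, mul_assoc]
  one_mem' := ⟨fun x hx => hx, by rw [one_mul, mul_one]⟩
  add_mem' := by
    rintro f g ⟨hf1, hf2⟩ ⟨hg1, hg2⟩
    refine ⟨fun x hx => ?_, ?_⟩
    · exact X.U.add_mem (hf1 x hx) (hg1 x hx)
    · rw [add_mul, mul_add, hf2, hg2]
  zero_mem' := ⟨fun x _ => by simp, by rw [zero_mul, mul_zero]⟩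
  algebraMap_mem' := by
    intro c
    refine ⟨fun x hx => ?_, Algebra.commutes c X.T⟩
    rw [Module.algebraMap_end_apply]
    exact X.U.smul_mem c hx

set_option linter.all false
set_option linter.unusedSectionVars false
set_option linter.style.haveILetI false
set_option linter.unusedSimpArgs false
set_option linter.unusedVariables false
set_option linter.deprecated false

namespace Stm
open LaurentPolynomial

section ring
variable {k : Type u} [Field k]

theorem coeff_T_mul (r : k[T;T⁻¹]) (m n : ℤ) : (T m * r).coeff n = r.coeff (n - m) := by
  have := AddMonoidAlgebra.coeff_single_mul_eq_mul_coeff (x := r) (r := (1:k)) (m := m) (m₁ := n) (n - m) (by intros; omega)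
  rw [one_mul] at this
  exact this

/-- nonnegative part with respect to sign `e` -/
noncomputable def Pos (k : Type u) [Field k] (e : ℤ) : Subalgebra k k[T;T⁻¹] :=
  (Polynomial.aeval (T e : k[T;T⁻¹])).range

theorem T_mem_Pos {e : ℤ} (he : e = 1 ∨ e = -1) {n : ℤ} (hn : 0 ≤ e * n) : (T n : k[T;T⁻¹]) ∈ Pos k e := by
  refine ⟨Polynomial.X ^ (e * n).toNat, ?_⟩
  simp only [AlgHom.toRingHom_eq_coe, RingHom.coe_coe, map_pow, Polynomial.aeval_X, T_pow]
  congr 1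
  rw [Int.toNat_of_nonneg hn]
  rcases he with rfl | rfl <;> ring

theorem mem_Pos {e : ℤ} (he : e = 1 ∨ e = -1) (r : k[T;T⁻¹]) :
    r ∈ Pos k e ↔ ∀ n, e * n < 0 → r.coeff n = 0 := by
  constructor
  · rintro ⟨p, rfl⟩ n hn
    simp only [AlgHom.toRingHom_eq_coe, RingHom.coe_coe]
    induction p using Polynomial.induction_on' with
    | add p q hp hq => simp [map_add, hp, hq]
    | monomial m a =>
      rw [Polynomial.aeval_monomial, T_pow, ← Algebra.smul_def]
      simp only [AddMonoidAlgebra.coeff_smul, Finsupp.smul_apply, T_apply, smul_eq_mul]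
      rw [if_neg, mul_zero]
      rintro rfl
      rcases he with rfl | rfl <;> nlinarith
  · intro h
    have : r = ∑ n ∈ r.coeff.support, (r.coeff n) • (T n : k[T;T⁻¹]) := by
      ext n
      simp only [AddMonoidAlgebra.coeff_sum, AddMonoidAlgebra.coeff_smul, Finsupp.coe_finset_sum,
        Finset.sum_apply, Finsupp.smul_apply, T_apply, smul_eq_mul, mul_ite, mul_one, mul_zero,
        Finset.sum_ite_eq', Finsupp.mem_support_iff]
      split_ifs with h0
      · rfl
      · simpa using h0
    rw [this]
    refine Subalgebra.sum_mem _ fun n hn => Subalgebra.smul_mem _ (T_mem_Pos he ?_) _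
    by_contra hc
    exact (Finsupp.mem_support_iff.1 hn) (h n (not_le.1 hc))

theorem T_isUnit_smul_inj {W : Type*} [AddCommGroup W] [Module k[T;T⁻¹] W] (n : ℤ) {v w : W}
    (h : (T n : k[T;T⁻¹]) • v = (T n : k[T;T⁻¹]) • w) : v = w := by
  have := congrArg (fun x => (T (-n) : k[T;T⁻¹]) • x) h
  simp only [← mul_smul, ← T_add, neg_add_cancel, T_zero, one_smul] at this
  exact this

theorem T_smul_smul {W : Type*} [AddCommGroup W] [Module k[T;T⁻¹] W] (m n : ℤ) (w : W) :
    (T m : k[T;T⁻¹]) • (T n : k[T;T⁻¹]) • w = (T (m + n) : k[T;T⁻¹]) • w := by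
  rw [← mul_smul, T_add]

theorem exists_T_mul_mem_Pos {e : ℤ} (he : e = 1 ∨ e = -1) (r : k[T;T⁻¹]) :
    ∃ m : ℕ, ∀ m' : ℕ, m ≤ m' → T (e * m') * r ∈ Pos k e := by
  refine ⟨∑ n ∈ r.coeff.support, n.natAbs, fun m' hm' => ?_⟩
  rw [mem_Pos he]
  intro n hn
  rw [coeff_T_mul]
  by_contra hc
  have h1 := Finset.single_le_sum (f := Int.natAbs) (fun i _ => Nat.zero_le _) (Finsupp.mem_support_iff.2 hc)
  have : (n - e * m').natAbs ≤ m' := h1.trans hm'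
  rcases he with rfl | rfl <;> omega

theorem one_sub_T_dvd (n : ℤ) : (1 - T 1 : k[T;T⁻¹]) ∣ 1 - T n := by
  have key : ∀ n : ℕ, (1 - T 1 : k[T;T⁻¹]) ∣ 1 - T n := by
    intro n
    have := sub_dvd_pow_sub_pow (1 : k[T;T⁻¹]) (T 1) n
    simpa [T_pow] using this
  rcases Int.eq_nat_or_neg n with ⟨m, rfl | rfl⟩
  · exact key m
  · have : (1 - T (-(m:ℤ)) : k[T;T⁻¹]) = (1 - T m) * (- T (-(m:ℤ))) := by
      rw [sub_mul, one_mul, mul_neg, ← T_add]; simp; ring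
    rw [this]; exact (key m).mul_right _

/-- evaluation at `T = 1` -/
noncomputable def ev1 : k[T;T⁻¹] →ₗ[k] k where
  toFun r := r.coeff.sum fun _ a => a
  map_add' r s := by
    simp only [AddMonoidAlgebra.coeff_add]
    rw [Finsupp.sum_add_index'] <;> simp
  map_smul' c r := by
    simp only [AddMonoidAlgebra.coeff_smul, RingHom.id_apply]
    rw [Finsupp.sum_smul_index' (by simp), Finsupp.smul_sum]

@[simp] theorem ev1_T (n : ℤ) : ev1 (T n : k[T;T⁻¹]) = 1 := by
  show (Finsupp.single n (1:k)).sum (fun _ a => a) = 1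
  simp

theorem algebraMap_eq_smul_one' (a : k) : (algebraMap k k[T;T⁻¹] a) = a • (1 : k[T;T⁻¹]) :=
  Algebra.algebraMap_eq_smul_one a

theorem dvd_sub_ev1 (r : k[T;T⁻¹]) : (1 - T 1 : k[T;T⁻¹]) ∣ r - (ev1 r) • (1 : k[T;T⁻¹]) := by
  induction r using LaurentPolynomial.induction_on' with
  | add p q hp hq =>
    have : p + q - (ev1 (p + q)) • (1 : k[T;T⁻¹]) = (p - ev1 p • 1) + (q - ev1 q • 1) := by
      rw [map_add, add_smul]; abel
    rw [this]; exact dvd_add hp hq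
  | C_mul_T n a =>
    rw [← smul_eq_C_mul, map_smul, ev1_T, smul_assoc, one_smul, ← smul_sub]
    have := (one_sub_T_dvd (k := k) n).mul_left (-(algebraMap k k[T;T⁻¹] a))
    rw [show a • (T n - 1 : k[T;T⁻¹]) = -(algebraMap k k[T;T⁻¹] a) * (1 - T n) by
      rw [Algebra.smul_def]; ring]
    exact this

theorem ev1_T_mul (n : ℤ) (r : k[T;T⁻¹]) : ev1 (T n * r) = ev1 r := by
  induction r using LaurentPolynomial.induction_on' with
  | add p q hp hq => rw [mul_add, map_add, map_add, hp, hq]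
  | C_mul_T m a => rw [← smul_eq_C_mul, mul_smul_comm, ← T_add, map_smul, map_smul]; simp

theorem ev1_one_sub_mul (r : k[T;T⁻¹]) : ev1 ((1 - T 1) * r) = 0 := by
  rw [sub_mul, one_mul, map_sub, ev1_T_mul, sub_self]

theorem one_sub_T_ne_zero : (1 - T 1 : k[T;T⁻¹]) ≠ 0 := by
  intro h
  have := congrArg (fun r => r.coeff 0) h
  simp only [AddMonoidAlgebra.coeff_sub, Finsupp.sub_apply, T_apply] at this
  rw [← T_zero, T_apply] at this
  simp at this

theorem Pos_noeth (e : ℤ) : IsNoetherianRing (Pos k e) :=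
  isNoetherianRing_of_surjective _ _ (Polynomial.aeval (T e : k[T;T⁻¹])).rangeRestrict.toRingHom
    (AlgHom.rangeRestrict_surjective _)

theorem Pos_pid (e : ℤ) : IsPrincipalIdealRing (Pos k e) :=
  IsPrincipalIdealRing.of_surjective (Polynomial.aeval (T e : k[T;T⁻¹])).rangeRestrict.toRingHom
    (AlgHom.rangeRestrict_surjective _)

theorem R_noeth : IsNoetherianRing k[T;T⁻¹] := by
  haveI := LaurentPolynomial.isLocalization (R := k)
  exact IsLocalization.isNoetherianRing (Submonoid.powers (Polynomial.X : Polynomial k)) _ inferInstance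

end ring

section chart
variable {k : Type u} [Field k]
variable {W : Type*} [AddCommGroup W] [Module k W] [Module k[T;T⁻¹] W] [IsScalarTower k k[T;T⁻¹] W]

structure IsChart (e p : ℤ) (L : ℤ → Submodule k W) : Prop where
  he : e = 1 ∨ e = -1
  hp : 0 < p
  anti : ∀ i j, i ≤ j → L j ≤ L i
  shift : ∀ w j, (T e : k[T;T⁻¹]) • w ∈ L (j + p) ↔ w ∈ L j
  exh : ∀ w, ∃ j, w ∈ L j
  fg : ∀ j, ∃ S : Finset W, ∀ w ∈ L j, w ∈ Submodule.span (Pos k e) (S : Set W)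

variable (k W) in
def TF : Prop := ∀ (r : k[T;T⁻¹]) (w : W), r • w = 0 → r = 0 ∨ w = 0

namespace IsChart
variable {e p : ℤ} {L : ℤ → Submodule k W} (h : IsChart e p L)
include h

theorem shiftn_nat (n : ℕ) (w : W) (j : ℤ) :
    (T (e * n) : k[T;T⁻¹]) • w ∈ L (j + p * n) ↔ w ∈ L j := by
  induction n generalizing j with
  | zero => simp
  | succ n ih =>
    rw [← ih, show e * ((n + 1 : ℕ) : ℤ) = e + e * n by push_cast; ring, ← T_smul_smul,
      show j + p * ((n + 1 : ℕ) : ℤ) = j + p * n + p by push_cast; ring, h.shift]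

theorem shiftn (n : ℤ) (w : W) (j : ℤ) :
    (T (e * n) : k[T;T⁻¹]) • w ∈ L (j + p * n) ↔ w ∈ L j := by
  rcases Int.eq_nat_or_neg n with ⟨m, rfl | rfl⟩
  · exact h.shiftn_nat m w j
  · rw [← h.shiftn_nat m _ (j + p * (-m : ℤ)), T_smul_smul]
    simp only [mul_neg, add_neg_cancel, T_zero, one_smul, neg_add_cancel_right]

theorem T_mem {w : W} {j : ℤ} (hw : w ∈ L j) : (T e : k[T;T⁻¹]) • w ∈ L j :=
  h.anti _ _ (by linarith [h.hp]) ((h.shift w j).2 hw)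

theorem pos_smul {r : k[T;T⁻¹]} (hr : r ∈ Pos k e) {w : W} {j : ℤ} (hw : w ∈ L j) : r • w ∈ L j := by
  obtain ⟨q, rfl⟩ := hr
  simp only [AlgHom.toRingHom_eq_coe, RingHom.coe_coe]
  induction q using Polynomial.induction_on with
  | C a => rw [Polynomial.aeval_C, algebraMap_smul]; exact (L j).smul_mem _ hw
  | add q q' h1 h2 => rw [map_add, add_smul]; exact (L j).add_mem h1 h2
  | monomial n a ih =>
    rw [pow_succ, ← mul_assoc, map_mul, Polynomial.aeval_X, mul_comm, mul_smul]
    exact h.T_mem ih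

/-- for large n, `T^(e n) w ∈ L j` -/
theorem eventually (w : W) (j : ℤ) : ∃ n : ℕ, ∀ n' : ℤ, n ≤ n' → (T (e * n') : k[T;T⁻¹]) • w ∈ L j := by
  obtain ⟨i, hi⟩ := h.exh w
  refine ⟨(j - i).toNat, fun n' hn' => ?_⟩
  refine h.anti _ (i + p * n') ?_ ((h.shiftn n' w i).2 hi)
  have := h.hp
  have h0 : (0:ℤ) ≤ n' := le_trans (by positivity) hn'
  nlinarith [Int.self_le_toNat (j - i)]

def sub (j : ℤ) : Submodule (Pos k e) W where
  carrier := L j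
  add_mem' := (L j).add_mem
  zero_mem' := (L j).zero_mem
  smul_mem' := fun c _ hx => h.pos_smul c.2 hx

theorem basis (tf : TF k W) (j : ℤ) : ∃ (n : ℕ) (b : Module.Basis (Fin n) k[T;T⁻¹] W),
    ∀ w, w ∈ L j ↔ ∀ i, b.repr w i ∈ Pos k e := by
  classical
  have he := h.he
  haveI := Pos_noeth (k := k) e
  haveI := Pos_pid (k := k) e
  obtain ⟨S, hS⟩ := h.fg j
  haveI : IsNoetherian (Pos k e) (Submodule.span (Pos k e) (S : Set W)) :=
    isNoetherian_span_of_finite _ S.finite_toSet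
  haveI : IsNoetherian (Pos k e) (h.sub j) := isNoetherian_of_le (t := Submodule.span (Pos k e) (S : Set W)) hS
  haveI : Module.IsTorsionFree (Pos k e) (h.sub j) := by
    refine Module.IsTorsionFree.of_smul_eq_zero (R := Pos k e) (M := h.sub j) fun r w hrw => ?_
    have := tf (r : k[T;T⁻¹]) (w : W) (congrArg Subtype.val hrw)
    simpa using this
  obtain ⟨n, c⟩ := Module.basisOfFiniteTypeTorsionFree' (R := Pos k e) (M := h.sub j)
  have hli : LinearIndependent k[T;T⁻¹] (fun i => (c i : W)) := by
    rw [Fintype.linearIndependent_iff]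
    intro g hg i
    choose m hm using fun i => exists_T_mul_mem_Pos he (g i)
    set M := ∑ i, m i
    have hM : ∀ i, T (e * M) * g i ∈ Pos k e := fun i => hm i M (Finset.single_le_sum (f := m) (fun _ _ => Nat.zero_le _) (Finset.mem_univ i))
    have h2 : ∑ i, (⟨_, hM i⟩ : Pos k e) • c i = 0 := by
      apply Subtype.ext
      have := congrArg (fun w => (T (e * M) : k[T;T⁻¹]) • w) hg
      simp only [Finset.smul_sum, smul_zero, ← mul_smul] at this
      rw [AddSubmonoidClass.coe_finset_sum]
      exact this
    have := congrArg Subtype.val (Fintype.linearIndependent_iff.1 c.linearIndependent _ h2 i)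
    simp only [ZeroMemClass.coe_zero, mul_eq_zero] at this
    rcases this with h3 | h3
    · exact absurd h3 (isUnit_T _).ne_zero
    · exact h3
  have hrep : ∀ w : h.sub j, (w : W) = ∑ i, ((c.repr w i : Pos k e) : k[T;T⁻¹]) • (c i : W) := by
    intro w
    conv_lhs => rw [← c.sum_repr w]
    rw [AddSubmonoidClass.coe_finset_sum]
    rfl
  have hsp : ⊤ ≤ Submodule.span k[T;T⁻¹] (Set.range fun i => (c i : W)) := by
    intro w _
    obtain ⟨m, hm⟩ := h.eventually w j
    have h1 : (T (e * m) : k[T;T⁻¹]) • w ∈ Submodule.span k[T;T⁻¹] (Set.range fun i => (c i : W)) := by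
      rw [show (T (e * m) : k[T;T⁻¹]) • w = _ from hrep ⟨_, hm m le_rfl⟩]
      exact Submodule.sum_mem _ fun i _ => Submodule.smul_mem _ _ (Submodule.subset_span ⟨i, rfl⟩)
    have := Submodule.smul_mem _ (T (-(e * m)) : k[T;T⁻¹]) h1
    rwa [T_smul_smul, neg_add_cancel, T_zero, one_smul] at this
  refine ⟨n, Module.Basis.mk hli hsp, fun w => ⟨fun hw i => ?_, fun hw => ?_⟩⟩
  · have h1 := hrep ⟨w, hw⟩
    have h2 : (Module.Basis.mk hli hsp).repr w i = ((c.repr ⟨w, hw⟩ i : Pos k e) : k[T;T⁻¹]) := by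
      conv_lhs => rw [show w = _ from h1]
      rw [show (∑ i, ((c.repr ⟨w, hw⟩ i : Pos k e) : k[T;T⁻¹]) • (c i : W)) = ∑ i, ((c.repr ⟨w, hw⟩ i : Pos k e) : k[T;T⁻¹]) • (Module.Basis.mk hli hsp i) by simp]
      rw [Module.Basis.repr_sum_self]
    rw [h2]; exact SetLike.coe_mem _
  · rw [← (Module.Basis.mk hli hsp).sum_repr w]
    refine Submodule.sum_mem _ fun i _ => h.pos_smul (hw i) ?_
    rw [Module.Basis.mk_apply]
    exact (c i).2

end IsChart
end chart
end Stm

namespace Stm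
open LaurentPolynomial

section flag
variable {k : Type*} [Field k] {X V V' : Type*} [AddCommGroup X] [Module k X] [AddCommGroup V] [Module k V]
  [AddCommGroup V'] [Module k V']

theorem flag_lift (π : V →ₗ[k] V') (f : X →ₗ[k] V') (Y : ℕ → Submodule k X) (G : ℕ → Submodule k V)
    (hY : Antitone Y) (hG : Antitone G) (hY0 : Y 0 = ⊤)
    (hf : ∀ j, ∀ y ∈ Y j, ∃ v ∈ G j, π v = f y) (n : ℕ) :
    ∃ g : X →ₗ[k] V, (∀ x, π (g x) = f x) ∧ ∀ j ≤ n, ∀ y ∈ Y j, g y ∈ G j := by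
  have key : ∀ n, ∃ h : Y n →ₗ[k] G n, ∀ y, π (h y) = f y := by
    intro n
    have hs : ∀ y : Y n, f y ∈ (G n).map π := fun y => by
      obtain ⟨v, hv, h⟩ := hf n y y.2
      exact ⟨v, hv, h⟩
    let f' : Y n →ₗ[k] (G n).map π := (f.domRestrict (Y n)).codRestrict _ hs
    let q : G n →ₗ[k] (G n).map π := (π.domRestrict (G n)).codRestrict _ (fun v => ⟨v, v.2, rfl⟩)
    have hq : Function.Surjective q := by
      rintro ⟨_, v, hv, rfl⟩
      exact ⟨⟨v, hv⟩, rfl⟩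
    obtain ⟨s, hs⟩ := q.exists_rightInverse_of_surjective (LinearMap.range_eq_top.2 hq)
    refine ⟨s ∘ₗ f', fun y => ?_⟩
    have := congrArg Subtype.val (LinearMap.congr_fun hs (f' y))
    exact this
  induction n with
  | zero =>
    obtain ⟨h, hh⟩ := key 0
    refine ⟨(G 0).subtype ∘ₗ h ∘ₗ (LinearMap.codRestrict (Y 0) LinearMap.id (fun x => by rw [hY0]; trivial)), ?_, ?_⟩
    · intro x; exact hh _
    · intro j hj y hy
      obtain rfl : j = 0 := by omega
      exact Subtype.property _
  | succ n ih =>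
    obtain ⟨g, hg1, hg2⟩ := ih
    obtain ⟨h, hh⟩ := key (n + 1)
    obtain ⟨c, hc⟩ := (Y (n + 1)).exists_isCompl
    obtain ⟨e, he⟩ : ∃ e : X →ₗ[k] Y (n + 1), ∀ y : Y (n + 1), e y = y :=
      ⟨(Y (n+1)).linearProjOfIsCompl c hc, fun y => Submodule.linearProjOfIsCompl_apply_left hc y⟩
    refine ⟨g ∘ₗ (LinearMap.id - (Y (n+1)).subtype ∘ₗ e) + (G (n+1)).subtype ∘ₗ h ∘ₗ e, ?_, ?_⟩
    · intro x
      simp [hg1, hh]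
    · intro j hj y hy
      rcases Nat.lt_or_ge n j with h1 | h1
      · obtain rfl : j = n + 1 := by omega
        have := he ⟨y, hy⟩
        simp only [LinearMap.add_apply, LinearMap.comp_apply, LinearMap.sub_apply, LinearMap.id_apply, this]
        simp
      · simp only [LinearMap.add_apply, LinearMap.comp_apply, LinearMap.sub_apply, LinearMap.id_apply]
        refine Submodule.add_mem _ (hg2 j h1 _ (Submodule.sub_mem _ hy (hY hj (e y).2))) (hG hj (h (e y)).2)

end flag

section chart
variable {k : Type u} [Field k]
variable {W : Type*} [AddCommGroup W] [Module k W] [Module k[T;T⁻¹] W] [IsScalarTower k k[T;T⁻¹] W]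
variable {V : Type*} [AddCommGroup V] [Module k V] [Module k[T;T⁻¹] V] [IsScalarTower k k[T;T⁻¹] V]
variable {V' : Type*} [AddCommGroup V'] [Module k V'] [Module k[T;T⁻¹] V'] [IsScalarTower k k[T;T⁻¹] V']

theorem Pos_decomp {e : ℤ} (he : e = 1 ∨ e = -1) {r : k[T;T⁻¹]} (hr : r ∈ Pos k e) :
    T (-e) * (r - r.coeff 0 • (1 : k[T;T⁻¹])) ∈ Pos k e := by
  rw [mem_Pos he] at hr ⊢
  intro n hn
  rw [coeff_T_mul, ← T_zero]
  simp only [AddMonoidAlgebra.coeff_sub, AddMonoidAlgebra.coeff_smul, Finsupp.sub_apply, Finsupp.smul_apply, T_apply]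
  by_cases h0 : 0 = n - -e
  · rw [if_pos h0, ← h0]; simp
  · rw [if_neg h0, hr]; simp
    rcases he with rfl | rfl <;> omega

namespace IsChart
variable {e p : ℤ} {L : ℤ → Submodule k W} (h : IsChart e p L)
include h

theorem one_sub_mem (r : k[T;T⁻¹]) (hr : r ∈ Pos k e) {w : W} {j} (hw : w ∈ L j) : (1 - r) • w ∈ L j :=
  h.pos_smul (Subalgebra.sub_mem _ (Subalgebra.one_mem _) hr) hw

theorem one_sub_iff (w : W) (j : ℤ) : (1 - T e : k[T;T⁻¹]) • w ∈ L j ↔ w ∈ L j := by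
  have hT : (T e : k[T;T⁻¹]) ∈ Pos k e := T_mem_Pos h.he (by rcases h.he with h | h <;> rw [h] <;> norm_num)
  refine ⟨fun hw => ?_, h.one_sub_mem _ hT⟩
  have key : ∀ n : ℕ, w ∈ L (j - p * n) → w ∈ L j := by
    intro n
    induction n with
    | zero => intro hw; simpa using hw
    | succ n ih =>
      intro h1
      apply ih
      have h2 := (h.shift w _).2 h1
      rw [show j - p * ((n + 1 : ℕ) : ℤ) + p = j - p * n by push_cast; ring] at h2
      have h3 : w = (1 - T e : k[T;T⁻¹]) • w + (T e : k[T;T⁻¹]) • w := by rw [← add_smul]; simp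
      rw [h3]
      refine Submodule.add_mem _ (h.anti _ _ ?_ hw) h2
      have := h.hp
      have : 0 ≤ p * n := by positivity
      linarith
  obtain ⟨i, hi⟩ := h.exh w
  refine key (j - i).toNat (h.anti _ _ ?_ hi)
  have := h.hp
  nlinarith [Int.self_le_toNat (j - i), Int.natCast_nonneg (j-i).toNat]

theorem preserve_of {L' : ℤ → Submodule k V} (h' : IsChart e p L') (f : W →ₗ[k[T;T⁻¹]] V) (d j0 : ℤ)
    (hf : ∀ i, j0 ≤ i → i < j0 + p → ∀ w ∈ L i, f w ∈ L' (i + d)) (i : ℤ) (w : W) (hw : w ∈ L i) :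
    f w ∈ L' (i + d) := by
  have hp := h.hp
  set q := (i - j0) / p
  have h1 := Int.emod_add_mul_ediv (i - j0) p
  have h2 := Int.emod_nonneg (i - j0) hp.ne'
  have h3 := Int.emod_lt_of_pos (i - j0) hp
  have h4 : (T (e * (-q)) : k[T;T⁻¹]) • w ∈ L (i + p * (-q)) := (h.shiftn _ _ _).2 hw
  have h5 := hf _ (by simp only [q]; linarith) (by simp only [q]; linarith) _ h4
  rw [map_smul, show i + p * -q + d = (i + d) + p * (-q) by ring, h'.shiftn] at h5
  exact h5

theorem eventually_hom (tf : TF k W) {L' : ℤ → Submodule k V} (h' : IsChart e p L') (f : W →ₗ[k[T;T⁻¹]] V) :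
    ∃ n : ℕ, ∀ n' : ℤ, n ≤ n' → ∀ i, ∀ w ∈ L i, (T (e * n') : k[T;T⁻¹]) • f w ∈ L' i := by
  obtain ⟨n, b, hb⟩ := h.basis tf 0
  choose m hm using fun i => h'.eventually (f (b i)) p
  refine ⟨∑ i, m i, fun n' hn' i w hw => ?_⟩
  have := h.preserve_of h' ((T (e * n') : k[T;T⁻¹]) • f) 0 0 ?_ i w hw
  · simpa using this
  intro i h0 h1 w hw
  have h2 := (hb w).1 (h.anti _ _ h0 hw)
  rw [← b.sum_repr w, map_sum]
  refine h'.anti _ p (by linarith) (Submodule.sum_mem _ fun a _ => ?_)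
  rw [map_smul]
  refine h'.pos_smul (h2 a) (hm a n' ?_)
  refine le_trans ?_ hn'
  exact_mod_cast Finset.single_le_sum (f := m) (fun _ _ => Nat.zero_le _) (Finset.mem_univ a)

/-- `(1 - t^n)`-trick -/
theorem inter_lift {MV : Submodule k[T;T⁻¹] W} {c : ℕ} (hM : ∀ w : W, ((1 - T 1 : k[T;T⁻¹]) ^ c) • w ∈ MV)
    (π : W →ₗ[k[T;T⁻¹]] V) {m l : W} {j : ℤ} (hm : m ∈ MV) (hl : l ∈ L j) (hml : π m = π l) :
    ∃ w ∈ MV, w ∈ L j ∧ π w = π l := by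
  obtain ⟨n, hn⟩ := h.eventually m j
  have hT : (T (e * n) : k[T;T⁻¹]) ∈ Pos k e := T_mem_Pos h.he (by rcases h.he with h | h <;> rw [h] <;> omega)
  set x : Pos k e := ⟨_, hT⟩
  obtain ⟨y, hy⟩ := sub_dvd_pow_sub_pow (1 : Pos k e) (1 - x) c
  have hy' : (1 : k[T;T⁻¹]) - (1 - T (e * n)) ^ c = (y : k[T;T⁻¹]) * T (e * n) := by
    have := congrArg Subtype.val hy
    simp [x] at this
    rw [this]
  refine ⟨((1 : k[T;T⁻¹]) - T (e * n)) ^ c • l + (y : k[T;T⁻¹]) • (T (e * n) : k[T;T⁻¹]) • m, ?_, ?_, ?_⟩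
  · refine MV.add_mem ?_ (MV.smul_mem _ (MV.smul_mem _ hm))
    obtain ⟨z, hz⟩ := one_sub_T_dvd (k := k) (e * n)
    rw [hz, mul_pow, mul_smul]
    exact hM _
  · refine Submodule.add_mem _ (h.pos_smul ?_ hl) (h.pos_smul y.2 (hn n le_rfl))
    exact Subalgebra.pow_mem _ (Subalgebra.sub_mem _ (Subalgebra.one_mem _) hT) _
  · rw [map_add, map_smul, map_smul, map_smul, hml, ← mul_smul, ← hy', ← add_smul]
    simp

end IsChart

theorem one_sub_Te_mem {MV : Submodule k[T;T⁻¹] V} (hM : ∀ w : V, ((1 - T 1 : k[T;T⁻¹])) • w ∈ MV) (n : ℤ) (w : V) :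
    (1 - T n : k[T;T⁻¹]) • w ∈ MV := by
  obtain ⟨z, hz⟩ := one_sub_T_dvd (k := k) n
  rw [hz, mul_smul]; exact hM _

theorem chart_lift {e p : ℤ} {LW : ℤ → Submodule k W} {LV : ℤ → Submodule k V} {LV' : ℤ → Submodule k V'}
    (hW : IsChart e p LW) (tf : TF k W) (hV : IsChart e p LV)
    (π : V →ₗ[k[T;T⁻¹]] V') (MW : Submodule k[T;T⁻¹] W) (MV : Submodule k[T;T⁻¹] V) (MV' : Submodule k[T;T⁻¹] V')
    (hMW : ∀ w : W, (1 - T 1 : k[T;T⁻¹]) • w ∈ MW) (hMV : ∀ w : V, (1 - T 1 : k[T;T⁻¹]) • w ∈ MV)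
    (hπM : ∀ w ∈ MV', ∃ m ∈ MV, π m = w) (hπL : ∀ j, ∀ w ∈ LV' j, ∃ m ∈ LV j, π m = w)
    (ν : W →ₗ[k[T;T⁻¹]] V') (hνM : ∀ w ∈ MW, ν w ∈ MV') (hνL : ∀ j, ∀ w ∈ LW j, ν w ∈ LV' j) :
    ∃ g : W →ₗ[k[T;T⁻¹]] V, (∀ w, π (g w) = ν w) ∧ (∀ w ∈ MW, g w ∈ MV) ∧ (∀ j, ∀ w ∈ LW j, g w ∈ LV j) := by
  obtain ⟨n, b, hb⟩ := hW.basis tf 0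
  have hp := hW.hp
  have hposT : (T e : k[T;T⁻¹]) ∈ Pos k e := T_mem_Pos hW.he (by rcases hW.he with h | h <;> rw [h] <;> norm_num)
  -- inclusion of the constant vectors
  let iX : (Fin n → k) →ₗ[k] W := Fintype.linearCombination k (fun i => (b i : W))
  have hiX : ∀ x, iX x = ∑ i, x i • b i := fun x => Fintype.linearCombination_apply _ _ _
  have hiX0 : ∀ x, iX x ∈ LW 0 := by
    intro x
    rw [hb, hiX]
    intro i
    have : ∑ i, x i • b i = ∑ i, (algebraMap k k[T;T⁻¹] (x i)) • b i := by simp only [algebraMap_smul]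
    rw [this, Module.Basis.repr_sum_self]
    exact Subalgebra.algebraMap_mem _ _
  let ext : ((Fin n → k) →ₗ[k] V) → (W →ₗ[k[T;T⁻¹]] V) := fun f => b.constr k (fun i => f (Pi.single i 1))
  have hext : ∀ f x, ext f (iX x) = f x := by
    intro f x
    rw [hiX, map_sum]
    conv_rhs => rw [show x = ∑ i, x i • (Pi.single i (1:k) : Fin n → k) by
      funext j; simp [Finset.sum_apply, Pi.single_apply]]
    rw [map_sum]
    refine Finset.sum_congr rfl fun i _ => ?_
    rw [← algebraMap_smul k[T;T⁻¹] (x i) (b i), map_smul, algebraMap_smul, map_smul]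
    simp [ext]
  have hextπ : ∀ f : (Fin n → k) →ₗ[k] V, (∀ x, π (f x) = ν (iX x)) → ∀ w, π (ext f w) = ν w := by
    intro f hf w
    have : π ∘ₗ ext f = ν := by
      refine b.ext fun i => ?_
      simp only [LinearMap.comp_apply, ext, Module.Basis.constr_basis, hf]
      congr 1
      rw [hiX]
      simp [Pi.single_apply]
    exact LinearMap.congr_fun this w
  have hd1 : ∀ w ∈ LW 0, ∃ x, ∃ w' ∈ LW 0, w = iX x + (T e : k[T;T⁻¹]) • w' := by
    intro w hw
    have h1 := (hb w).1 hw
    refine ⟨fun i => (b.repr w i).coeff 0, (T (-e) : k[T;T⁻¹]) • (w - iX fun i => (b.repr w i).coeff 0), ?_, ?_⟩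
    · rw [hb]
      intro i
      have h2 := Pos_decomp hW.he (h1 i)
      convert h2 using 1
      rw [map_smul, map_sub, hiX]
      simp only [Finsupp.smul_apply, Finsupp.sub_apply, smul_eq_mul]
      congr 2
      have : ∑ i, (b.repr w i).coeff 0 • b i = ∑ i, ((b.repr w i).coeff 0 • (1:k[T;T⁻¹])) • b i := by simp
      rw [this, Module.Basis.repr_sum_self]
    · rw [T_smul_smul]; simp
  have hd2 : ∀ w, ∃ x w', w = iX x + (1 - T 1 : k[T;T⁻¹]) • w' := by
    intro w
    choose c hc using fun i => dvd_sub_ev1 (b.repr w i)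
    refine ⟨fun i => ev1 (b.repr w i), ∑ i, c i • b i, ?_⟩
    rw [hiX, Finset.smul_sum, ← Finset.sum_add_distrib]
    conv_lhs => rw [← b.sum_repr w]
    refine Finset.sum_congr rfl fun i _ => ?_
    rw [← mul_smul, ← hc i, sub_smul]
    simp
  let πk : V →ₗ[k] V' := π.restrictScalars k
  let νk : (Fin n → k) →ₗ[k] V' := (ν.restrictScalars k) ∘ₗ iX
  obtain ⟨fa, ha1, ha2⟩ := flag_lift πk νk (fun j => (LW j).comap iX) (fun j => LV j)
    (fun i j hij => Submodule.comap_mono (hW.anti _ _ (by exact_mod_cast hij)))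
    (fun i j hij => hV.anti _ _ (by exact_mod_cast hij))
    (by ext x; simp [hiX0]) (fun j y hy => hπL j _ (hνL _ _ hy)) p.toNat
  obtain ⟨fb, hb1, hb2⟩ := flag_lift πk νk (fun j => if j = 0 then ⊤ else (MW.restrictScalars k).comap iX)
    (fun j => if j = 0 then LV 0 else LV 0 ⊓ MV.restrictScalars k)
    (by intro i j hij; by_cases h0 : i = 0
        · simp [h0]
        · simp only [if_neg h0, if_neg (show ¬ j = 0 by omega)]; exact le_rfl)
    (by intro i j hij; by_cases h0 : i = 0
        · by_cases h1 : j = 0 <;> simp [h0, h1]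
        · simp only [if_neg h0, if_neg (show ¬ j = 0 by omega)]; exact le_rfl)
    (by simp)
    (by
      intro j y hy
      obtain ⟨l, hl, hl'⟩ := hπL 0 _ (hνL _ _ (hiX0 y))
      by_cases h0 : j = 0
      · exact ⟨l, by simpa [h0] using hl, hl'⟩
      · simp only [if_neg h0] at hy ⊢
        obtain ⟨m, hm, hm'⟩ := hπM _ (hνM _ hy)
        obtain ⟨w, hw1, hw2, hw3⟩ := hV.inter_lift (c := 1) (by simpa using hMV) π hm hl (by rw [hm', hl'])
        exact ⟨w, ⟨hw2, hw1⟩, hw3.trans hl'⟩) 1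
  have hbL0 : ∀ x, fb x ∈ LV 0 := fun x => by simpa using hb2 0 (by omega) x (by simp)
  have haL0 : ∀ x, fa x ∈ LV 0 := fun x => by simpa using ha2 0 (by omega) x (by simp [hiX0])
  have hext0 : ∀ f : (Fin n → k) →ₗ[k] V, (∀ x, f x ∈ LV 0) → ∀ w ∈ LW 0, ext f w ∈ LV 0 := by
    intro f hf w hw
    rw [← b.sum_repr w, map_sum]
    refine Submodule.sum_mem _ fun i _ => ?_
    rw [map_smul]
    refine hV.pos_smul ((hb w).1 hw i) ?_
    simp only [ext, Module.Basis.constr_basis, hf]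
  have hshift : ∀ v ∈ LV 0, (T e : k[T;T⁻¹]) • v ∈ LV p := by
    intro v hv
    have := (hV.shift v 0).2 hv
    rwa [zero_add] at this
  have haL : ∀ j, ∀ w ∈ LW j, ext fa w ∈ LV j := by
    intro j w hw
    have := hW.preserve_of hV (ext fa) 0 0 ?_ j w hw
    · simpa using this
    intro i hi0 hip w hw
    obtain ⟨x, w', hw', rfl⟩ := hd1 w (hW.anti _ _ hi0 hw)
    have h1 : iX x ∈ LW i := by
      have h2 := (hW.shift w' 0).2 hw'
      have := Submodule.sub_mem _ hw (hW.anti i _ (by linarith) h2)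
      simpa using this
    rw [map_add, hext, map_smul, add_zero]
    refine Submodule.add_mem _ ?_ (hV.anti _ _ (by linarith) (hshift _ (hext0 fa haL0 _ hw')))
    have := ha2 i.toNat (by omega) x
    rw [Int.toNat_of_nonneg hi0] at this
    exact this h1
  refine ⟨(1 - T e : k[T;T⁻¹]) • ext fa + (T e : k[T;T⁻¹]) • ext fb, ?_, ?_, ?_⟩
  · intro w
    simp only [LinearMap.add_apply, LinearMap.smul_apply, map_add, map_smul]
    rw [hextπ fa ha1, hextπ fb hb1, ← add_smul]
    simp
  · intro w hw
    simp only [LinearMap.add_apply, LinearMap.smul_apply]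
    refine MV.add_mem (one_sub_Te_mem hMV _ _) (MV.smul_mem _ ?_)
    obtain ⟨x, w', rfl⟩ := hd2 w
    rw [map_add, hext, map_smul]
    refine MV.add_mem ?_ (hMV _)
    have h1 : iX x ∈ MW := by
      have := MW.sub_mem hw (hMW w')
      simpa using this
    have := hb2 1 le_rfl x (by simpa using h1)
    simp only [one_ne_zero, if_false] at this
    exact this.2
  · intro j w hw
    have := hW.preserve_of hV ((1 - T e : k[T;T⁻¹]) • ext fa + (T e : k[T;T⁻¹]) • ext fb) 0 0 ?_ j w hw
    · simpa using this
    intro i hi0 hip w hw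
    simp only [LinearMap.add_apply, LinearMap.smul_apply, add_zero]
    refine Submodule.add_mem _ (hV.one_sub_mem _ hposT (haL i w hw)) ?_
    exact hV.anti _ _ (by linarith) (hshift _ (hext0 fb hbL0 _ (hW.anti _ _ hi0 hw)))

end chart
end Stm

namespace Stm
open LaurentPolynomial

section pb
variable {k : Type u} [Field k]
variable {P : Type u} [AddCommGroup P] [Module k P] [Module k[T;T⁻¹] P] [IsScalarTower k k[T;T⁻¹] P]
variable {W : Type u} [AddCommGroup W] [Module k W] [Module k[T;T⁻¹] W] [IsScalarTower k k[T;T⁻¹] W]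
variable {A : Type u} [AddCommGroup A] [Module k A] [Module k[T;T⁻¹] A] [IsScalarTower k k[T;T⁻¹] A]
variable {V : Type u} [AddCommGroup V] [Module k V] [Module k[T;T⁻¹] V] [IsScalarTower k k[T;T⁻¹] V]

structure PB (k : Type u) [Field k] (W : Type u) [AddCommGroup W] [Module k W] [Module k[T;T⁻¹] W]
    [IsScalarTower k k[T;T⁻¹] W] where
  M1 : Submodule k[T;T⁻¹] W
  L : ℤ → Submodule k W
  N : ℤ → Submodule k W
  tf : TF k W
  hM : ∀ w : W, (1 - T 1 : k[T;T⁻¹]) • w ∈ M1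
  hL : IsChart 1 3 L
  hN : IsChart (-1) 6 N

/-- saturated submodules -/
def Sat (Q : Submodule k[T;T⁻¹] W) : Prop := ∀ (r : k[T;T⁻¹]) (w : W), r ≠ 0 → r • w ∈ Q → w ∈ Q

theorem Sat.tf {Q : Submodule k[T;T⁻¹] W} (hQ : Sat Q) : TF k (W ⧸ Q) := by
  intro r w hw
  obtain ⟨w, rfl⟩ := Q.mkQ_surjective w
  by_cases hr : r = 0
  · exact Or.inl hr
  · right
    rw [← map_smul] at hw
    simp only [Submodule.mkQ_apply, Submodule.Quotient.mk_eq_zero] at hw ⊢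
    exact hQ r w hr hw

theorem IsChart.pull {e p : ℤ} {L : ℤ → Submodule k W} (h : IsChart e p L) (ι : P →ₗ[k[T;T⁻¹]] W)
    (hι : Function.Injective ι) : IsChart e p (fun j => (L j).comap (ι.restrictScalars k)) where
  he := h.he
  hp := h.hp
  anti := fun i j hij => Submodule.comap_mono (h.anti i j hij)
  shift := fun w j => by
    simp only [Submodule.mem_comap, LinearMap.restrictScalars_apply, map_smul]
    exact h.shift _ _
  exh := fun w => h.exh (ι w)
  fg := fun j => by
    obtain ⟨S, hS⟩ := h.fg j
    haveI := Pos_noeth (k := k) e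
    set Nn := Submodule.span (Pos k e) (S : Set W)
    haveI : IsNoetherian (Pos k e) Nn := isNoetherian_span_of_finite _ S.finite_toSet
    let ι' : P →ₗ[Pos k e] W := ι.restrictScalars (Pos k e)
    let Q := Nn.comap ι'
    let f : Q →ₗ[Pos k e] Nn := (ι'.domRestrict Q).codRestrict Nn (fun x => x.2)
    have hf : Function.Injective f := by
      intro x y hxy
      exact Subtype.ext (hι (congrArg Subtype.val hxy))
    haveI : IsNoetherian (Pos k e) Q := isNoetherian_of_injective f hf
    have hfg : Q.FG := Module.Finite.iff_fg.1 inferInstance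
    obtain ⟨S', hS'⟩ := hfg
    refine ⟨S', fun w hw => ?_⟩
    rw [hS']
    exact hS _ hw

theorem IsChart.push {e p : ℤ} {L : ℤ → Submodule k W} (h : IsChart e p L) (π : W →ₗ[k[T;T⁻¹]] A)
    (hπ : Function.Surjective π) : IsChart e p (fun j => (L j).map (π.restrictScalars k)) where
  he := h.he
  hp := h.hp
  anti := fun i j hij => Submodule.map_mono (h.anti i j hij)
  shift := fun w j => by
    constructor
    · rintro ⟨x, hx, hxw⟩
      refine ⟨(T (-e) : k[T;T⁻¹]) • x, ?_, ?_⟩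
      · refine (h.shift _ j).1 ?_
        rw [T_smul_smul]; simpa using hx
      · simp only [LinearMap.restrictScalars_apply, map_smul] at hxw ⊢
        rw [hxw, T_smul_smul]; simp
    · rintro ⟨x, hx, rfl⟩
      exact ⟨(T e : k[T;T⁻¹]) • x, (h.shift _ j).2 hx, by simp⟩
  exh := fun w => by
    obtain ⟨w, rfl⟩ := hπ w
    obtain ⟨j, hj⟩ := h.exh w
    exact ⟨j, w, hj, rfl⟩
  fg := fun j => by
    classical
    obtain ⟨S, hS⟩ := h.fg j
    refine ⟨S.image π, ?_⟩
    rintro _ ⟨w, hw, rfl⟩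
    have := Submodule.mem_map_of_mem (f := π.restrictScalars (Pos k e)) (hS w hw)
    rw [Submodule.map_span] at this
    simpa using this

namespace PB

noncomputable def pull (E : PB k W) (ι : P →ₗ[k[T;T⁻¹]] W) (hι : Function.Injective ι) : PB k P where
  M1 := E.M1.comap ι
  L := fun j => (E.L j).comap (ι.restrictScalars k)
  N := fun j => (E.N j).comap (ι.restrictScalars k)
  tf := fun r w hw => by
    have := E.tf r (ι w) (by rw [← map_smul, hw, map_zero])
    rwa [map_eq_zero_iff ι hι] at this
  hM := fun w => by
    rw [Submodule.mem_comap, map_smul]; exact E.hM _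
  hL := E.hL.pull ι hι
  hN := E.hN.pull ι hι

noncomputable def push (E : PB k W) (π : W →ₗ[k[T;T⁻¹]] A) (hπ : Function.Surjective π) (htf : TF k A) : PB k A where
  M1 := E.M1.map π
  L := fun j => (E.L j).map (π.restrictScalars k)
  N := fun j => (E.N j).map (π.restrictScalars k)
  tf := htf
  hM := fun w => by
    obtain ⟨w, rfl⟩ := hπ w
    exact ⟨_, E.hM w, by simp⟩
  hL := E.hL.push π hπ
  hN := E.hN.push π hπ

noncomputable def sub (E : PB k W) (Q : Submodule k[T;T⁻¹] W) : PB k Q := E.pull Q.subtype Q.injective_subtype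

noncomputable def quot (E : PB k W) (Q : Submodule k[T;T⁻¹] W) (hQ : Sat Q) : PB k (W ⧸ Q) :=
  E.push Q.mkQ Q.mkQ_surjective hQ.tf

noncomputable def Mc (E : PB k W) : ℕ → Submodule k[T;T⁻¹] W
  | 0 => ⊤
  | 1 => E.M1
  | (n + 2) => (E.Mc n).map (LinearMap.lsmul k[T;T⁻¹] W (1 - T 1))

theorem one_sub_inj (E : PB k W) {v w : W} (h : (1 - T 1 : k[T;T⁻¹]) • v = (1 - T 1 : k[T;T⁻¹]) • w) : v = w := by
  have := E.tf (1 - T 1) (v - w) (by rw [smul_sub, h, sub_self])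
  rcases this with h | h
  · exact absurd h one_sub_T_ne_zero
  · exact sub_eq_zero.1 h

theorem mem_Mc_add_two (E : PB k W) (n : ℕ) (w : W) :
    w ∈ E.Mc (n + 2) ↔ ∃ v ∈ E.Mc n, (1 - T 1 : k[T;T⁻¹]) • v = w := by
  rw [Mc]; rfl

theorem smul_mem_Mc (E : PB k W) (n : ℕ) (w : W) : (1 - T 1 : k[T;T⁻¹]) • w ∈ E.Mc (n + 2) ↔ w ∈ E.Mc n := by
  rw [mem_Mc_add_two]
  constructor
  · rintro ⟨v, hv, h⟩
    rwa [← E.one_sub_inj h]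
  · exact fun h => ⟨w, h, rfl⟩

theorem Mc_succ_le (E : PB k W) (n : ℕ) : E.Mc (n + 1) ≤ E.Mc n := by
  induction n using Nat.twoStepInduction with
  | zero => exact le_top
  | one =>
    intro w hw
    obtain ⟨v, _, rfl⟩ := (E.mem_Mc_add_two 0 w).1 hw
    exact E.hM v
  | more n ih _ =>
    intro w hw
    obtain ⟨v, hv, rfl⟩ := (E.mem_Mc_add_two _ w).1 hw
    exact (E.smul_mem_Mc _ _).2 (ih hv)

theorem pow_mem_Mc (E : PB k W) (n : ℕ) (w : W) : ((1 - T 1 : k[T;T⁻¹]) ^ n) • w ∈ E.Mc n := by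
  have h2 : ∀ n (w : W), ((1 - T 1 : k[T;T⁻¹]) ^ n) • w ∈ E.Mc (2 * n) := by
    intro n
    induction n with
    | zero => intro w; exact Submodule.mem_top
    | succ n ih =>
      intro w
      rw [pow_succ', mul_smul]
      exact (E.smul_mem_Mc (2 * n) _).2 (ih w)
  exact (antitone_nat_of_succ_le E.Mc_succ_le) (by omega : n ≤ 2 * n) (h2 n w)

theorem finite (E : PB k W) : Module.Finite k[T;T⁻¹] W := by
  obtain ⟨n, b, _⟩ := E.hL.basis E.tf 0
  exact Module.Finite.of_basis b

structure IsHom (e : ℕ) (E : PB k W) (F : PB k V) (g : W →ₗ[k[T;T⁻¹]] V) : Prop where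
  M : ∀ n, ∀ w ∈ E.Mc n, g w ∈ F.Mc (n + e)
  L : ∀ j, ∀ w ∈ E.L j, g w ∈ F.L (j - 2 * e)
  N : ∀ i, ∀ w ∈ E.N i, g w ∈ F.N (i + e)

theorem isHom_M_of {e : ℕ} {E : PB k W} {F : PB k V} {g : W →ₗ[k[T;T⁻¹]] V}
    (h0 : ∀ w, g w ∈ F.Mc e) (h1 : ∀ w ∈ E.M1, g w ∈ F.Mc (1 + e)) (n : ℕ) : ∀ w ∈ E.Mc n, g w ∈ F.Mc (n + e) := by
  induction n using Nat.twoStepInduction with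
  | zero => intro w _; rw [zero_add]; exact h0 w
  | one => exact h1
  | more n ih _ =>
    intro w hw
    obtain ⟨v, hv, rfl⟩ := (E.mem_Mc_add_two _ w).1 hw
    rw [map_smul, show n + 2 + e = n + e + 2 by ring]
    exact (F.smul_mem_Mc _ _).2 (ih v hv)

theorem isHom0_iff {E : PB k W} {F : PB k V} {g : W →ₗ[k[T;T⁻¹]] V} :
    IsHom 0 E F g ↔ (∀ w ∈ E.M1, g w ∈ F.M1) ∧ (∀ j, ∀ w ∈ E.L j, g w ∈ F.L j) ∧ (∀ i, ∀ w ∈ E.N i, g w ∈ F.N i) := by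
  constructor
  · intro h
    exact ⟨h.M 1, by simpa using h.L, by simpa using h.N⟩
  · rintro ⟨h1, h2, h3⟩
    exact ⟨isHom_M_of (fun _ => Submodule.mem_top) h1, by simpa using h2, by simpa using h3⟩

structure SMono (E : PB k P) (F : PB k W) (ι : P →ₗ[k[T;T⁻¹]] W) : Prop where
  inj : Function.Injective ι
  M : ∀ p, ι p ∈ F.M1 ↔ p ∈ E.M1
  L : ∀ j p, ι p ∈ F.L j ↔ p ∈ E.L j
  N : ∀ j p, ι p ∈ F.N j ↔ p ∈ E.N j

structure SEpi (E : PB k W) (F : PB k A) (π : W →ₗ[k[T;T⁻¹]] A) : Prop where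
  surj : Function.Surjective π
  M : ∀ a, a ∈ F.M1 ↔ ∃ w ∈ E.M1, π w = a
  L : ∀ j a, a ∈ F.L j ↔ ∃ w ∈ E.L j, π w = a
  N : ∀ j a, a ∈ F.N j ↔ ∃ w ∈ E.N j, π w = a

structure SES (EP : PB k P) (EW : PB k W) (EA : PB k A) (ι : P →ₗ[k[T;T⁻¹]] W) (π : W →ₗ[k[T;T⁻¹]] A) : Prop where
  mono : SMono EP EW ι
  epi : SEpi EW EA π
  exact : ∀ w, π w = 0 ↔ ∃ p, ι p = w

theorem SMono.isHom {E : PB k P} {F : PB k W} {ι : P →ₗ[k[T;T⁻¹]] W} (h : SMono E F ι) : IsHom 0 E F ι :=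
  isHom0_iff.2 ⟨fun w => (h.M w).2, fun j w => (h.L j w).2, fun j w => (h.N j w).2⟩

theorem SEpi.isHom {E : PB k W} {F : PB k A} {π : W →ₗ[k[T;T⁻¹]] A} (h : SEpi E F π) : IsHom 0 E F π :=
  isHom0_iff.2 ⟨fun w hw => (h.M _).2 ⟨w, hw, rfl⟩, fun j w hw => (h.L j _).2 ⟨w, hw, rfl⟩,
    fun j w hw => (h.N j _).2 ⟨w, hw, rfl⟩⟩

theorem pull_smono (E : PB k W) (ι : P →ₗ[k[T;T⁻¹]] W) (hι : Function.Injective ι) : SMono (E.pull ι hι) E ι :=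
  ⟨hι, fun _ => Iff.rfl, fun _ _ => Iff.rfl, fun _ _ => Iff.rfl⟩

theorem push_sepi (E : PB k W) (π : W →ₗ[k[T;T⁻¹]] A) (hπ : Function.Surjective π) (htf : TF k A) :
    SEpi E (E.push π hπ htf) π :=
  ⟨hπ, fun _ => Iff.rfl, fun _ _ => Iff.rfl, fun _ _ => Iff.rfl⟩

theorem sub_smono (E : PB k W) (Q : Submodule k[T;T⁻¹] W) : SMono (E.sub Q) E Q.subtype := pull_smono _ _ _

theorem quot_sepi (E : PB k W) (Q : Submodule k[T;T⁻¹] W) (hQ : Sat Q) : SEpi E (E.quot Q hQ) Q.mkQ := push_sepi _ _ _ _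

theorem ses (E : PB k W) (Q : Submodule k[T;T⁻¹] W) (hQ : Sat Q) :
    SES (E.sub Q) E (E.quot Q hQ) Q.subtype Q.mkQ :=
  ⟨E.sub_smono Q, E.quot_sepi Q hQ, fun w => by simp⟩

theorem SES.Mmono {EP : PB k P} {EW : PB k W} {EA : PB k A} {ι : P →ₗ[k[T;T⁻¹]] W} {π : W →ₗ[k[T;T⁻¹]] A}
    (h : SES EP EW EA ι π) (n : ℕ) : ∀ p, ι p ∈ EW.Mc n ↔ p ∈ EP.Mc n := by
  induction n using Nat.twoStepInduction with
  | zero => intro p; exact ⟨fun _ => Submodule.mem_top, fun _ => Submodule.mem_top⟩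
  | one => exact h.mono.M
  | more n ih _ =>
    intro p
    refine ⟨fun hp => ?_, h.mono.isHom.M (n + 2) p⟩
    obtain ⟨v, hv, hvp⟩ := (EW.mem_Mc_add_two _ _).1 hp
    have h1 : π v = 0 := by
      refine EA.one_sub_inj ?_
      rw [← map_smul, hvp, smul_zero, h.exact]
      exact ⟨p, rfl⟩
    obtain ⟨q, rfl⟩ := (h.exact v).1 h1
    rw [← map_smul] at hvp
    rw [← h.mono.inj hvp, EP.smul_mem_Mc]
    exact (ih q).1 hv

theorem SEpi.Mc {E : PB k W} {F : PB k A} {π : W →ₗ[k[T;T⁻¹]] A} (h : SEpi E F π) (n : ℕ) :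
    ∀ a, a ∈ F.Mc n ↔ ∃ w ∈ E.Mc n, π w = a := by
  induction n using Nat.twoStepInduction with
  | zero => intro a; exact ⟨fun _ => (h.surj a).imp fun w hw => ⟨Submodule.mem_top, hw⟩, fun _ => Submodule.mem_top⟩
  | one => exact h.M
  | more n ih _ =>
    intro a
    rw [F.mem_Mc_add_two]
    constructor
    · rintro ⟨v, hv, rfl⟩
      obtain ⟨w, hw, rfl⟩ := (ih v).1 hv
      exact ⟨(1 - T 1 : k[T;T⁻¹]) • w, (E.smul_mem_Mc _ _).2 hw, by simp⟩
    · rintro ⟨w, hw, rfl⟩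
      obtain ⟨v, hv, rfl⟩ := (E.mem_Mc_add_two _ _).1 hw
      exact ⟨π v, (ih _).2 ⟨v, hv, rfl⟩, by simp⟩

noncomputable def coeffL (n : ℤ) : k[T;T⁻¹] →ₗ[k] k where
  toFun r := r.coeff n
  map_add' _ _ := rfl
  map_smul' _ _ := rfl

theorem fd (E : PB k W) (j i : ℤ) : FiniteDimensional k (E.L j ⊓ E.N i : Submodule k W) := by
  classical
  obtain ⟨n, b, hb⟩ := E.hL.basis E.tf j
  obtain ⟨S, hS⟩ := E.hN.fg i
  choose m hm using fun (x : W × Fin n) => exists_T_mul_mem_Pos (k := k) (e := -1) (Or.inr rfl) (b.repr x.1 x.2)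
  set M := ∑ x ∈ S ×ˢ Finset.univ, m x
  have hM : ∀ w ∈ E.N i, ∀ a, T (-1 * M) * b.repr w a ∈ Pos k (-1) := by
    intro w hw a
    have := hS w hw
    clear hw
    induction this using Submodule.span_induction with
    | mem x hx =>
      exact hm (x, a) M (Finset.single_le_sum (f := m) (fun _ _ => Nat.zero_le _) (by simpa using hx))
    | zero => simp
    | add x y _ _ h1 h2 =>
      rw [map_add, Finsupp.add_apply, mul_add]
      exact Subalgebra.add_mem _ h1 h2
    | smul r x _ h1 =>
      have : b.repr (r • x) a = (r : k[T;T⁻¹]) * b.repr x a := by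
        rw [Subalgebra.smul_def, map_smul, Finsupp.smul_apply, smul_eq_mul]
      rw [this, mul_left_comm]
      exact Subalgebra.mul_mem _ r.2 h1
  let f : (E.L j ⊓ E.N i : Submodule k W) →ₗ[k] (Fin n → Fin (M + 1) → k) :=
    LinearMap.pi fun a => LinearMap.pi fun c => coeffL (c : ℤ) ∘ₗ (Finsupp.lapply (R := k) a) ∘ₗ (b.repr.toLinearMap.restrictScalars k) ∘ₗ Submodule.subtype _
  refine FiniteDimensional.of_injective f ?_
  rw [injective_iff_map_eq_zero]
  intro w hw
  apply Subtype.ext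
  apply b.repr.injective
  ext a c
  rw [Submodule.coe_zero, map_zero]
  rcases lt_or_ge c 0 with hc | hc
  · exact (mem_Pos (Or.inl rfl) _).1 ((hb w).1 w.2.1 a) c (by linarith)
  rcases lt_or_ge (M:ℤ) c with hc2 | hc2
  · have := (mem_Pos (Or.inr rfl) _).1 (hM w w.2.2 a) (c - M) (by linarith)
    rw [coeff_T_mul] at this
    simpa using this
  · have := congrFun (congrFun hw a) ⟨c.toNat, by omega⟩
    simp only [f, LinearMap.pi_apply, LinearMap.comp_apply, coeffL] at this
    simpa [hc] using this

end PB
end pb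
end Stm

namespace Stm
open LaurentPolynomial

section ext
variable {k : Type u} [Field k]
variable {P : Type u} [AddCommGroup P] [Module k P] [Module k[T;T⁻¹] P] [IsScalarTower k k[T;T⁻¹] P]
variable {W : Type u} [AddCommGroup W] [Module k W] [Module k[T;T⁻¹] W] [IsScalarTower k k[T;T⁻¹] W]
variable {A : Type u} [AddCommGroup A] [Module k A] [Module k[T;T⁻¹] A] [IsScalarTower k k[T;T⁻¹] A]
variable {V : Type u} [AddCommGroup V] [Module k V] [Module k[T;T⁻¹] V] [IsScalarTower k k[T;T⁻¹] V]

/-- extension along one chart -/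
theorem chart_ext {e p : ℤ} {LP : ℤ → Submodule k P} {LW : ℤ → Submodule k W} {LA : ℤ → Submodule k A}
    {LV : ℤ → Submodule k V}
    (hW : IsChart e p LW) (hA : IsChart e p LA) (tf : TF k A) (ι : P →ₗ[k[T;T⁻¹]] W) (π : W →ₗ[k[T;T⁻¹]] A)
    (MP : Submodule k[T;T⁻¹] P) (MW : Submodule k[T;T⁻¹] W) (MA : Submodule k[T;T⁻¹] A) (MV : Submodule k[T;T⁻¹] V)
    (hMA : ∀ w : A, (1 - T 1 : k[T;T⁻¹]) • w ∈ MA) (hMW : ∀ w : W, (1 - T 1 : k[T;T⁻¹]) • w ∈ MW)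
    (hinj : Function.Injective ι) (hex : ∀ w, π w = 0 ↔ ∃ p, ι p = w)
    (hιM : ∀ p, ι p ∈ MW → p ∈ MP) (hιL : ∀ j p, ι p ∈ LW j → p ∈ LP j)
    (hπM : ∀ a, a ∈ MA ↔ ∃ m ∈ MW, π m = a) (hπL : ∀ j a, a ∈ LA j ↔ ∃ m ∈ LW j, π m = a)
    (φ : P →ₗ[k[T;T⁻¹]] V) (hφM : ∀ p ∈ MP, φ p ∈ MV) (hφL : ∀ j, ∀ p ∈ LP j, φ p ∈ LV j) :
    ∃ μ : W →ₗ[k[T;T⁻¹]] V, (∀ p, μ (ι p) = φ p) ∧ (∀ w ∈ MW, μ w ∈ MV) ∧ (∀ j, ∀ w ∈ LW j, μ w ∈ LV j) := by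
  obtain ⟨σ, h1, h2, h3⟩ := chart_lift hA tf hW π MA MW MA hMA hMW (fun a => (hπM a).1) (fun j a => (hπL j a).1)
    LinearMap.id (fun _ h => h) (fun _ _ h => h)
  let δ : W →ₗ[k[T;T⁻¹]] W := LinearMap.id - σ ∘ₗ π
  have hδ : ∀ w, δ w = w - σ (π w) := fun w => rfl
  have hδr : ∀ w, δ w ∈ LinearMap.range ι := by
    intro w
    rw [LinearMap.mem_range, ← hex, hδ, map_sub, h1]; simp
  let ρ : W →ₗ[k[T;T⁻¹]] P := (LinearEquiv.ofInjective ι hinj).symm.toLinearMap ∘ₗ δ.codRestrict _ hδr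
  have hρ : ∀ w, ι (ρ w) = w - σ (π w) := by
    intro w
    have := congrArg Subtype.val ((LinearEquiv.ofInjective ι hinj).apply_symm_apply (δ.codRestrict _ hδr w))
    exact this
  refine ⟨φ ∘ₗ ρ, fun p => ?_, fun w hw => hφM _ (hιM _ ?_), fun j w hw => hφL _ _ (hιL _ _ ?_)⟩
  · have : ρ (ι p) = p := by
      apply hinj
      rw [hρ, (hex (ι p)).2 ⟨p, rfl⟩]; simp
    simp [this]
  · rw [hρ]
    exact MW.sub_mem hw (h2 _ ((hπM _).2 ⟨w, hw, rfl⟩))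
  · rw [hρ]
    exact Submodule.sub_mem _ hw (h3 _ _ ((hπL _ _).2 ⟨w, hw, rfl⟩))

theorem factor_through (ι : P →ₗ[k[T;T⁻¹]] W) (π : W →ₗ[k[T;T⁻¹]] A) (hπ : Function.Surjective π)
    (hex : ∀ w, π w = 0 ↔ ∃ p, ι p = w) (θ : W →ₗ[k[T;T⁻¹]] V) (h : ∀ p, θ (ι p) = 0) :
    ∃ θ' : A →ₗ[k[T;T⁻¹]] V, ∀ w, θ' (π w) = θ w := by
  have hk : LinearMap.ker π ≤ LinearMap.ker θ := by
    intro w hw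
    obtain ⟨p, rfl⟩ := (hex w).1 hw
    exact h p
  refine ⟨(LinearMap.ker π).liftQ θ hk ∘ₗ (π.quotKerEquivOfSurjective hπ).symm.toLinearMap, fun w => ?_⟩
  have : (π.quotKerEquivOfSurjective hπ).symm (π w) = (LinearMap.ker π).mkQ w := by
    rw [LinearEquiv.symm_apply_eq]; rfl
  simp [this]

/-- maps preserving the `M`- and one chart structure -/
def HomC (MA : Submodule k[T;T⁻¹] A) (MV : Submodule k[T;T⁻¹] V) (LA : ℤ → Submodule k A) (LV : ℤ → Submodule k V) :
    Submodule k (A →ₗ[k[T;T⁻¹]] V) where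
  carrier := {h | (∀ a ∈ MA, h a ∈ MV) ∧ ∀ j, ∀ a ∈ LA j, h a ∈ LV j}
  add_mem' := fun ha hb => ⟨fun a h => MV.add_mem (ha.1 a h) (hb.1 a h), fun j a h => (LV j).add_mem (ha.2 j a h) (hb.2 j a h)⟩
  zero_mem' := ⟨fun a _ => MV.zero_mem, fun j a _ => (LV j).zero_mem⟩
  smul_mem' := fun c f hf => ⟨fun a h => by
      have := (MV.restrictScalars k).smul_mem c (hf.1 a h)
      exact this, fun j a h => (LV j).smul_mem c (hf.2 j a h)⟩

theorem mk_laurent (f : ℤ → k) (n : ℕ) (hf1 : ∀ m : ℤ, n ≤ m → f m = 0) (hf2 : ∀ m : ℤ, m ≤ -n → f m = 0) :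
    ∃ r : k[T;T⁻¹], ∀ m, r.coeff m = f m := by
  classical
  have : (Function.support f).Finite := by
    refine (Set.finite_Ioo (-n : ℤ) n).subset fun m hm => ?_
    constructor
    · by_contra h
      exact hm (hf2 m (not_lt.1 h))
    · by_contra h
      exact hm (hf1 m (not_lt.1 h))
  exact ⟨AddMonoidAlgebra.ofCoeff (Finsupp.ofSupportFinite f this), fun m => rfl⟩

theorem laurent_ext {r s : k[T;T⁻¹]} (h : ∀ n, r.coeff n = s.coeff n) : r = s := by
  ext n; exact h n

section res
variable (EA : PB k A) (F : PB k V) (ψ : (A →ₗ[k[T;T⁻¹]] V) →ₗ[k] k)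
  (h1 : ∀ h ∈ HomC EA.M1 F.M1 EA.L F.L, ψ h = 0) (h2 : ∀ h ∈ HomC EA.M1 F.M1 EA.N F.N, ψ h = 0)
include h1 h2

theorem res_fin (h : A →ₗ[k[T;T⁻¹]] V) (hM : ∀ a ∈ EA.M1, h a ∈ F.M1) :
    ∃ s : k[T;T⁻¹], ∀ n, s.coeff n = ψ ((T (- n - 1) : k[T;T⁻¹]) • h) := by
  obtain ⟨n1, hn1⟩ := EA.hL.eventually_hom EA.tf F.hL h
  obtain ⟨n2, hn2⟩ := EA.hN.eventually_hom EA.tf F.hN h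
  refine mk_laurent _ (n1 + n2 + 1) (fun m hm => h2 _ ⟨?_, ?_⟩) (fun m hm => h1 _ ⟨?_, ?_⟩)
  · intro a ha; exact F.M1.smul_mem _ (hM a ha)
  · intro j a ha
    have := hn2 (m + 1) (by push_cast at hm; omega) j a ha
    rwa [show -1 * (m + 1) = - m - 1 by ring] at this
  · intro a ha; exact F.M1.smul_mem _ (hM a ha)
  · intro j a ha
    have := hn1 (- m - 1) (by push_cast at hm; omega) j a ha
    rwa [one_mul] at this

theorem res_exists : ∃ Res : (A →ₗ[k[T;T⁻¹]] V) →ₗ[k[T;T⁻¹]] k[T;T⁻¹],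
    ∀ h n, (Res h).coeff n = ψ ((T (- n - 1) : k[T;T⁻¹]) • (1 - T 1 : k[T;T⁻¹]) • h) := by
  have := fun h : A →ₗ[k[T;T⁻¹]] V => res_fin EA F ψ h1 h2 ((1 - T 1 : k[T;T⁻¹]) • h) (fun a _ => F.hM _)
  choose f hf using this
  have hadd : ∀ x y, f (x + y) = f x + f y := by
    intro x y
    apply laurent_ext; intro n
    rw [AddMonoidAlgebra.coeff_add, Finsupp.add_apply, hf, hf, hf, ← map_add, smul_add, smul_add]
  have hT : ∀ (m : ℤ) x, f ((T m : k[T;T⁻¹]) • x) = T m * f x := by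
    intro m x
    apply laurent_ext; intro n
    rw [hf, coeff_T_mul, hf]
    congr 1
    rw [smul_comm (1 - T 1 : k[T;T⁻¹]) (T m : k[T;T⁻¹]) x, ← mul_smul, ← T_add]
    congr 2; ring
  have hc : ∀ (c : k) x, f (c • x) = c • f x := by
    intro c x
    apply laurent_ext; intro n
    rw [hf, AddMonoidAlgebra.coeff_smul, Finsupp.smul_apply, hf, ← map_smul, smul_comm c, smul_comm c]
  refine ⟨⟨⟨f, hadd⟩, fun r x => ?_⟩, hf⟩
  simp only [RingHom.id_apply, smul_eq_mul]
  induction r using LaurentPolynomial.induction_on' with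
  | add p q hp hq => rw [add_smul, hadd, hp, hq, add_mul]
  | C_mul_T n a =>
    rw [← smul_eq_C_mul, smul_assoc, hc, hT, smul_mul_assoc]

theorem res_trace (Res : (A →ₗ[k[T;T⁻¹]] V) →ₗ[k[T;T⁻¹]] k[T;T⁻¹])
    (hR : ∀ h n, (Res h).coeff n = ψ ((T (- n - 1) : k[T;T⁻¹]) • (1 - T 1 : k[T;T⁻¹]) • h))
    (h : A →ₗ[k[T;T⁻¹]] V) (hM : ∀ a ∈ EA.M1, h a ∈ F.M1) :
    ∃ s, Res h = (1 - T 1) * s ∧ s.coeff (-1) = ψ h := by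
  obtain ⟨s, hs⟩ := res_fin EA F ψ h1 h2 h hM
  refine ⟨s, ?_, ?_⟩
  · apply laurent_ext; intro n
    rw [hR, sub_mul, one_mul, AddMonoidAlgebra.coeff_sub, Finsupp.sub_apply, coeff_T_mul, hs, hs, ← map_sub,
      sub_smul, smul_sub, one_smul, ← mul_smul, ← T_add]
    congr 4; ring
  · rw [hs]; simp

/-- the key vanishing in one chart -/
theorem chart_res {e p : ℤ} {LA : ℤ → Submodule k A} {LV : ℤ → Submodule k V} (hA : IsChart e p LA) (hV : IsChart e p LV)
    {n : ℕ} (b : Module.Basis (Fin n) k[T;T⁻¹] A) (j : ℤ) (hb : ∀ w, w ∈ LA (j + 1) ↔ ∀ i, b.repr w i ∈ Pos k e)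
    (v : V) (hv : v ∈ LV j) (a : Fin n) (r : k[T;T⁻¹]) (hr : r ∈ Pos k e) (i : ℤ) (w : A) (hw : w ∈ LA i) :
    ((T e * r : k[T;T⁻¹]) • (b.coord a).smulRight v) w ∈ LV i := by
  have := hA.preserve_of hV ((T e * r : k[T;T⁻¹]) • (b.coord a).smulRight v) 0 (j + 1) ?_ i w hw
  · simpa using this
  intro i hi1 hi2 w hw
  have hw' := (hb w).1 (hA.anti _ _ hi1 hw) a
  rw [LinearMap.smul_apply, LinearMap.smulRight_apply, mul_smul]
  refine hV.anti _ (j + p) (by linarith) ((hV.shift _ _).2 (hV.pos_smul hr (hV.pos_smul hw' hv)))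

theorem res_g : ∃ (Res : (A →ₗ[k[T;T⁻¹]] V) →ₗ[k[T;T⁻¹]] k[T;T⁻¹]) (g : V →ₗ[k[T;T⁻¹]] A),
    PB.IsHom 1 F EA g ∧
    (∀ (α : A →ₗ[k[T;T⁻¹]] k[T;T⁻¹]) (v : V), α (g v) = Res (α.smulRight v)) ∧
    (∀ h : A →ₗ[k[T;T⁻¹]] V, (∀ a ∈ EA.M1, h a ∈ F.M1) → Res h = 0 → ψ h = 0) := by
  obtain ⟨Res, hR⟩ := res_exists EA F ψ h1 h2
  have htr := res_trace EA F ψ h1 h2 Res hR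
  obtain ⟨n, b, -⟩ := EA.hL.basis EA.tf 0
  let g : V →ₗ[k[T;T⁻¹]] A := ∑ i, (LinearMap.smulRight
    (Res ∘ₗ (LinearMap.smulRightₗ (R := k[T;T⁻¹]) (M := V) (b.coord i))) (b i))
  have hg0 : ∀ v, g v = ∑ i, Res ((b.coord i).smulRight v) • b i := by
    intro v; simp [g, LinearMap.sum_apply]
  have hg : ∀ (α : A →ₗ[k[T;T⁻¹]] k[T;T⁻¹]) (v : V), α (g v) = Res (α.smulRight v) := by
    intro α v
    have : α.smulRight v = ∑ i, α (b i) • (b.coord i).smulRight v := by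
      refine b.ext fun j => ?_
      simp [LinearMap.sum_apply, Finsupp.single_apply]
    rw [this, map_sum, hg0, map_sum]
    refine Finset.sum_congr rfl fun i _ => ?_
    rw [map_smul, map_smul, smul_eq_mul, smul_eq_mul, mul_comm]
  refine ⟨Res, g, ⟨PB.isHom_M_of ?_ ?_, ?_, ?_⟩, hg, ?_⟩
  · intro v
    show g v ∈ EA.M1
    by_contra hcon
    obtain ⟨l, hl1, hl2⟩ := Submodule.exists_le_ker_of_notMem (p := EA.M1.restrictScalars k) (v := g v) hcon
    have hlT : ∀ (r : k[T;T⁻¹]) (a : A), l (r • a) = ev1 r * l a := by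
      intro r a
      obtain ⟨s, hs⟩ := dvd_sub_ev1 r
      have h3 : l ((r - (ev1 r) • (1 : k[T;T⁻¹])) • a) = 0 := by
        rw [hs, mul_smul]
        exact hl2 (EA.hM _)
      rw [sub_smul, map_sub, smul_assoc, one_smul, l.map_smul (ev1 r) a, sub_eq_zero] at h3
      rw [h3, smul_eq_mul]
    let α : A →ₗ[k[T;T⁻¹]] k[T;T⁻¹] := ∑ i, l (b i) • b.coord i
    have hα : ∀ a, ev1 (α a) = l a := by
      intro a
      conv_rhs => rw [← b.sum_repr a, map_sum]
      simp only [α, LinearMap.sum_apply, map_sum, LinearMap.smul_apply, map_smul, hlT, Module.Basis.coord_apply,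
        smul_eq_mul]
      exact Finset.sum_congr rfl fun i _ => mul_comm _ _
    have hα2 : ∀ a ∈ EA.M1, (α.smulRight v) a ∈ F.M1 := by
      intro a ha
      obtain ⟨s, hs⟩ := dvd_sub_ev1 (α a)
      have : l a = 0 := hl2 ha
      rw [hα, this, zero_smul, sub_zero] at hs
      rw [LinearMap.smulRight_apply, hs, mul_smul]
      exact F.hM _
    obtain ⟨s, hs, -⟩ := htr _ hα2
    rw [← hg] at hs
    apply hl1
    rw [← hα, hs, ev1_one_sub_mul]
  · intro v hv
    have : ∀ i, ∃ s, Res ((b.coord i).smulRight v) = (1 - T 1) * s := fun i =>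
      (htr _ (fun a _ => F.M1.smul_mem _ hv)).imp fun s hs => hs.1
    choose s hs using this
    rw [add_comm, PB.mem_Mc_add_two EA 0]
    refine ⟨∑ i, s i • b i, Submodule.mem_top, ?_⟩
    rw [hg0, Finset.smul_sum]
    refine Finset.sum_congr rfl fun i _ => ?_
    rw [hs, mul_smul]
  · intro j v hv
    obtain ⟨n, b, hb⟩ := EA.hL.basis EA.tf (j + 1)
    have := EA.hL.shift (g v) (j - 2)
    push_cast
    rw [← this, show j - 2 + 3 = j + 1 by ring, hb]
    intro a
    rw [mem_Pos (Or.inl rfl)]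
    intro m hm
    rw [map_smul, Finsupp.smul_apply, smul_eq_mul, coeff_T_mul]
    have h3 := hg (b.coord a) v
    rw [Module.Basis.coord_apply] at h3
    rw [h3, hR]
    refine h1 _ ⟨fun x hx => ?_, fun i w hw => ?_⟩
    · exact F.M1.smul_mem _ (F.hM _)
    · rw [← mul_smul, show (T (-(m - 1) - 1) * (1 - T 1) : k[T;T⁻¹]) = T 1 * (T (- m - 1) * (1 - T 1)) by
        rw [← mul_assoc, ← T_add]; congr 2; ring]
      refine chart_res EA F ψ h1 h2 EA.hL F.hL b j hb v hv a _ ?_ i w hw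
      refine Subalgebra.mul_mem _ (T_mem_Pos (Or.inl rfl) (by omega))
        (Subalgebra.sub_mem _ (Subalgebra.one_mem _) (T_mem_Pos (Or.inl rfl) (by omega)))
  · intro j v hv
    obtain ⟨n, b, hb⟩ := EA.hN.basis EA.tf (j + 1)
    push_cast
    rw [hb]
    intro a
    rw [mem_Pos (Or.inr rfl)]
    intro m hm
    have h3 := hg (b.coord a) v
    rw [Module.Basis.coord_apply] at h3
    rw [h3, hR]
    refine h2 _ ⟨fun x hx => ?_, fun i w hw => ?_⟩
    · exact F.M1.smul_mem _ (F.hM _)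
    · rw [← mul_smul, show (T (-m - 1) * (1 - T 1) : k[T;T⁻¹]) = T (-1) * (T (- m) - T (-m + 1)) by
        rw [mul_sub, mul_sub, mul_one, ← T_add, ← T_add, ← T_add]; congr 2 <;> ring]
      refine chart_res EA F ψ h1 h2 EA.hN F.hN b j hb v hv a _ ?_ i w hw
      exact Subalgebra.sub_mem _ (T_mem_Pos (Or.inr rfl) (by omega)) (T_mem_Pos (Or.inr rfl) (by omega))
  · intro h hM hres
    obtain ⟨s, hs, hs2⟩ := htr h hM
    rw [hres, eq_comm, mul_eq_zero] at hs
    rcases hs with hs | hs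
    · exact absurd hs one_sub_T_ne_zero
    · rw [← hs2, hs]; rfl

end res

namespace PB

theorem extend_or {EP : PB k P} {EW : PB k W} {EA : PB k A} {F : PB k V} {ι : P →ₗ[k[T;T⁻¹]] W}
    {π : W →ₗ[k[T;T⁻¹]] A} (hs : SES EP EW EA ι π) {φ : P →ₗ[k[T;T⁻¹]] V} (hφ : IsHom 0 EP F φ) :
    (∃ χ : W →ₗ[k[T;T⁻¹]] V, IsHom 0 EW F χ ∧ ∀ p, χ (ι p) = φ p) ∨
    ∃ g : V →ₗ[k[T;T⁻¹]] A, IsHom 1 F EA g ∧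
      (∀ (V' : Type u) [AddCommGroup V'] [Module k V'] [Module k[T;T⁻¹] V'] [IsScalarTower k k[T;T⁻¹] V']
        (F' : PB k V') (p : V →ₗ[k[T;T⁻¹]] V'), SEpi F F' p → LinearMap.ker p ≤ LinearMap.ker g →
        ∀ χ : W →ₗ[k[T;T⁻¹]] V', IsHom 0 EW F' χ → ¬ ∀ x, χ (ι x) = p (φ x)) ∧
      (∀ (Q : Submodule k[T;T⁻¹] W), Sat Q → ∀ hQ : LinearMap.range ι ≤ Q, LinearMap.range g ≤ Q.map π →
        ∀ χ : Q →ₗ[k[T;T⁻¹]] V, IsHom 0 (EW.sub Q) F χ → ¬ ∀ x, χ ⟨ι x, hQ ⟨x, rfl⟩⟩ = φ x) := by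
  obtain ⟨hφM, hφL, hφN⟩ := isHom0_iff.1 hφ
  obtain ⟨μ1, m1, m1M, m1L⟩ := chart_ext EW.hL EA.hL EA.tf ι π EP.M1 EW.M1 EA.M1 F.M1 EA.hM EW.hM hs.mono.inj hs.exact
    (fun p => (hs.mono.M p).1) (fun j p => (hs.mono.L j p).1) hs.epi.M hs.epi.L φ hφM hφL
  obtain ⟨μ2, m2, m2M, m2L⟩ := chart_ext EW.hN EA.hN EA.tf ι π EP.M1 EW.M1 EA.M1 F.M1 EA.hM EW.hM hs.mono.inj hs.exact
    (fun p => (hs.mono.M p).1) (fun j p => (hs.mono.N j p).1) hs.epi.M hs.epi.N φ hφM hφN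
  obtain ⟨u, hu⟩ := factor_through ι π hs.epi.surj hs.exact (μ1 - μ2) (fun p => by simp [m1, m2])
  have huM : ∀ a ∈ EA.M1, u a ∈ F.M1 := by
    intro a ha
    obtain ⟨w, hw, rfl⟩ := (hs.epi.M a).1 ha
    rw [hu]
    exact F.M1.sub_mem (m1M w hw) (m2M w hw)
  set H1 := HomC EA.M1 F.M1 EA.L F.L
  set H2 := HomC EA.M1 F.M1 EA.N F.N
  by_cases hmem : u ∈ H1 ⊔ H2
  · left
    obtain ⟨a, ha, b, hb, hab⟩ := Submodule.mem_sup.1 hmem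
    have heq : ∀ w, μ1 w - a (π w) = μ2 w + b (π w) := by
      intro w
      have := hu w
      rw [← hab] at this
      simp only [LinearMap.add_apply, LinearMap.sub_apply] at this
      rw [sub_eq_iff_eq_add, add_assoc, add_comm (b _), this]; abel
    refine ⟨μ1 - a ∘ₗ π, isHom0_iff.2 ⟨?_, ?_, ?_⟩, ?_⟩
    · intro w hw
      exact F.M1.sub_mem (m1M w hw) (ha.1 _ ((hs.epi.M _).2 ⟨w, hw, rfl⟩))
    · intro j w hw
      exact (F.L j).sub_mem (m1L j w hw) (ha.2 _ _ ((hs.epi.L _ _).2 ⟨w, hw, rfl⟩))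
    · intro j w hw
      show μ1 w - a (π w) ∈ _
      rw [heq]
      exact (F.N j).add_mem (m2L j w hw) (hb.2 _ _ ((hs.epi.N _ _).2 ⟨w, hw, rfl⟩))
    · intro p
      simp [(hs.exact (ι p)).2 ⟨p, rfl⟩, m1]
  · right
    obtain ⟨ψ, hψ1, hψ2⟩ := Submodule.exists_le_ker_of_notMem hmem
    have h1 : ∀ h ∈ H1, ψ h = 0 := fun h hh => hψ2 ((le_sup_left : H1 ≤ H1 ⊔ H2) hh)
    have h2 : ∀ h ∈ H2, ψ h = 0 := fun h hh => hψ2 ((le_sup_right : H2 ≤ H1 ⊔ H2) hh)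
    obtain ⟨Res, g, hg, hgα, htr⟩ := res_g EA F ψ h1 h2
    refine ⟨g, hg, ?_, ?_⟩
    · intro V' _ _ _ _ F' p hp hker χ hχ hcon
      obtain ⟨hχM, hχL, hχN⟩ := isHom0_iff.1 hχ
      obtain ⟨hpM, hpL, hpN⟩ := isHom0_iff.1 hp.isHom
      obtain ⟨t1, ht1⟩ := factor_through ι π hs.epi.surj hs.exact (p ∘ₗ μ1 - χ) (fun x => by simp [m1, hcon])
      obtain ⟨t2, ht2⟩ := factor_through ι π hs.epi.surj hs.exact (p ∘ₗ μ2 - χ) (fun x => by simp [m2, hcon])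
      obtain ⟨l1, e1, l1M, l1L⟩ := chart_lift EA.hL EA.tf F.hL p EA.M1 F.M1 F'.M1 EA.hM F.hM
        (fun a => (hp.M a).1) (fun j a => (hp.L j a).1) t1 (by
          intro a ha
          obtain ⟨w, hw, rfl⟩ := (hs.epi.M a).1 ha
          rw [ht1]
          exact F'.M1.sub_mem (hpM _ (m1M w hw)) (hχM w hw)) (by
          intro j a ha
          obtain ⟨w, hw, rfl⟩ := (hs.epi.L j a).1 ha
          rw [ht1]
          exact (F'.L j).sub_mem (hpL _ _ (m1L j w hw)) (hχL j w hw))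
      obtain ⟨l2, e2, l2M, l2L⟩ := chart_lift EA.hN EA.tf F.hN p EA.M1 F.M1 F'.M1 EA.hM F.hM
        (fun a => (hp.M a).1) (fun j a => (hp.N j a).1) t2 (by
          intro a ha
          obtain ⟨w, hw, rfl⟩ := (hs.epi.M a).1 ha
          rw [ht2]
          exact F'.M1.sub_mem (hpM _ (m2M w hw)) (hχM w hw)) (by
          intro j a ha
          obtain ⟨w, hw, rfl⟩ := (hs.epi.N j a).1 ha
          rw [ht2]
          exact (F'.N j).sub_mem (hpN _ _ (m2L j w hw)) (hχN j w hw))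
      have hz : ψ (u - l1 + l2) = 0 := by
        refine htr _ ?_ ?_
        · intro a ha
          exact F.M1.add_mem (F.M1.sub_mem (huM a ha) (l1M a ha)) (l2M a ha)
        · set ν := u - l1 + l2 with hν
          have hpν : ∀ a, g (ν a) = 0 := by
            intro a
            refine hker ?_
            obtain ⟨w, rfl⟩ := hs.epi.surj a
            rw [LinearMap.mem_ker]
            simp only [hν, LinearMap.add_apply, LinearMap.sub_apply, map_add, map_sub, hu, e1, e2, ht1, ht2,
              LinearMap.comp_apply]
            abel
          obtain ⟨n, b, -⟩ := EA.hL.basis EA.tf 0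
          have : ν = ∑ i, (b.coord i).smulRight (ν (b i)) := by
            refine b.ext fun j => ?_
            simp [LinearMap.sum_apply, Finsupp.single_apply]
          rw [this, map_sum]
          refine Finset.sum_eq_zero fun i _ => ?_
          rw [← hgα, hpν, map_zero]
      apply hψ1
      rw [map_add, map_sub, h1 l1 ⟨l1M, l1L⟩, h2 l2 ⟨l2M, l2L⟩] at hz
      simpa using hz
    · intro Q hQs hQ hgQ χ hχ hcon
      obtain ⟨hχM, hχL, hχN⟩ := isHom0_iff.1 hχ
      have hs2 := EW.ses Q hQs
      obtain ⟨κ1, c1, c1M, c1L⟩ := chart_ext EW.hL (EW.quot Q hQs).hL (EW.quot Q hQs).tf Q.subtype Q.mkQ (EW.sub Q).M1 EW.M1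
        (EW.quot Q hQs).M1 F.M1 (EW.quot Q hQs).hM EW.hM hs2.mono.inj hs2.exact
        (fun p => (hs2.mono.M p).1) (fun j p => (hs2.mono.L j p).1) hs2.epi.M hs2.epi.L χ hχM hχL
      obtain ⟨κ2, c2, c2M, c2L⟩ := chart_ext EW.hN (EW.quot Q hQs).hN (EW.quot Q hQs).tf Q.subtype Q.mkQ (EW.sub Q).M1 EW.M1
        (EW.quot Q hQs).M1 F.M1 (EW.quot Q hQs).hM EW.hM hs2.mono.inj hs2.exact
        (fun p => (hs2.mono.M p).1) (fun j p => (hs2.mono.N j p).1) hs2.epi.M hs2.epi.N χ hχM hχN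
      have c1' : ∀ x, κ1 (ι x) = φ x := fun x => by rw [← hcon]; exact c1 ⟨ι x, hQ ⟨x, rfl⟩⟩
      have c2' : ∀ x, κ2 (ι x) = φ x := fun x => by rw [← hcon]; exact c2 ⟨ι x, hQ ⟨x, rfl⟩⟩
      obtain ⟨l1, hl1⟩ := factor_through ι π hs.epi.surj hs.exact (μ1 - κ1) (fun x => by simp [m1, c1'])
      obtain ⟨l2, hl2⟩ := factor_through ι π hs.epi.surj hs.exact (μ2 - κ2) (fun x => by simp [m2, c2'])
      have l1H : l1 ∈ H1 := by
        constructor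
        · intro a ha
          obtain ⟨w, hw, rfl⟩ := (hs.epi.M a).1 ha
          rw [hl1]
          exact F.M1.sub_mem (m1M w hw) (c1M w hw)
        · intro j a ha
          obtain ⟨w, hw, rfl⟩ := (hs.epi.L j a).1 ha
          rw [hl1]
          exact (F.L j).sub_mem (m1L _ w hw) (c1L _ w hw)
      have l2H : l2 ∈ H2 := by
        constructor
        · intro a ha
          obtain ⟨w, hw, rfl⟩ := (hs.epi.M a).1 ha
          rw [hl2]
          exact F.M1.sub_mem (m2M w hw) (c2M w hw)
        · intro j a ha
          obtain ⟨w, hw, rfl⟩ := (hs.epi.N j a).1 ha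
          rw [hl2]
          exact (F.N j).sub_mem (m2L _ w hw) (c2L _ w hw)
      have hz : ψ (u - l1 + l2) = 0 := by
        refine htr _ ?_ ?_
        · intro a ha
          exact F.M1.add_mem (F.M1.sub_mem (huM a ha) (l1H.1 a ha)) (l2H.1 a ha)
        · set ν := u - l1 + l2 with hν
          have hpν : ∀ v, ν (g v) = 0 := by
            intro v
            obtain ⟨w, hw, hwv⟩ := hgQ ⟨v, rfl⟩
            rw [← hwv]
            have d1 := c1 ⟨w, hw⟩
            have d2 := c2 ⟨w, hw⟩
            simp only [Submodule.subtype_apply] at d1 d2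
            simp only [hν, LinearMap.add_apply, LinearMap.sub_apply, hu, hl1, hl2, d1, d2]
            abel
          obtain ⟨n, b, -⟩ := F.hL.basis F.tf 0
          have : ν = ∑ i, (b.coord i ∘ₗ ν).smulRight (b i) := by
            ext a
            simp only [LinearMap.sum_apply, LinearMap.smulRight_apply, LinearMap.comp_apply, Module.Basis.coord_apply]
            exact (b.sum_repr (ν a)).symm
          rw [this, map_sum]
          refine Finset.sum_eq_zero fun i _ => ?_
          rw [← hgα, LinearMap.comp_apply, hpν, map_zero]
      apply hψ1
      rw [map_add, map_sub, h1 l1 l1H, h2 l2 l2H] at hz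
      simpa using hz

end PB
end ext
end Stm

namespace Stm
open LaurentPolynomial

section deg
variable {k : Type u} [Field k]
variable {P : Type u} [AddCommGroup P] [Module k P] [Module k[T;T⁻¹] P] [IsScalarTower k k[T;T⁻¹] P]
variable {W : Type u} [AddCommGroup W] [Module k W] [Module k[T;T⁻¹] W] [IsScalarTower k k[T;T⁻¹] W]
variable {A : Type u} [AddCommGroup A] [Module k A] [Module k[T;T⁻¹] A] [IsScalarTower k k[T;T⁻¹] A]
variable {V : Type u} [AddCommGroup V] [Module k V] [Module k[T;T⁻¹] V] [IsScalarTower k k[T;T⁻¹] V]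

theorem finrank_le_map {X : Submodule k W} {Y : Submodule k V} [FiniteDimensional k Y] (f : W →ₗ[k] V)
    (hf : Function.Injective f) (h : ∀ x ∈ X, f x ∈ Y) : Module.finrank k X ≤ Module.finrank k Y := by
  refine LinearMap.finrank_le_finrank_of_injective (f := f.restrict h) ?_
  intro x y hxy
  exact Subtype.ext (hf (congrArg Subtype.val hxy))

theorem rank_split {V : Type*} [AddCommGroup V] [Module k V] (f : W →ₗ[k] V) (X : Submodule k W) [FiniteDimensional k X] :
    Module.finrank k X = Module.finrank k (X.map f) + Module.finrank k (X ⊓ LinearMap.ker f : Submodule k W) := by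
  have h := LinearMap.finrank_range_add_finrank_ker (f.domRestrict X)
  rw [LinearMap.range_domRestrict, LinearMap.ker_domRestrict] at h
  rw [← h]
  congr 1
  rw [← Submodule.map_comap_subtype]
  exact LinearEquiv.finrank_eq (Submodule.equivMapOfInjective X.subtype X.injective_subtype _)

namespace PB

noncomputable def Gam (E : PB k W) (c m : ℕ) : Submodule k W :=
  (E.Mc c).restrictScalars k ⊓ (E.L (-2 * c) ⊓ E.N (c - 6 * m))

theorem mem_Gam (E : PB k W) {c m : ℕ} {w : W} : w ∈ E.Gam c m ↔ w ∈ E.Mc c ∧ w ∈ E.L (-2 * c) ∧ w ∈ E.N (c - 6 * m) := Iff.rfl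

instance Gam_fd (E : PB k W) (c m : ℕ) : FiniteDimensional k (E.Gam c m) := by
  haveI := E.fd (-2 * c) (c - 6 * m)
  exact Submodule.finiteDimensional_of_le (inf_le_right : E.Gam c m ≤ _)

noncomputable def H (E : PB k W) (m : ℕ) : ℕ := ∑ c ∈ Finset.range 6, Module.finrank k (E.Gam c m)

theorem kap (E : PB k W) (j : ℤ) : ∃ (b : Fin (Module.finrank k[T;T⁻¹] W) → W)
    (κ : W →ₗ[k] (Fin (Module.finrank k[T;T⁻¹] W) → k)),
    (∀ i, b i ∈ E.L j) ∧ (∀ w ∈ E.L j, κ w = 0 → (T (-1) : k[T;T⁻¹]) • w ∈ E.L j) ∧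
    (∀ w ∈ E.L j, κ ((T 1 : k[T;T⁻¹]) • w) = 0) ∧ (∀ i, κ (b i) = Pi.single i 1) := by
  obtain ⟨n, b, hb⟩ := E.hL.basis E.tf j
  have hn : Module.finrank k[T;T⁻¹] W = n := by
    rw [Module.finrank_eq_card_basis b, Fintype.card_fin]
  rw [hn]
  let κ : W →ₗ[k] (Fin n → k) := LinearMap.pi fun a => coeffL 0 ∘ₗ (Finsupp.lapply (R := k) a) ∘ₗ (b.repr.toLinearMap.restrictScalars k)
  have hκ : ∀ w a, κ w a = (b.repr w a).coeff 0 := fun w a => rfl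
  refine ⟨b, κ, ?_, ?_, ?_, ?_⟩
  · intro i
    rw [hb]
    intro a
    rw [b.repr_self, Finsupp.single_apply]
    split_ifs
    · exact Subalgebra.one_mem _
    · exact Subalgebra.zero_mem _
  · intro w hw h0
    rw [hb] at hw ⊢
    intro a
    rw [map_smul, Finsupp.smul_apply, smul_eq_mul, mem_Pos (Or.inl rfl)]
    intro n hn
    rw [coeff_T_mul]
    rcases eq_or_ne n (-1) with rfl | hne
    · have := congrFun h0 a
      rw [hκ] at this
      simpa using this
    · exact (mem_Pos (Or.inl rfl) _).1 (hw a) _ (by omega)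
  · intro w hw
    rw [hb] at hw
    funext a
    rw [hκ, map_smul, Finsupp.smul_apply, smul_eq_mul, coeff_T_mul]
    exact (mem_Pos (Or.inl rfl) _).1 (hw a) _ (by omega)
  · intro i
    funext a
    rw [hκ, b.repr_self, Finsupp.single_apply, Pi.single_apply]
    by_cases h : i = a
    · subst h; simp
    · rw [if_neg h, if_neg (Ne.symm h)]; rfl

theorem one_sub_pow_L (E : PB k W) (j : ℤ) (c : ℕ) (w : W) : ((1 - T 1 : k[T;T⁻¹]) ^ c) • w ∈ E.L j ↔ w ∈ E.L j := by
  induction c with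
  | zero => simp
  | succ c ih => rw [pow_succ', mul_smul, E.hL.one_sub_iff, ih]

theorem one_sub_N (E : PB k W) (i : ℤ) (w : W) : (1 - T 1 : k[T;T⁻¹]) • w ∈ E.N (i - 6) ↔ w ∈ E.N i := by
  rw [← E.hN.one_sub_iff w i, ← E.hN.shift _ (i - 6), ← neg_mem_iff (x := (1 - T (-1) : k[T;T⁻¹]) • w), sub_add_cancel, ← mul_smul, ← neg_smul]
  have : (T (-1) * (1 - T 1) : k[T;T⁻¹]) = - (1 - T (-1)) := by
    rw [mul_sub, ← T_add]; simp
  rw [this]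

theorem one_sub_pow_N (E : PB k W) (i : ℤ) (c : ℕ) (w : W) : ((1 - T 1 : k[T;T⁻¹]) ^ c) • w ∈ E.N (i - 6 * c) ↔ w ∈ E.N i := by
  induction c with
  | zero => simp
  | succ c ih => 
    rw [pow_succ', mul_smul, ← ih, ← one_sub_N E (i - 6 * c) (((1 - T 1 : k[T;T⁻¹]) ^ c) • w)]
    rw [show i - 6 * ((c + 1 : ℕ) : ℤ) = i - 6 * c - 6 by push_cast; ring]

theorem Gam_mono (E : PB k W) (c : ℕ) {m m' : ℕ} (h : m ≤ m') : E.Gam c m ≤ E.Gam c m' := by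
  intro w hw
  exact ⟨hw.1, hw.2.1, E.hN.anti _ _ (by omega) hw.2.2⟩

theorem T_Gam (E : PB k W) (c m n : ℕ) {w : W} (hw : w ∈ E.Gam c m) : (T n : k[T;T⁻¹]) • w ∈ E.Gam c (m + n) := by
  refine ⟨Submodule.smul_mem _ _ hw.1, E.hL.pos_smul (T_mem_Pos (Or.inl rfl) (by omega)) hw.2.1, ?_⟩
  have := (E.hN.shiftn (-n) w (c - 6 * m)).2 hw.2.2
  rw [show (-1 * -(n : ℤ)) = n by ring] at this
  show _ ∈ E.N _
  rwa [show (c : ℤ) - 6 * ((m + n : ℕ) : ℤ) = c - 6 * m + 6 * -n by push_cast; ring]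

theorem Gam_data (E : PB k W) (c : ℕ) : ∃ (b : Fin (Module.finrank k[T;T⁻¹] W) → W)
    (κ : W →ₗ[k] (Fin (Module.finrank k[T;T⁻¹] W) → k)) (m0 : ℕ), (∀ i, b i ∈ E.L (-2 * c)) ∧
    (∀ m, m0 ≤ m → ∀ i, ((1 - T 1 : k[T;T⁻¹]) ^ c) • b i ∈ E.Gam c m) ∧
    (∀ i, κ (((1 - T 1 : k[T;T⁻¹]) ^ c) • b i) = Pi.single i 1) ∧
    (∀ m, ∀ w ∈ E.Gam c (m + 1), κ w = 0 → (T (-1) : k[T;T⁻¹]) • w ∈ E.Gam c m) ∧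
    (∀ m, ∀ w ∈ E.Gam c m, κ ((T 1 : k[T;T⁻¹]) • w) = 0) := by
  obtain ⟨b, κ, hb, h1, h2, h3⟩ := E.kap (-2 * c)
  have h4 : ∀ (c' : ℕ), ∀ w ∈ E.L (-2 * c), κ (((1 - T 1 : k[T;T⁻¹]) ^ c') • w) = κ w := by
    intro c'
    induction c' with
    | zero => intro w _; simp
    | succ c' ih =>
      intro w hw
      rw [pow_succ', mul_smul, sub_smul, one_smul, map_sub, h2 _ ((E.one_sub_pow_L _ _ _).2 hw), sub_zero, ih w hw]
  choose m hm using fun i => E.hN.exh (((1 - T 1 : k[T;T⁻¹]) ^ c) • b i)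
  refine ⟨b, κ, ∑ i, (c - m i).toNat, hb, ?_, ?_, ?_, ?_⟩
  · intro m' hm' i
    refine ⟨E.pow_mem_Mc _ _, (E.one_sub_pow_L _ _ _).2 (hb i), E.hN.anti _ _ ?_ (hm i)⟩
    have := Finset.single_le_sum (f := fun i => (c - m i).toNat) (fun _ _ => Nat.zero_le _) (Finset.mem_univ i)
    omega
  · intro i
    rw [h4 _ _ (hb i), h3]
  · intro m w hw h0
    refine ⟨Submodule.smul_mem _ _ hw.1, h1 w hw.2.1 h0, ?_⟩
    have := (E.hN.shift w (c - 6 * (m + 1 : ℕ))).2 hw.2.2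
    show _ ∈ E.N _
    rwa [show (c : ℤ) - 6 * ((m + 1 : ℕ) : ℤ) + 6 = c - 6 * m by push_cast; ring] at this
  · intro m w hw
    exact h2 w hw.2.1

theorem Tinj (n : ℤ) : Function.Injective (((LinearMap.lsmul k[T;T⁻¹] W (T n)).restrictScalars k) : W →ₗ[k] W) := by
  intro v w h
  exact T_isUnit_smul_inj n h

theorem Gam_step (E : PB k W) (c : ℕ) : ∃ m0 : ℕ, (∀ m, Module.finrank k (E.Gam c (m + 1)) ≤
      Module.finrank k (E.Gam c m) + Module.finrank k[T;T⁻¹] W) ∧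
    ∀ m, m0 ≤ m → Module.finrank k (E.Gam c (m + 1)) = Module.finrank k (E.Gam c m) + Module.finrank k[T;T⁻¹] W := by
  obtain ⟨b, κ, m0, h1, h2, h3, h4, h5⟩ := E.Gam_data c
  have hker : ∀ m, Module.finrank k (E.Gam c (m + 1) ⊓ LinearMap.ker κ : Submodule k W) = Module.finrank k (E.Gam c m) := by
    intro m
    haveI : FiniteDimensional k (E.Gam c (m + 1) ⊓ LinearMap.ker κ : Submodule k W) :=
      Submodule.finiteDimensional_of_le (inf_le_left : _ ≤ E.Gam c (m + 1))
    apply le_antisymm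
    · exact finrank_le_map _ (Tinj (k := k) (-1)) (fun w hw => h4 m w hw.1 hw.2)
    · exact finrank_le_map _ (Tinj (k := k) 1) (fun w hw => ⟨E.T_Gam c m 1 hw, h5 m w hw⟩)
  refine ⟨m0, fun m => ?_, fun m hm => ?_⟩
  · rw [rank_split κ, hker, add_comm]
    have := Submodule.finrank_le ((E.Gam c (m + 1)).map κ)
    rw [Module.finrank_fin_fun] at this
    omega
  · rw [rank_split κ, hker, add_comm]
    congr 1
    have : (E.Gam c (m + 1)).map κ = ⊤ := by
      rw [eq_top_iff, ← (Pi.basisFun k _).span_eq, Submodule.span_le]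
      rintro _ ⟨i, rfl⟩
      exact ⟨_, h2 (m + 1) (by omega) i, by rw [h3]; simp⟩
    rw [this, finrank_top, Module.finrank_fin_fun]

theorem H_step (E : PB k W) : ∃ m0 : ℕ, (∀ m, E.H (m + 1) ≤ E.H m + 6 * Module.finrank k[T;T⁻¹] W) ∧
    ∀ m, m0 ≤ m → E.H (m + 1) = E.H m + 6 * Module.finrank k[T;T⁻¹] W := by
  choose m0 h1 h2 using E.Gam_step
  refine ⟨∑ c ∈ Finset.range 6, m0 c, fun m => ?_, fun m hm => ?_⟩
  · have := Finset.sum_le_sum (fun c (_ : c ∈ Finset.range 6) => h1 c m)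
    rw [Finset.sum_add_distrib, Finset.sum_const, Finset.card_range] at this
    exact this
  · have := Finset.sum_congr rfl (fun c (hc : c ∈ Finset.range 6) => h2 c m (le_trans
      (Finset.single_le_sum (f := m0) (fun _ _ => Nat.zero_le _) hc) hm))
    rw [Finset.sum_add_distrib, Finset.sum_const, Finset.card_range] at this
    exact this

theorem D_exists (E : PB k W) : ∃ D : ℤ, (∃ m0 : ℕ, ∀ m, m0 ≤ m → (E.H m : ℤ) = 6 * Module.finrank k[T;T⁻¹] W * m + D) ∧
    ∀ m, 6 * Module.finrank k[T;T⁻¹] W * m + D ≤ E.H m := by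
  obtain ⟨m0, h1, h2⟩ := E.H_step
  set r := Module.finrank k[T;T⁻¹] W
  have key : ∀ n, (E.H (m0 + n) : ℤ) = E.H m0 + 6 * r * n := by
    intro n
    induction n with
    | zero => simp
    | succ n ih =>
      have := h2 (m0 + n) (by omega)
      rw [← add_assoc, this]; push_cast; rw [ih]; ring
  have key2 : ∀ n m, (E.H (m + n) : ℤ) ≤ E.H m + 6 * r * n := by
    intro n m
    induction n with
    | zero => simp
    | succ n ih =>
      have := h1 (m + n)
      rw [← add_assoc]; zify at this; push_cast; linarith
  refine ⟨E.H m0 - 6 * r * m0, ⟨m0, fun m hm => ?_⟩, fun m => ?_⟩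
  · obtain ⟨n, rfl⟩ := Nat.exists_eq_add_of_le hm
    rw [key]; push_cast; ring
  · have h3 := key2 m0 m
    have h4 := key m
    rw [add_comm m m0] at h3
    linarith

noncomputable def D (E : PB k W) : ℤ := E.D_exists.choose

theorem D_eq (E : PB k W) : ∃ m0 : ℕ, ∀ m, m0 ≤ m → (E.H m : ℤ) = 6 * Module.finrank k[T;T⁻¹] W * m + E.D :=
  E.D_exists.choose_spec.1

theorem D_le (E : PB k W) (m : ℕ) : 6 * Module.finrank k[T;T⁻¹] W * m + E.D ≤ E.H m :=
  E.D_exists.choose_spec.2 m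

theorem H_le {E : PB k W} {F : PB k V} {g : W →ₗ[k[T;T⁻¹]] V} (hg : Function.Injective g) (h : IsHom 0 E F g) (m : ℕ) :
    E.H m ≤ F.H m := by
  refine Finset.sum_le_sum fun c _ => finrank_le_map (g.restrictScalars k) hg fun w hw => ?_
  refine ⟨h.M c w hw.1, ?_, ?_⟩
  · simpa using h.L _ w hw.2.1
  · simpa using h.N _ w hw.2.2

theorem Gam_six (E : PB k W) (m : ℕ) : Module.finrank k (E.Gam 6 m) ≤ Module.finrank k (E.Gam 0 m) := by
  let f : W →ₗ[k[T;T⁻¹]] W := LinearMap.lsmul k[T;T⁻¹] W ((1 - T 1) ^ 3 * T (-4))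
  have hf : Function.Injective f := by
    rw [injective_iff_map_eq_zero]
    intro w hw
    refine (E.tf _ w hw).resolve_left ?_
    exact mul_ne_zero (pow_ne_zero _ one_sub_T_ne_zero) (isUnit_T _).ne_zero
  have hle : E.Gam 6 m ≤ (E.Gam 0 m).map (f.restrictScalars k) := by
    intro w hw
    obtain ⟨w1, hw1, rfl⟩ := (E.mem_Mc_add_two 4 w).1 hw.1
    obtain ⟨w2, hw2, rfl⟩ := (E.mem_Mc_add_two 2 _).1 hw1
    obtain ⟨w3, hw3, rfl⟩ := (E.mem_Mc_add_two 0 _).1 hw2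
    have he : (1 - T 1 : k[T;T⁻¹]) • (1 - T 1 : k[T;T⁻¹]) • (1 - T 1 : k[T;T⁻¹]) • w3 = ((1 - T 1 : k[T;T⁻¹]) ^ 3) • w3 := by
      rw [← mul_smul, ← mul_smul]; congr 1; ring
    rw [he] at hw ⊢
    refine ⟨(T 4 : k[T;T⁻¹]) • w3, ⟨Submodule.mem_top, ?_, ?_⟩, ?_⟩
    · have h1 := (E.one_sub_pow_L _ _ _).1 hw.2.1
      have := (E.hL.shiftn 4 w3 _).2 h1
      simpa using this
    · have h1 := hw.2.2
      have h2 := (E.one_sub_pow_N (6 - 6 * m + 18) 3 w3).1 (by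
        show _ ∈ E.N _
        rwa [show (6 : ℤ) - 6 * m + 18 - 6 * (3 : ℕ) = (6 : ℕ) - 6 * m by push_cast; ring])
      have := (E.hN.shiftn (-4) w3 _).2 h2
      rw [show (-1 : ℤ) * -4 = 4 by norm_num] at this
      show _ ∈ E.N _
      rwa [show (6 - 6 * m + 18 + 6 * -4 : ℤ) = (0 : ℕ) - 6 * m by push_cast; ring] at this
    · show ((1 - T 1) ^ 3 * T (-4) : k[T;T⁻¹]) • (T 4 : k[T;T⁻¹]) • w3 = _
      rw [mul_smul, T_smul_smul]; simp
  calc _ ≤ _ := Submodule.finrank_mono hle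
    _ ≤ _ := Submodule.finrank_map_le _ _

theorem H_le1 {E : PB k W} {F : PB k V} {g : W →ₗ[k[T;T⁻¹]] V} (hg : Function.Injective g) (h : IsHom 1 E F g) (m : ℕ) :
    E.H m ≤ F.H m := by
  have key : ∀ c, Module.finrank k (E.Gam c m) ≤ Module.finrank k (F.Gam (c + 1) m) := by
    intro c
    refine finrank_le_map (g.restrictScalars k) hg fun w hw => ?_
    refine ⟨h.M c w hw.1, ?_, ?_⟩
    · have := h.L _ w hw.2.1
      show _ ∈ F.L _
      rwa [show (-2 * c - 2 * (1 : ℕ) : ℤ) = -2 * ((c + 1 : ℕ) : ℤ) by push_cast; ring] at this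
    · have := h.N _ w hw.2.2
      show _ ∈ F.N _
      rwa [show (c - 6 * m + (1 : ℕ) : ℤ) = ((c + 1 : ℕ) : ℤ) - 6 * m by push_cast; ring] at this
  have h2 := Finset.sum_le_sum (fun c (_ : c ∈ Finset.range 6) => key c)
  have h3 : Module.finrank k (F.Gam (5 + 1) m) ≤ _ := F.Gam_six m
  refine le_trans h2 ?_
  unfold H
  rw [Finset.sum_range_succ, Finset.sum_range_succ' _ 5]
  omega

theorem D_le_D {E : PB k W} {F : PB k V} {e : ℕ} (he : e = 0 ∨ e = 1) {g : W →ₗ[k[T;T⁻¹]] V} (hg : Function.Injective g)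
    (h : IsHom e E F g) (hr : Module.finrank k[T;T⁻¹] W = Module.finrank k[T;T⁻¹] V) : E.D ≤ F.D := by
  obtain ⟨m0, h0⟩ := E.D_eq
  obtain ⟨m1, h1⟩ := F.D_eq
  have h2 : E.H (m0 + m1) ≤ F.H (m0 + m1) := by
    rcases he with rfl | rfl
    · exact H_le hg h _
    · exact H_le1 hg h _
  have h3 := h0 (m0 + m1) (by omega)
  have h4 := h1 (m0 + m1) (by omega)
  rw [hr] at h3
  zify at h2
  linarith

/-- equality of degrees forces a strict isomorphism -/
theorem strict_of_D_eq {E : PB k W} {F : PB k V} {g : W →ₗ[k[T;T⁻¹]] V} (hg : Function.Injective g)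
    (h : IsHom 0 E F g) (hr : Module.finrank k[T;T⁻¹] W = Module.finrank k[T;T⁻¹] V) (hD : E.D = F.D) :
    Function.Surjective g ∧ SMono E F g := by
  obtain ⟨m0, h0⟩ := E.D_eq
  obtain ⟨m1, h1⟩ := F.D_eq
  have hmap : ∀ c m, (E.Gam c m).map (g.restrictScalars k) ≤ F.Gam c m := by
    rintro c m _ ⟨w, hw, rfl⟩
    refine ⟨h.M c w hw.1, ?_, ?_⟩
    · simpa using h.L _ w hw.2.1
    · simpa using h.N _ w hw.2.2
  have hfin : ∀ c m, Module.finrank k ((E.Gam c m).map (g.restrictScalars k)) = Module.finrank k (E.Gam c m) := by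
    intro c m
    exact (LinearEquiv.finrank_eq (Submodule.equivMapOfInjective (g.restrictScalars k) hg (E.Gam c m))).symm
  have hGam : ∀ m, m0 + m1 ≤ m → ∀ c < 6, ∀ v ∈ F.Gam c m, ∃ w ∈ E.Gam c m, g w = v := by
    intro m hm c hc v hv
    have hH : E.H m = F.H m := by
      have h3 := h0 m (by omega)
      have h4 := h1 m (by omega)
      rw [hr, hD] at h3
      exact_mod_cast h3.trans h4.symm
    have := (Finset.sum_eq_sum_iff_of_le (s := Finset.range 6) (f := fun c => Module.finrank k (E.Gam c m))
      (g := fun c => Module.finrank k (F.Gam c m)) (fun c _ => by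
        rw [← hfin]; exact Submodule.finrank_mono (hmap c m))).1 hH c (Finset.mem_range.2 hc)
    have h5 := Submodule.eq_of_le_of_finrank_eq (hmap c m) (by rw [hfin]; exact this)
    rw [← h5] at hv
    exact hv
  -- the basic tool
  have tool : ∀ (c : ℕ) (v : V) (i : ℤ), c < 6 → v ∈ F.Mc c → v ∈ F.N i → ∃ n0 : ℕ, ∀ n : ℕ, n0 ≤ n → 
      ∃ w ∈ E.Gam c n, g w = (T ((n : ℤ) + (i - c) / 6) : k[T;T⁻¹]) • v := by
    intro c v i hc hv hi
    obtain ⟨n1, hn1⟩ := F.hL.eventually v (-2 * c)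
    refine ⟨m0 + m1 + n1 + (-((i - c) / 6)).toNat, fun n hn => ?_⟩
    refine hGam n (by omega) c hc _ ⟨Submodule.smul_mem _ _ hv, ?_, ?_⟩
    · have := hn1 (n + (i - c) / 6) (by omega)
      rwa [one_mul] at this
    · have := (F.hN.shiftn (-(n + (i - c) / 6)) v i).2 hi
      rw [show (-1 : ℤ) * -(n + (i - c) / 6) = n + (i - c) / 6 by ring] at this
      exact F.hN.anti _ _ (by omega) this
  have hsurj : Function.Surjective g := by
    intro v
    obtain ⟨i, hi⟩ := F.hN.exh v
    obtain ⟨n0, hn0⟩ := tool 0 v i (by norm_num) Submodule.mem_top hi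
    obtain ⟨w, -, hw⟩ := hn0 n0 le_rfl
    refine ⟨(T (-(n0 + (i - (0 : ℕ)) / 6)) : k[T;T⁻¹]) • w, ?_⟩
    rw [map_smul, hw, T_smul_smul]; simp
  refine ⟨hsurj, hg, fun w => ⟨fun hw => ?_, h.M 1 w⟩, fun j w => ⟨fun hw => ?_, fun hw => by simpa using h.L j w hw⟩,
    fun j w => ⟨fun hw => ?_, fun hw => by simpa using h.N j w hw⟩⟩
  · obtain ⟨i, hi⟩ := F.hN.exh (g w)
    obtain ⟨n0, hn0⟩ := tool 1 (g w) i (by norm_num) hw hi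
    obtain ⟨w', hw', hww⟩ := hn0 n0 le_rfl
    rw [← map_smul] at hww
    have := hg hww
    subst this
    have h3 := E.M1.smul_mem (T (-(n0 + (i - (1 : ℕ)) / 6))) hw'.1
    rw [T_smul_smul] at h3; simpa using h3
  · -- reduce to j = minus twice c
    have key : ∀ (c : ℕ), c < 3 → ∀ w, g w ∈ F.L (-2 * c) → w ∈ E.L (-2 * c) := by
      intro c hc w hw
      obtain ⟨i, hi⟩ := F.hN.exh (g (((1 - T 1 : k[T;T⁻¹]) ^ c) • w))
      set m := m0 + m1 + (c - i).toNat
      obtain ⟨w', hw', hww⟩ := hGam m (by omega) c (by omega) (g (((1 - T 1 : k[T;T⁻¹]) ^ c) • w)) ⟨by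
        rw [map_smul]; exact F.pow_mem_Mc _ _, by
        rw [map_smul]; exact (F.one_sub_pow_L _ _ _).2 hw, F.hN.anti _ _ (by omega) hi⟩
      have := hg hww
      subst this
      exact (E.one_sub_pow_L _ _ _).1 hw'.2.1
    have h3 : ∃ (c : ℕ) (n : ℤ), c < 3 ∧ j = -2 * c + 3 * n := by
      refine ⟨(j % 3).toNat, (j + 2 * (j % 3)) / 3, ?_, ?_⟩ <;> omega
    obtain ⟨c, n, hc, rfl⟩ := h3
    have h4 := F.hL.shiftn (-n) (g w) (-2 * c + 3 * n)
    have h5 := E.hL.shiftn (-n) w (-2 * c + 3 * n)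
    rw [show (-2 * c + 3 * n + 3 * -n : ℤ) = -2 * c by ring] at h4 h5
    rw [← h5]
    refine key c hc _ ?_
    rw [map_smul]
    exact h4.2 hw
  · set c := (j % 6).toNat with hc
    obtain ⟨n0, hn0⟩ := tool c (((1 - T 1 : k[T;T⁻¹]) ^ c) • g w) (j - 6 * c) (by omega) (F.pow_mem_Mc _ _) ((F.one_sub_pow_N _ _ _).2 hw)
    obtain ⟨w', hw', hww⟩ := hn0 n0 le_rfl
    rw [← map_smul, ← map_smul] at hww
    have := hg hww
    subst this
    rw [← E.one_sub_pow_N _ c]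
    have h3 := hw'.2.2
    set q := (n0 + (j - 6 * c - c) / 6 : ℤ)
    have h4 := E.hN.shiftn (-q) (((1 - T 1 : k[T;T⁻¹]) ^ c) • w) (j - 6 * c)
    rw [show (-1 : ℤ) * -q = q by ring] at h4
    refine h4.1 ?_
    show _ ∈ E.N _
    rwa [show (j - 6 * c + 6 * -q : ℤ) = c - 6 * n0 by omega]

theorem SES.finrank {EP : PB k P} {EW : PB k W} {EA : PB k A} {ι : P →ₗ[k[T;T⁻¹]] W} {π : W →ₗ[k[T;T⁻¹]] A}
    (h : SES EP EW EA ι π) : Module.finrank k[T;T⁻¹] W = Module.finrank k[T;T⁻¹] P + Module.finrank k[T;T⁻¹] A := by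
  haveI := EW.finite
  have h1 := Submodule.finrank_quotient_add_finrank (LinearMap.ker π)
  rw [LinearEquiv.finrank_eq (π.quotKerEquivOfSurjective h.epi.surj)] at h1
  have h2 : LinearMap.ker π = LinearMap.range ι := by
    ext w; rw [LinearMap.mem_ker, h.exact]; rfl
  rw [h2, LinearMap.finrank_range_of_inj h.mono.inj] at h1
  omega

theorem SES.surj {EP : PB k P} {EW : PB k W} {EA : PB k A} {ι : P →ₗ[k[T;T⁻¹]] W} {π : W →ₗ[k[T;T⁻¹]] A}
    (h : SES EP EW EA ι π) (c : ℕ) : ∃ m0 : ℕ, ∀ m, m0 ≤ m → ∀ a ∈ EA.Gam c m, ∃ w ∈ EW.Gam c m, π w = a := by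
  obtain ⟨b, κ, m0, h1, h2, h3, h4, h5⟩ := EA.Gam_data c
  choose b' hb' hbb using fun i => (h.epi.L _ _).1 (h1 i)
  choose i hi using fun a => EW.hN.exh (((1 - T 1 : k[T;T⁻¹]) ^ c) • b' a)
  set m1 := m0 + ∑ a, (c - i a).toNat with hm1
  have hb2 : ∀ m, m1 ≤ m → ∀ a, ((1 - T 1 : k[T;T⁻¹]) ^ c) • b' a ∈ EW.Gam c m := by
    intro m hm a
    refine ⟨EW.pow_mem_Mc _ _, (EW.one_sub_pow_L _ _ _).2 (hb' a), EW.hN.anti _ _ ?_ (hi a)⟩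
    have := Finset.single_le_sum (f := fun a => (c - i a).toNat) (fun _ _ => Nat.zero_le _) (Finset.mem_univ a)
    omega
  have step : ∀ n : ℕ, ∀ a ∈ EA.Gam c (m1 + n), ∃ a0 ∈ EA.Gam c m1, ∃ w ∈ EW.Gam c (m1 + n),
      a = (T n : k[T;T⁻¹]) • a0 + π w := by
    intro n
    induction n with
    | zero => intro a ha; exact ⟨a, ha, 0, Submodule.zero_mem _, by simp⟩
    | succ n ih =>
      intro a ha
      set w := ∑ i, κ a i • ((1 - T 1 : k[T;T⁻¹]) ^ c) • b' i with hw
      have hwG : w ∈ EW.Gam c (m1 + (n + 1)) := Submodule.sum_mem _ fun i _ => Submodule.smul_mem _ _ (hb2 _ (by omega) i)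
      have hπw : (π.restrictScalars k) w = ∑ i, κ a i • ((1 - T 1 : k[T;T⁻¹]) ^ c) • b i := by
        rw [hw, map_sum]
        refine Finset.sum_congr rfl fun i _ => ?_
        rw [map_smul, LinearMap.restrictScalars_apply, map_smul, hbb]
      have h6 : a - π w ∈ EA.Gam c (m1 + n + 1) := by
        refine Submodule.sub_mem _ ha ?_
        show (π.restrictScalars k) w ∈ _
        rw [hπw]
        exact Submodule.sum_mem _ fun i _ => Submodule.smul_mem _ _ (h2 _ (by omega) i)
      have h7 : κ (a - π w) = 0 := by
        have : κ (π w) = κ a := by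
          show κ ((π.restrictScalars k) w) = _
          rw [hπw, map_sum]
          simp only [map_smul, h3]
          funext j
          simp [Finset.sum_apply, Pi.single_apply]
        rw [map_sub, this, sub_self]
      obtain ⟨a0, ha0, w', hw', he⟩ := ih _ (h4 _ _ h6 h7)
      refine ⟨a0, ha0, (T 1 : k[T;T⁻¹]) • w' + w, Submodule.add_mem _ (EW.T_Gam c _ 1 hw') hwG, ?_⟩
      have h8 := congrArg (fun x => (T 1 : k[T;T⁻¹]) • x) he
      simp only [T_smul_smul, smul_add] at h8
      rw [map_add, map_smul, ← add_assoc]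
      rw [show (1 + n : ℤ) = ((n + 1 : ℕ) : ℤ) by push_cast; ring] at h8
      rw [← h8]; simp
  -- lift the finite-dimensional space
  have lift : ∀ a ∈ EA.Gam c m1, ∃ n0 : ℕ, ∀ n : ℕ, n0 ≤ n → ∃ w ∈ EW.Gam c (m1 + n), π w = (T n : k[T;T⁻¹]) • a := by
    intro a ha
    obtain ⟨x, hx, hxa⟩ := (h.epi.Mc c a).1 ha.1
    obtain ⟨y, hy, hya⟩ := (h.epi.N _ a).1 ha.2.2
    obtain ⟨z, hz1, hz2, hz3⟩ := EW.hN.inter_lift (EW.pow_mem_Mc c) π hx hy (hxa.trans hya.symm)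
    obtain ⟨n0, hn0⟩ := EW.hL.eventually z (-2 * c)
    refine ⟨n0, fun n hn => ⟨(T n : k[T;T⁻¹]) • z, ⟨Submodule.smul_mem _ _ hz1, ?_, ?_⟩, ?_⟩⟩
    · have := hn0 n (by omega)
      rwa [one_mul] at this
    · have := (EW.hN.shiftn (-n) z (c - 6 * m1)).2 hz2
      rw [show (-1 * -(n : ℤ)) = n by ring] at this
      show _ ∈ EW.N _
      rwa [show (c : ℤ) - 6 * ((m1 + n : ℕ) : ℤ) = c - 6 * m1 + 6 * -n by push_cast; ring]
    · rw [map_smul, hz3, hya]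
  have lift2 : ∃ n0 : ℕ, ∀ n : ℕ, n0 ≤ n → ∀ a ∈ EA.Gam c m1, ∃ w ∈ EW.Gam c (m1 + n), π w = (T n : k[T;T⁻¹]) • a := by
    let β := Module.finBasis k (EA.Gam c m1)
    choose n0 hn0 using fun i => lift (β i) (β i).2
    refine ⟨∑ i, n0 i, fun n hn a ha => ?_⟩
    have h9 : ∀ i, ∃ w ∈ EW.Gam c (m1 + n), π w = (T n : k[T;T⁻¹]) • (β i : A) := fun i =>
      hn0 i n (le_trans (Finset.single_le_sum (f := n0) (fun _ _ => Nat.zero_le _) (Finset.mem_univ i)) hn)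
    choose w hw hπw using h9
    refine ⟨∑ i, β.repr ⟨a, ha⟩ i • w i, Submodule.sum_mem _ fun i _ => Submodule.smul_mem _ _ (hw i), ?_⟩
    have h10 := congrArg Subtype.val (β.sum_repr ⟨a, ha⟩)
    simp only [AddSubmonoidClass.coe_finset_sum, Submodule.coe_smul] at h10
    show (π.restrictScalars k) _ = _
    rw [map_sum]
    conv_rhs => rw [← h10, Finset.smul_sum]
    refine Finset.sum_congr rfl fun i _ => ?_
    rw [map_smul, LinearMap.restrictScalars_apply, hπw, smul_comm]
  obtain ⟨n0, hn0⟩ := lift2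
  refine ⟨m1 + n0, fun m hm a ha => ?_⟩
  obtain ⟨n, rfl⟩ := Nat.exists_eq_add_of_le (show m1 ≤ m by omega)
  obtain ⟨a0, ha0, w, hw, rfl⟩ := step n a ha
  obtain ⟨w', hw', he⟩ := hn0 n (by omega) a0 ha0
  exact ⟨w' + w, Submodule.add_mem _ hw' hw, by rw [map_add, he]⟩

theorem SES.D {EP : PB k P} {EW : PB k W} {EA : PB k A} {ι : P →ₗ[k[T;T⁻¹]] W} {π : W →ₗ[k[T;T⁻¹]] A}
    (h : SES EP EW EA ι π) : EW.D = EP.D + EA.D := by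
  choose m0 h0 using h.surj
  obtain ⟨m1, h1⟩ := EP.D_eq
  obtain ⟨m2, h2⟩ := EW.D_eq
  obtain ⟨m3, h3⟩ := EA.D_eq
  set m := (∑ c ∈ Finset.range 6, m0 c) + m1 + m2 + m3
  have hH : EW.H m = EP.H m + EA.H m := by
    unfold H
    rw [← Finset.sum_add_distrib]
    refine Finset.sum_congr rfl fun c hc => ?_
    rw [rank_split (π.restrictScalars k) (EW.Gam c m), add_comm]
    haveI : FiniteDimensional k (EW.Gam c m ⊓ LinearMap.ker (π.restrictScalars k) : Submodule k W) :=
      Submodule.finiteDimensional_of_le (inf_le_left : _ ≤ EW.Gam c m)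
    congr 1
    · rw [LinearEquiv.finrank_eq (Submodule.equivMapOfInjective (ι.restrictScalars k) h.mono.inj (EP.Gam c m))]
      refine congrArg (fun X : Submodule k W => Module.finrank k X) ?_
      ext w
      constructor
      · rintro ⟨hw, hw0⟩
        obtain ⟨p, rfl⟩ := (h.exact w).1 hw0
        exact ⟨p, ⟨(h.Mmono c p).1 hw.1, (h.mono.L _ _).1 hw.2.1, (h.mono.N _ _).1 hw.2.2⟩, rfl⟩
      · rintro ⟨p, hp, rfl⟩
        exact ⟨⟨(h.Mmono c p).2 hp.1, (h.mono.L _ _).2 hp.2.1, (h.mono.N _ _).2 hp.2.2⟩, (h.exact _).2 ⟨p, rfl⟩⟩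
    · refine congrArg (fun X : Submodule k A => Module.finrank k X) ?_
      ext a
      constructor
      · rintro ⟨w, hw, rfl⟩
        refine ⟨(h.epi.Mc c _).2 ⟨w, hw.1, rfl⟩, (h.epi.L _ _).2 ⟨w, hw.2.1, rfl⟩, (h.epi.N _ _).2 ⟨w, hw.2.2, rfl⟩⟩
      · intro ha
        exact h0 c m (le_trans (Finset.single_le_sum (f := m0) (fun _ _ => Nat.zero_le _) hc) (by omega)) a ha
  have e1 := h1 m (by omega)
  have e2 := h2 m (by omega)
  have e3 := h3 m (by omega)
  rw [hH, h.finrank] at e2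
  push_cast at e2
  rw [e1, e3] at e2
  linarith

end PB
end deg
end Stm

namespace Stm
section latt
variable {α : Type*} [Lattice α] [IsModularLattice α] [BoundedOrder α]

def ChainOn (LL : α → Prop) (A C : α) : Prop :=
  ∀ X Y, LL X → LL Y → A ≤ X → X ≤ C → A ≤ Y → Y ≤ C → X ≤ Y ∨ Y ≤ X

/-- U1 on an interval -/
def U1 (LL : α → Prop) (A B C D : α) : Prop := LL A → LL B → LL C → A ≤ B → B < C →
  (∀ X, LL X → B ≤ X → X ≤ C → X = B ∨ X = C) → ChainOn LL A B → LL D → A ≤ D → D ≤ C → ¬ D ≤ B → D ≠ C →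
  ∃ Z, LL Z ∧ Z ⊓ B = A ∧ Z ⊔ B = C

def U2 (LL : α → Prop) (A B C D : α) : Prop := LL A → LL B → LL C → A < B → B ≤ C →
  (∀ X, LL X → A ≤ X → X ≤ B → X = A ∨ X = B) → ChainOn LL B C → LL D → A ≤ D → D ≤ C → D ≠ A → ¬ B ≤ D →
  ∃ Z, LL Z ∧ Z ⊓ B = A ∧ Z ⊔ B = C

theorem lattice_chain (LL : α → Prop) (hinf : ∀ X Y, LL X → LL Y → LL (X ⊓ Y)) (hsup : ∀ X Y, LL X → LL Y → LL (X ⊔ Y))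
    (hbot : LL ⊥) (htop : LL ⊤) (r : α → ℕ) (hr : ∀ X Y, LL X → LL Y → X < Y → r X < r Y)
    (hadd : ∀ X Y, LL X → LL Y → r X + r Y = r (X ⊓ Y) + r (X ⊔ Y))
    (h1 : ∀ A B C D, U1 LL A B C D) (h2 : ∀ A B C D, U2 LL A B C D)
    (hne : (⊥ : α) ≠ ⊤) (hind : ∀ X Y, LL X → LL Y → X ⊓ Y = ⊥ → X ⊔ Y = ⊤ → X = ⊥ ∨ Y = ⊥) :
    ∀ X Y, LL X → LL Y → X ≤ Y ∨ Y ≤ X := by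
  classical
  have hr' : ∀ X Y, LL X → LL Y → X ≤ Y → r X ≤ r Y := by
    intro X Y hX hY hXY
    rcases hXY.eq_or_lt with rfl | h
    · exact le_rfl
    · exact (hr X Y hX hY h).le
  have hreq : ∀ X Y, LL X → LL Y → X ≤ Y → r Y ≤ r X → X = Y := by
    intro X Y hX hY hXY hrr
    by_contra hcon
    have := hr X Y hX hY (lt_of_le_of_ne hXY hcon)
    omega
  -- minimal elements above / maximal below
  have hminabove : ∀ B C, LL B → LL C → B < C → ∃ B', LL B' ∧ B < B' ∧ B' ≤ C ∧ ∀ X, LL X → B ≤ X → X ≤ B' → X = B ∨ X = B' := by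
    intro B C hB hC hBC
    have hex : ∃ n, ∃ B', LL B' ∧ B < B' ∧ B' ≤ C ∧ r B' = n := ⟨_, C, hC, hBC, le_rfl, rfl⟩
    obtain ⟨B', hB', h3, h4, h5⟩ := Nat.find_spec hex
    refine ⟨B', hB', h3, h4, fun X hX hX1 hX2 => ?_⟩
    rcases hX1.eq_or_lt with h | h
    · exact Or.inl h.symm
    · right
      refine hreq X B' hX hB' hX2 ?_
      rw [h5]
      exact Nat.find_min' hex ⟨X, hX, h, hX2.trans h4, rfl⟩
  have hmaxbelow : ∀ B, LL B → B ≠ ⊥ → ∃ B', LL B' ∧ B' < B ∧ ∀ X, LL X → B' ≤ X → X ≤ B → X = B' ∨ X = B := by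
    intro B hB hne
    have hex : ∃ n, ∃ B', LL B' ∧ B' < B ∧ r B - r B' = n := ⟨_, ⊥, hbot, bot_lt_iff_ne_bot.2 hne, rfl⟩
    obtain ⟨B', hB', h3, h4⟩ := Nat.find_spec hex
    refine ⟨B', hB', h3, fun X hX hX1 hX2 => ?_⟩
    rcases hX2.eq_or_lt with h | h
    · exact Or.inr h
    · left
      have := Nat.find_min' hex ⟨X, hX, h, rfl⟩
      rw [← h4] at this
      have h6 := hr' _ _ hX hB hX2
      have h7 := hr _ _ hX hB h
      exact (hreq B' X hB' hX hX1 (by omega)).symm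
  -- maximal chain interval
  have hexm : ∃ n, ∃ A B, LL A ∧ LL B ∧ A ≤ B ∧ ChainOn LL A B ∧ r ⊤ - (r B - r A) = n :=
    ⟨_, ⊥, ⊥, hbot, hbot, le_rfl, fun X Y _ _ _ hX hY _ => Or.inl (hX.trans hY), rfl⟩
  obtain ⟨A0, B0, hA0, hB0, hAB0, hch0, hm0⟩ := Nat.find_spec hexm
  have hmax : ∀ A B, LL A → LL B → A ≤ B → ChainOn LL A B → r B - r A ≤ r B0 - r A0 := by
    intro A B hA hB hAB hch
    have h3 := Nat.find_min' hexm ⟨A, B, hA, hB, hAB, hch, rfl⟩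
    rw [← hm0] at h3
    have h4 := hr' _ _ hB0 htop le_top
    have h5 := hr' _ _ hB htop le_top
    omega
  have hpos : 0 < r B0 - r A0 := by
    obtain ⟨B, hB, h3, -, h4⟩ := hminabove ⊥ ⊤ hbot htop (bot_lt_iff_ne_bot.2 (Ne.symm hne))
    have h5 := hmax ⊥ B hbot hB bot_le (by
      intro X Y hX hY hX1 hX2 hY1 hY2
      rcases h4 X hX hX1 hX2 with rfl | rfl
      · exact Or.inl hY1
      · exact Or.inr hY2)
    have := hr _ _ hbot hB h3
    omega
  -- first step
  have hexB : ∃ n, ∃ A B, LL A ∧ LL B ∧ A ⊓ B0 = A0 ∧ A ⊔ B0 = B ∧ r ⊤ - r B = n :=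
    ⟨_, A0, B0, hA0, hB0, inf_eq_left.2 hAB0, sup_eq_right.2 hAB0, rfl⟩
  obtain ⟨A, B, hA, hB, hi, hs, hn⟩ := Nat.find_spec hexB
  have hAB : A ≤ B := hs ▸ le_sup_left
  have hB0B : B0 ≤ B := hs ▸ le_sup_right
  have hchAB : ChainOn LL A B := by
    intro X Y hX hY hX1 hX2 hY1 hY2
    have e : ∀ X, A ≤ X → X ≤ B → X = A ⊔ B0 ⊓ X := by
      intro X h3 h4
      rw [← sup_inf_assoc_of_le B0 h3, hs, inf_eq_right.2 h4]
    have hA0' : ∀ X, A ≤ X → A0 ≤ B0 ⊓ X := fun X h => le_inf hAB0 (hi ▸ inf_le_left.trans h)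
    rcases hch0 (B0 ⊓ X) (B0 ⊓ Y) (hinf _ _ hB0 hX) (hinf _ _ hB0 hY) (hA0' X hX1) inf_le_left (hA0' Y hY1) inf_le_left with h | h
    · left; rw [e X hX1 hX2, e Y hY1 hY2]; exact sup_le_sup le_rfl h
    · right; rw [e X hX1 hX2, e Y hY1 hY2]; exact sup_le_sup le_rfl h
  -- equal rank differences: only inequality needed
  have hBtop : B = ⊤ := by
    by_contra hcon
    obtain ⟨B', hB', hBB', -, hmin⟩ := hminabove B ⊤ hB htop (lt_top_iff_ne_top.2 hcon)
    by_cases hch : ChainOn LL A B'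
    · have h3 := hmax A B' hA hB' (hAB.trans hBB'.le) hch
      have h4 := hadd A B0 hA hB0
      rw [hi, hs] at h4
      have h5 := hr _ _ hB hB' hBB'
      have h6 := hr' _ _ hA hB hAB
      have h7 := hr' _ _ hA0 hB0 hAB0
      omega
    · simp only [ChainOn, not_forall, not_or] at hch
      obtain ⟨X, Y, hX, hY, hX1, hX2, hY1, hY2, h3, h4⟩ := hch
      have : ∃ D, LL D ∧ A ≤ D ∧ D ≤ B' ∧ ¬ D ≤ B ∧ D ≠ B' := by
        by_cases hXB : X ≤ B
        · refine ⟨Y, hY, hY1, hY2, fun hYB => ?_, fun h => h3 (h ▸ hX2)⟩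
          rcases hchAB X Y hX hY hX1 hXB hY1 hYB with h | h
          · exact h3 h
          · exact h4 h
        · exact ⟨X, hX, hX1, hX2, hXB, fun h => h4 (h ▸ hY2)⟩
      obtain ⟨D, hD, hD1, hD2, hD3, hD4⟩ := this
      obtain ⟨Z, hZ, hZ1, hZ2⟩ := h1 A B B' D hA hB hB' hAB hBB' hmin hchAB hD hD1 hD2 hD3 hD4
      have hAZ : A ≤ Z := hZ1 ▸ inf_le_left
      have h5 := Nat.find_min' hexB ⟨Z, B', hZ, hB', by
        rw [← hi, ← hZ1, inf_assoc, inf_eq_right.2 hB0B], by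
        rw [← hZ2, ← hs, ← sup_assoc, sup_eq_left.2 hAZ], rfl⟩
      rw [← hn] at h5
      have h6 := hr _ _ hB hB' hBB'
      have h7 := hr' _ _ hB' htop le_top
      omega
  have hexA : ∃ n, ∃ C A', LL C ∧ LL A' ∧ C ⊔ A = ⊤ ∧ C ⊓ A = A' ∧ r A' = n :=
    ⟨_, ⊤, A, htop, hA, top_sup_eq _, top_inf_eq _, rfl⟩
  obtain ⟨C, A', hC, hA', hCs, hCi, hAn⟩ := Nat.find_spec hexA
  rw [hBtop] at hs hchAB hAB
  have hAC : A' ≤ C := hCi ▸ inf_le_left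
  have hAA : A' ≤ A := hCi ▸ inf_le_right
  have hd1 := hadd A B0 hA hB0
  rw [hi, hs] at hd1
  have hd2 := hadd C A hC hA
  rw [hCi, hCs] at hd2
  have hd3 := hr' _ _ hA' hC hAC
  have hd4 := hr' _ _ hA htop hAB
  have hd5 := hr' _ _ hA0 hB0 hAB0
  have hchC : ChainOn LL A' C := by
    intro X Y hX hY hX1 hX2 hY1 hY2
    have e : ∀ X, A' ≤ X → X ≤ C → X = (X ⊔ A) ⊓ C := by
      intro X h3 h4
      rw [sup_inf_assoc_of_le A h4, inf_comm A C, hCi, sup_eq_left.2 h3]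
    rcases hchAB (X ⊔ A) (Y ⊔ A) (hsup _ _ hX hA) (hsup _ _ hY hA) le_sup_right le_top le_sup_right le_top with h | h
    · left; rw [e X hX1 hX2, e Y hY1 hY2]; exact inf_le_inf h le_rfl
    · right; rw [e X hX1 hX2, e Y hY1 hY2]; exact inf_le_inf h le_rfl
  have hAbot : A' = ⊥ := by
    by_contra hcon
    obtain ⟨A'', hA'', hlt, hmin⟩ := hmaxbelow A' hA' hcon
    by_cases hch : ChainOn LL A'' C
    · have h3 := hmax A'' C hA'' hC (hlt.le.trans hAC) hch
      have h5 := hr _ _ hA'' hA' hlt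
      omega
    · simp only [ChainOn, not_forall, not_or] at hch
      obtain ⟨X, Y, hX, hY, hX1, hX2, hY1, hY2, h3, h4⟩ := hch
      have : ∃ D, LL D ∧ A'' ≤ D ∧ D ≤ C ∧ D ≠ A'' ∧ ¬ A' ≤ D := by
        by_cases hXB : A' ≤ X
        · refine ⟨Y, hY, hY1, hY2, fun h => h4 (h ▸ hX1), fun hYB => ?_⟩
          rcases hchC X Y hX hY hXB hX2 hYB hY2 with h | h
          · exact h3 h
          · exact h4 h
        · exact ⟨X, hX, hX1, hX2, fun h => h3 (h ▸ hY1), hXB⟩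
      obtain ⟨D, hD, hD1, hD2, hD3, hD4⟩ := this
      obtain ⟨Z, hZ, hZ1, hZ2⟩ := h2 A'' A' C D hA'' hA' hC hlt hAC hmin hchC hD hD1 hD2 hD3 hD4
      have hZC : Z ≤ C := hZ2 ▸ le_sup_left
      have h5 := Nat.find_min' hexA ⟨Z, A'', hZ, hA'', by
        rw [← hCs, ← hZ2, sup_assoc, sup_eq_right.2 hAA], by
        rw [← hZ1, ← hCi, ← inf_assoc, inf_eq_left.2 hZC], rfl⟩
      rw [← hAn] at h5
      have h6 := hr _ _ hA'' hA' hlt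
      omega
  rcases hind C A hC hA (hCi.trans hAbot) hCs with h | h
  · exfalso
    rw [h, bot_sup_eq] at hCs
    rw [hCs] at hd1
    omega
  · rw [h] at hchAB
    exact fun X Y hX hY => hchAB X Y hX hY bot_le le_top bot_le le_top
end latt
end Stm

namespace Stm
open LaurentPolynomial

section ss
variable {k : Type u} [Field k]
variable {P : Type u} [AddCommGroup P] [Module k P] [Module k[T;T⁻¹] P] [IsScalarTower k k[T;T⁻¹] P]
variable {W : Type u} [AddCommGroup W] [Module k W] [Module k[T;T⁻¹] W] [IsScalarTower k k[T;T⁻¹] W]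
variable {A : Type u} [AddCommGroup A] [Module k A] [Module k[T;T⁻¹] A] [IsScalarTower k k[T;T⁻¹] A]
variable {V : Type u} [AddCommGroup V] [Module k V] [Module k[T;T⁻¹] V] [IsScalarTower k k[T;T⁻¹] V]

namespace PB

theorem IsHom.comp {e : ℕ} {E : PB k P} {F : PB k W} {G : PB k V} {f : P →ₗ[k[T;T⁻¹]] W} {g : W →ₗ[k[T;T⁻¹]] V}
    (hf : IsHom e E F f) (hg : IsHom 0 F G g) : IsHom e E G (g ∘ₗ f) :=
  ⟨fun n w hw => hg.M _ _ (hf.M n w hw), fun j w hw => by simpa using hg.L _ _ (hf.L j w hw),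
    fun j w hw => by simpa using hg.N _ _ (hf.N j w hw)⟩

theorem IsHom.comp' {e : ℕ} {E : PB k P} {F : PB k W} {G : PB k V} {f : P →ₗ[k[T;T⁻¹]] W} {g : W →ₗ[k[T;T⁻¹]] V}
    (hf : IsHom 0 E F f) (hg : IsHom e F G g) : IsHom e E G (g ∘ₗ f) :=
  ⟨fun n w hw => hg.M _ _ (hf.M n w hw), fun j w hw => by simpa using hg.L _ _ (hf.L j w hw),
    fun j w hw => by simpa using hg.N _ _ (hf.N j w hw)⟩

theorem IsHom.id (E : PB k W) : IsHom 0 E E LinearMap.id := isHom0_iff.2 ⟨fun _ h => h, fun _ _ h => h, fun _ _ h => h⟩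

theorem IsHom.zero (E : PB k W) (F : PB k V) : IsHom 0 E F 0 :=
  isHom0_iff.2 ⟨fun _ h => F.M1.zero_mem, fun _ _ h => (F.L _).zero_mem, fun _ _ h => (F.N _).zero_mem⟩

noncomputable abbrev rk (Q : Submodule k[T;T⁻¹] W) : ℕ := Module.finrank k[T;T⁻¹] Q

theorem sat_ker (F : PB k V) (f : W →ₗ[k[T;T⁻¹]] V) : Sat (LinearMap.ker f) := by
  intro r w hr h
  rw [LinearMap.mem_ker, map_smul] at h
  exact (F.tf r _ h).resolve_left hr

theorem sat_bot (E : PB k W) : Sat (⊥ : Submodule k[T;T⁻¹] W) := by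
  intro r w hr h
  rw [Submodule.mem_bot] at h ⊢
  exact (E.tf r _ h).resolve_left hr

theorem sat_top : Sat (⊤ : Submodule k[T;T⁻¹] W) := fun _ _ _ _ => Submodule.mem_top

theorem sat_inf {P Q : Submodule k[T;T⁻¹] W} (hP : Sat P) (hQ : Sat Q) : Sat (P ⊓ Q) :=
  fun r w hr h => ⟨hP r w hr h.1, hQ r w hr h.2⟩

theorem sat_comap {Q : Submodule k[T;T⁻¹] V} (hQ : Sat Q) (f : W →ₗ[k[T;T⁻¹]] V) : Sat (Q.comap f) :=
  fun r w hr h => hQ r (f w) hr (by rw [← map_smul]; exact h)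

theorem sat_map_subtype {C : Submodule k[T;T⁻¹] W} (hC : Sat C) {Q : Submodule k[T;T⁻¹] C} (hQ : Sat Q) :
    Sat (Q.map C.subtype) := by
  rintro r w hr ⟨x, hx, h⟩
  have hw : w ∈ C := hC r w hr (h ▸ x.2)
  exact ⟨⟨w, hw⟩, hQ r _ hr (by rwa [show r • (⟨w, hw⟩ : C) = x from Subtype.ext h.symm]), rfl⟩

theorem rk_mono (E : PB k W) {A B : Submodule k[T;T⁻¹] W} (h : A ≤ B) : rk A ≤ rk B := by
  haveI := E.finite
  haveI : IsNoetherianRing k[T;T⁻¹] := R_noeth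
  exact Submodule.finrank_mono h

theorem eq_of_rk (E : PB k W) {A B : Submodule k[T;T⁻¹] W} (hA : Sat A) (h : A ≤ B) (hr : rk B ≤ rk A) : A = B := by
  haveI := E.finite
  haveI : IsNoetherianRing k[T;T⁻¹] := R_noeth
  refine le_antisymm h fun b hb => ?_
  have h1 := Submodule.finrank_quotient_add_finrank (A.comap B.subtype)
  have h2 : Module.finrank k[T;T⁻¹] (A.comap B.subtype) = rk A :=
    LinearEquiv.finrank_eq (Submodule.comapSubtypeEquivOfLe h)
  have h3 : Module.finrank k[T;T⁻¹] (B ⧸ A.comap B.subtype) = 0 := by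
    have : rk B = Module.finrank k[T;T⁻¹] B := rfl
    omega
  rw [Module.finrank_eq_zero_iff] at h3
  obtain ⟨a, ha, h4⟩ := h3 ((A.comap B.subtype).mkQ ⟨b, hb⟩)
  rw [← map_smul, Submodule.mkQ_apply, Submodule.Quotient.mk_eq_zero] at h4
  exact hA a b ha h4

theorem rk_top : rk (⊤ : Submodule k[T;T⁻¹] W) = Module.finrank k[T;T⁻¹] W := finrank_top _ _

theorem rk_bot : rk (⊥ : Submodule k[T;T⁻¹] W) = 0 := finrank_bot _ _

theorem rk_lt (E : PB k W) {A B : Submodule k[T;T⁻¹] W} (hA : Sat A) (h : A < B) : rk A < rk B := by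
  by_contra hcon
  exact h.ne (E.eq_of_rk hA h.le (not_lt.1 hcon))

theorem eq_bot_of_rk (E : PB k W) {B : Submodule k[T;T⁻¹] W} (h : rk B = 0) : B = ⊥ :=
  (E.eq_of_rk E.sat_bot bot_le (by omega)).symm

theorem rk_map_add (E : PB k W) (f : W →ₗ[k[T;T⁻¹]] V) : rk (LinearMap.range f) + rk (LinearMap.ker f) = Module.finrank k[T;T⁻¹] W := by
  haveI := E.finite
  have h1 := Submodule.finrank_quotient_add_finrank (LinearMap.ker f)
  rw [LinearEquiv.finrank_eq f.quotKerEquivRange] at h1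
  exact h1

theorem rk_map_inj (f : W →ₗ[k[T;T⁻¹]] V) (hf : Function.Injective f) (Q : Submodule k[T;T⁻¹] W) : rk (Q.map f) = rk Q :=
  (LinearEquiv.finrank_eq (Submodule.equivMapOfInjective f hf Q)).symm

/-- saturation -/
def satc (Q : Submodule k[T;T⁻¹] W) : Submodule k[T;T⁻¹] W where
  carrier := {w | ∃ r : k[T;T⁻¹], r ≠ 0 ∧ r • w ∈ Q}
  zero_mem' := ⟨1, one_ne_zero, by rw [smul_zero]; exact Q.zero_mem⟩
  add_mem' := by
    rintro a b ⟨r, hr, ha⟩ ⟨s, hs, hb⟩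
    refine ⟨r * s, mul_ne_zero hr hs, ?_⟩
    rw [smul_add]
    refine Q.add_mem ?_ ?_
    · rw [mul_comm, mul_smul]; exact Q.smul_mem _ ha
    · rw [mul_smul]; exact Q.smul_mem _ hb
  smul_mem' := by
    rintro c a ⟨r, hr, ha⟩
    exact ⟨r, hr, by rw [smul_comm]; exact Q.smul_mem _ ha⟩

theorem sat_satc (Q : Submodule k[T;T⁻¹] W) : Sat (satc Q) := by
  rintro r w hr ⟨s, hs, h⟩
  exact ⟨s * r, mul_ne_zero hs hr, by rw [mul_smul]; exact h⟩

theorem le_satc (Q : Submodule k[T;T⁻¹] W) : Q ≤ satc Q := fun w hw => ⟨1, one_ne_zero, by rwa [one_smul]⟩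

theorem satc_le {Q S : Submodule k[T;T⁻¹] W} (hS : Sat S) (h : Q ≤ S) : satc Q ≤ S := by
  rintro w ⟨r, hr, hw⟩
  exact hS r w hr (h hw)

theorem rk_satc (E : PB k W) (Q : Submodule k[T;T⁻¹] W) : rk (satc Q) = rk Q := by
  haveI := E.finite
  haveI : IsNoetherianRing k[T;T⁻¹] := R_noeth
  have h1 := Submodule.finrank_quotient_add_finrank (Q.comap (satc Q).subtype)
  have h2 : Module.finrank k[T;T⁻¹] (Q.comap (satc Q).subtype) = rk Q :=
    LinearEquiv.finrank_eq (Submodule.comapSubtypeEquivOfLe (le_satc Q))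
  have h3 : Module.finrank k[T;T⁻¹] (satc Q ⧸ Q.comap (satc Q).subtype) = 0 := by
    rw [Module.finrank_eq_zero_iff]
    intro x
    obtain ⟨⟨w, r, hr, hw⟩, rfl⟩ := Submodule.mkQ_surjective _ x
    refine ⟨r, hr, ?_⟩
    rw [← map_smul, Submodule.mkQ_apply, Submodule.Quotient.mk_eq_zero]
    exact hw
  have : rk (satc Q) = Module.finrank k[T;T⁻¹] (satc Q) := rfl
  omega

/-- factorisation of a hom -/
theorem hom_factor {e : ℕ} {E : PB k W} {F : PB k V} {f : W →ₗ[k[T;T⁻¹]] V} (hf : IsHom e E F f) :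
    ∃ fb : (W ⧸ LinearMap.ker f) →ₗ[k[T;T⁻¹]] satc (LinearMap.range f),
      (∀ w, (fb ((LinearMap.ker f).mkQ w) : V) = f w) ∧ Function.Injective fb ∧
      IsHom e (E.quot _ (F.sat_ker f)) (F.sub (satc (LinearMap.range f))) fb := by
  let fb : (W ⧸ LinearMap.ker f) →ₗ[k[T;T⁻¹]] satc (LinearMap.range f) :=
    (LinearMap.ker f).liftQ (f.codRestrict _ (fun w => le_satc _ ⟨w, rfl⟩)) (by rw [LinearMap.ker_codRestrict])
  have hfb : ∀ w, (fb ((LinearMap.ker f).mkQ w) : V) = f w := fun w => rfl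
  refine ⟨fb, hfb, ?_, ?_⟩
  · rw [← LinearMap.ker_eq_bot, LinearMap.ker_eq_bot']
    intro x hx
    obtain ⟨w, rfl⟩ := Submodule.mkQ_surjective _ x
    have := hfb w
    rw [hx] at this
    rw [Submodule.mkQ_apply, Submodule.Quotient.mk_eq_zero, LinearMap.mem_ker, ← this]; rfl
  · refine ⟨fun n x hx => ?_, ?_, ?_⟩
    · obtain ⟨w, hw, rfl⟩ := ((E.quot_sepi _ (F.sat_ker f)).Mc n x).1 hx
      rw [← (F.ses _ (sat_satc (LinearMap.range f))).Mmono]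
      exact hf.M n w hw
    · rintro j _ ⟨w, hw, rfl⟩
      exact hf.L j w hw
    · rintro j _ ⟨w, hw, rfl⟩
      exact hf.N j w hw

noncomputable def dl (E : PB k W) (μ : ℚ) : ℚ := (E.D : ℚ) - μ * (Module.finrank k[T;T⁻¹] W : ℚ)

theorem SES.dl {EP : PB k P} {EW : PB k W} {EA : PB k A} {ι : P →ₗ[k[T;T⁻¹]] W} {π : W →ₗ[k[T;T⁻¹]] A}
    (h : SES EP EW EA ι π) (μ : ℚ) : EW.dl μ = EP.dl μ + EA.dl μ := by
  unfold PB.dl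
  rw [h.D, h.finrank]
  push_cast; ring

theorem dl_iso {E : PB k W} {F : PB k V} {g : W →ₗ[k[T;T⁻¹]] V} (h : SMono E F g) (hs : Function.Surjective g) (μ : ℚ) :
    E.dl μ = F.dl μ := by
  let e := LinearEquiv.ofBijective g ⟨h.inj, hs⟩
  have hr : Module.finrank k[T;T⁻¹] W = Module.finrank k[T;T⁻¹] V := LinearEquiv.finrank_eq e
  have h1 := D_le_D (Or.inl rfl) h.inj h.isHom hr
  have he : ∀ v, g (e.symm v) = v := fun v => e.apply_symm_apply v
  have h2 : F.D ≤ E.D := by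
    refine D_le_D (Or.inl rfl) (g := e.symm.toLinearMap) e.symm.injective (isHom0_iff.2 ⟨?_, ?_, ?_⟩) hr.symm
    · intro w hw; rw [← he w] at hw; exact (h.M _).1 hw
    · intro j w hw; rw [← he w] at hw; exact (h.L _ _).1 hw
    · intro j w hw; rw [← he w] at hw; exact (h.N _ _).1 hw
  unfold dl
  rw [hr, le_antisymm h1 h2]

theorem dl_map {E : PB k P} {F : PB k W} {ι : P →ₗ[k[T;T⁻¹]] W} (h : SMono E F ι) (Q : Submodule k[T;T⁻¹] P) (μ : ℚ) :
    (E.sub Q).dl μ = (F.sub (Q.map ι)).dl μ := by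
  refine dl_iso (g := (Submodule.equivMapOfInjective ι h.inj Q).toLinearMap) ⟨LinearEquiv.injective _, ?_, ?_, ?_⟩ (LinearEquiv.surjective _) μ
  · intro p; exact h.M p
  · intro j p; exact h.L j p
  · intro j p; exact h.N j p

theorem dl_top (E : PB k W) (μ : ℚ) : (E.sub ⊤).dl μ = E.dl μ :=
  dl_iso (E.sub_smono ⊤) (fun w => ⟨⟨w, Submodule.mem_top⟩, rfl⟩) μ

theorem dl_bot (E : PB k W) (μ : ℚ) : (E.sub ⊥).dl μ = 0 := by
  have h := (E.ses ⊥ E.sat_bot).dl μ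
  have h2 : E.dl μ = (E.quot ⊥ E.sat_bot).dl μ := by
    refine dl_iso (g := (⊥ : Submodule k[T;T⁻¹] W).mkQ) ?_ (Submodule.mkQ_surjective _) μ
    have hi : Function.Injective (⊥ : Submodule k[T;T⁻¹] W).mkQ := by
      rw [← LinearMap.ker_eq_bot, Submodule.ker_mkQ]
    have hq := E.quot_sepi ⊥ E.sat_bot
    refine ⟨hi, fun p => ?_, fun j p => ?_, fun j p => ?_⟩
    · rw [hq.M]; exact ⟨fun ⟨w, hw, h⟩ => hi h ▸ hw, fun h => ⟨p, h, rfl⟩⟩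
    · rw [hq.L]; exact ⟨fun ⟨w, hw, h⟩ => hi h ▸ hw, fun h => ⟨p, h, rfl⟩⟩
    · rw [hq.N]; exact ⟨fun ⟨w, hw, h⟩ => hi h ▸ hw, fun h => ⟨p, h, rfl⟩⟩
  linarith

theorem ses_comap {EP : PB k P} {EW : PB k W} {EA : PB k A} {ι : P →ₗ[k[T;T⁻¹]] W} {π : W →ₗ[k[T;T⁻¹]] A}
    (h : SES EP EW EA ι π) (Q : Submodule k[T;T⁻¹] A) : SES EP (EW.sub (Q.comap π)) (EA.sub Q)
      (ι.codRestrict (Q.comap π) (fun p => by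
        rw [Submodule.mem_comap, (h.exact (ι p)).2 ⟨p, rfl⟩]; exact Q.zero_mem))
      (π.restrict (p := Q.comap π) (q := Q) (fun _ h => h)) where
  mono := ⟨fun a b hab => h.mono.inj (congrArg Subtype.val hab), h.mono.M, h.mono.L, h.mono.N⟩
  epi := by
    refine ⟨?_, ?_, ?_, ?_⟩
    · rintro ⟨a, ha⟩
      obtain ⟨w, rfl⟩ := h.epi.surj a
      exact ⟨⟨w, ha⟩, rfl⟩
    · rintro ⟨a, ha⟩
      refine ((h.epi.M a)).trans ⟨?_, ?_⟩
      · rintro ⟨w, hw, rfl⟩; exact ⟨⟨w, ha⟩, hw, rfl⟩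
      · rintro ⟨w, hw, hh⟩; exact ⟨w, hw, congrArg Subtype.val hh⟩
    · rintro j ⟨a, ha⟩
      refine ((h.epi.L j a)).trans ⟨?_, ?_⟩
      · rintro ⟨w, hw, rfl⟩; exact ⟨⟨w, ha⟩, hw, rfl⟩
      · rintro ⟨w, hw, hh⟩; exact ⟨w, hw, congrArg Subtype.val hh⟩
    · rintro j ⟨a, ha⟩
      refine ((h.epi.N j a)).trans ⟨?_, ?_⟩
      · rintro ⟨w, hw, rfl⟩; exact ⟨⟨w, ha⟩, hw, rfl⟩
      · rintro ⟨w, hw, hh⟩; exact ⟨w, hw, congrArg Subtype.val hh⟩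
  exact := by
    rintro ⟨w, hw⟩
    rw [Subtype.ext_iff]
    refine (h.exact w).trans ?_
    simp only [Subtype.ext_iff]
    rfl

theorem hom_dl {e : ℕ} (he : e = 0 ∨ e = 1) {E : PB k W} {F : PB k V} {f : W →ₗ[k[T;T⁻¹]] V} (hf : IsHom e E F f) (μ : ℚ) :
    E.dl μ ≤ (E.sub (LinearMap.ker f)).dl μ + (F.sub (satc (LinearMap.range f))).dl μ := by
  obtain ⟨fb, h1, h2, h3⟩ := hom_factor hf
  have hs := (E.ses _ (F.sat_ker f))
  rw [hs.dl μ]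
  have hr : Module.finrank k[T;T⁻¹] (W ⧸ LinearMap.ker f) = Module.finrank k[T;T⁻¹] (satc (LinearMap.range f)) := by
    have h4 := hs.finrank
    have h5 := E.rk_map_add f
    have h6 := F.rk_satc (LinearMap.range f)
    unfold rk at h5 h6
    omega
  have := D_le_D he h2 h3 hr
  unfold dl
  rw [hr]
  have : ((E.quot _ (F.sat_ker f)).D : ℚ) ≤ ((F.sub (satc (LinearMap.range f))).D : ℚ) := by exact_mod_cast this
  linarith

theorem rk_satc_range (E : PB k W) (F : PB k V) (f : W →ₗ[k[T;T⁻¹]] V) :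
    rk (satc (LinearMap.range f)) + rk (LinearMap.ker f) = Module.finrank k[T;T⁻¹] W := by
  rw [F.rk_satc, E.rk_map_add]

structure SS (E : PB k W) (μ : ℚ) : Prop where
  eq : E.dl μ = 0
  le : ∀ Q : Submodule k[T;T⁻¹] W, Sat Q → (E.sub Q).dl μ ≤ 0

structure LL (E : PB k W) (μ : ℚ) (Q : Submodule k[T;T⁻¹] W) : Prop where
  sat : Sat Q
  eq : (E.sub Q).dl μ = 0

theorem LL.top {E : PB k W} {μ : ℚ} (h : SS E μ) : LL E μ ⊤ := ⟨sat_top, by rw [dl_top, h.eq]⟩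
theorem LL.bot {E : PB k W} {μ : ℚ} (h : SS E μ) : LL E μ ⊥ := ⟨E.sat_bot, E.dl_bot μ⟩

theorem LL_sub {E : PB k W} {μ : ℚ} {C : Submodule k[T;T⁻¹] W} (hC : Sat C) (Q : Submodule k[T;T⁻¹] C) :
    LL (E.sub C) μ Q ↔ LL E μ (Q.map C.subtype) := by
  have h := dl_map (E.sub_smono C) Q μ
  constructor
  · rintro ⟨h1, h2⟩; exact ⟨sat_map_subtype hC h1, by rw [← h, h2]⟩
  · rintro ⟨h1, h2⟩
    refine ⟨?_, by rw [h, h2]⟩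
    have := sat_comap h1 C.subtype
    rwa [Submodule.comap_map_eq_of_injective C.injective_subtype] at this

theorem LL_quot {E : PB k W} {μ : ℚ} {A : Submodule k[T;T⁻¹] W} (hA : LL E μ A) (Q : Submodule k[T;T⁻¹] (W ⧸ A)) :
    LL (E.quot A hA.sat) μ Q ↔ LL E μ (Q.comap A.mkQ) := by
  have h := (ses_comap (E.ses A hA.sat) Q).dl μ
  rw [hA.eq, zero_add] at h
  constructor
  · rintro ⟨h1, h2⟩; exact ⟨sat_comap h1 _, by rw [h, h2]⟩
  · rintro ⟨h1, h2⟩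
    refine ⟨?_, by rw [← h, h2]⟩
    intro r x hr hx
    obtain ⟨w, rfl⟩ := A.mkQ_surjective x
    exact h1 r w hr (by rwa [Submodule.mem_comap, map_smul])

theorem SS.sub {E : PB k W} {μ : ℚ} (h : SS E μ) {C : Submodule k[T;T⁻¹] W} (hC : LL E μ C) : SS (E.sub C) μ :=
  ⟨hC.eq, fun Q hQ => by rw [dl_map (E.sub_smono C) Q μ]; exact h.le _ (sat_map_subtype hC.sat hQ)⟩

theorem SS.quot {E : PB k W} {μ : ℚ} (h : SS E μ) {C : Submodule k[T;T⁻¹] W} (hC : LL E μ C) : SS (E.quot C hC.sat) μ := by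
  constructor
  · have := (E.ses C hC.sat).dl μ
    rw [h.eq, hC.eq] at this
    linarith
  · intro Q hQ
    have h1 := (ses_comap (E.ses C hC.sat) Q).dl μ
    rw [hC.eq, zero_add] at h1
    rw [← h1]
    exact h.le _ (sat_comap hQ _)

section homs
variable {E : PB k W} {F : PB k V} {μ : ℚ} {e : ℕ} {f : W →ₗ[k[T;T⁻¹]] V}

theorem ker_LL (hE : SS E μ) (hF : SS F μ) (he : e = 0 ∨ e = 1) (hf : IsHom e E F f) : LL E μ (LinearMap.ker f) := by
  refine ⟨F.sat_ker f, le_antisymm (hE.le _ (F.sat_ker f)) ?_⟩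
  have h1 := hom_dl he hf μ
  have h2 := hF.le _ (sat_satc (LinearMap.range f))
  rw [hE.eq] at h1
  linarith

theorem satc_LL (hE : SS E μ) (hF : SS F μ) (he : e = 0 ∨ e = 1) (hf : IsHom e E F f) : LL F μ (satc (LinearMap.range f)) := by
  refine ⟨sat_satc _, le_antisymm (hF.le _ (sat_satc _)) ?_⟩
  have h1 := hom_dl he hf μ
  have h2 := hE.le _ (F.sat_ker f)
  rw [hE.eq] at h1
  linarith

/-- strict bijection -/
theorem bij_strict (hE : SS E μ) (hF : SS F μ) (hf : IsHom 0 E F f) (hi : Function.Injective f)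
    (hr : Module.finrank k[T;T⁻¹] W = Module.finrank k[T;T⁻¹] V) : Function.Surjective f ∧ SMono E F f := by
  refine strict_of_D_eq hi hf hr ?_
  have h1 := hE.eq
  have h2 := hF.eq
  unfold dl at h1 h2
  rw [hr] at h1
  have : (E.D : ℚ) = F.D := by linarith
  exact_mod_cast this

theorem exists_inv (hE : SS E μ) (hF : SS F μ) (hf : IsHom 0 E F f) (hi : Function.Bijective f) :
    ∃ g : V →ₗ[k[T;T⁻¹]] W, IsHom 0 F E g ∧ (∀ w, g (f w) = w) ∧ ∀ v, f (g v) = v := by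
  let e := LinearEquiv.ofBijective f hi
  have h := (bij_strict hE hF hf hi.1 (LinearEquiv.finrank_eq e)).2
  have he : ∀ v, f (e.symm v) = v := fun v => e.apply_symm_apply v
  refine ⟨e.symm.toLinearMap, isHom0_iff.2 ⟨?_, ?_, ?_⟩, fun w => e.symm_apply_apply w, he⟩
  · intro w hw; rw [← he w] at hw; exact (h.M _).1 hw
  · intro j w hw; rw [← he w] at hw; exact (h.L _ _).1 hw
  · intro j w hw; rw [← he w] at hw; exact (h.N _ _).1 hw

theorem hom_strict (hE : SS E μ) (hF : SS F μ) (hf : IsHom 0 E F f) :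
    LL F μ (LinearMap.range f) ∧ (∀ v ∈ LinearMap.range f, v ∈ F.M1 → ∃ w ∈ E.M1, f w = v) ∧
    (∀ j, ∀ v ∈ LinearMap.range f, v ∈ F.L j → ∃ w ∈ E.L j, f w = v) ∧
    (∀ j, ∀ v ∈ LinearMap.range f, v ∈ F.N j → ∃ w ∈ E.N j, f w = v) := by
  obtain ⟨fb, h1, h2, h3⟩ := hom_factor hf
  have hk := ker_LL hE hF (Or.inl rfl) hf
  have hS := satc_LL hE hF (Or.inl rfl) hf
  have hr : Module.finrank k[T;T⁻¹] (W ⧸ LinearMap.ker f) = Module.finrank k[T;T⁻¹] (satc (LinearMap.range f)) := by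
    have h4 := (E.ses _ (F.sat_ker f)).finrank
    have h5 := E.rk_map_add f
    have h6 := F.rk_satc (LinearMap.range f)
    unfold rk at h5 h6
    omega
  obtain ⟨hsur, hst⟩ := bij_strict (hE.quot hk) (hF.sub hS) h3 h2 hr
  have hrg : satc (LinearMap.range f) = LinearMap.range f := by
    refine le_antisymm (fun v hv => ?_) (le_satc _)
    obtain ⟨x, hx⟩ := hsur ⟨v, hv⟩
    obtain ⟨w, rfl⟩ := Submodule.mkQ_surjective _ x
    exact ⟨w, by rw [← h1, hx]⟩
  refine ⟨hrg ▸ hS, ?_, ?_, ?_⟩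
  · rintro _ ⟨w, rfl⟩ hv
    obtain ⟨w', hw', h⟩ := (hst.M ((LinearMap.ker f).mkQ w)).1 (show (fb ((LinearMap.ker f).mkQ w) : V) ∈ F.M1 by rw [h1]; exact hv)
    exact ⟨w', hw', by rw [← h1, h, h1]⟩
  · rintro j _ ⟨w, rfl⟩ hv
    obtain ⟨w', hw', h⟩ := (hst.L j ((LinearMap.ker f).mkQ w)).1 (show (fb ((LinearMap.ker f).mkQ w) : V) ∈ F.L j by rw [h1]; exact hv)
    exact ⟨w', hw', by rw [← h1]; exact (congrArg (fun x => (fb x : V)) h).trans (h1 w)⟩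
  · rintro j _ ⟨w, rfl⟩ hv
    obtain ⟨w', hw', h⟩ := (hst.N j ((LinearMap.ker f).mkQ w)).1 (show (fb ((LinearMap.ker f).mkQ w) : V) ∈ F.N j by rw [h1]; exact hv)
    exact ⟨w', hw', by rw [← h1]; exact (congrArg (fun x => (fb x : V)) h).trans (h1 w)⟩

end homs

theorem isHom_mkQ_subtype (E : PB k W) (P Q : Submodule k[T;T⁻¹] W) (hQ : Sat Q) :
    IsHom 0 (E.sub P) (E.quot Q hQ) (Q.mkQ ∘ₗ P.subtype) := (E.sub_smono P).isHom.comp (E.quot_sepi Q hQ).isHom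

theorem LL.inf {E : PB k W} {μ : ℚ} (hE : SS E μ) {P Q : Submodule k[T;T⁻¹] W} (hP : LL E μ P) (hQ : LL E μ Q) :
    LL E μ (P ⊓ Q) := by
  have h := ker_LL (hE.sub hP) (hE.quot hQ) (Or.inl rfl) (E.isHom_mkQ_subtype P Q hQ.sat)
  rw [LL_sub hP.sat, LinearMap.ker_comp, Submodule.ker_mkQ, Submodule.map_comap_subtype] at h
  exact h

theorem LL.sup {E : PB k W} {μ : ℚ} (hE : SS E μ) {P Q : Submodule k[T;T⁻¹] W} (hP : LL E μ P) (hQ : LL E μ Q) :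
    LL E μ (P ⊔ Q) := by
  have h := (hom_strict (hE.sub hP) (hE.quot hQ) (E.isHom_mkQ_subtype P Q hQ.sat)).1
  rw [LL_quot hQ, LinearMap.range_comp, Submodule.range_subtype, Submodule.comap_map_mkQ, sup_comm] at h
  exact h

theorem rk_add (E : PB k W) (P Q : Submodule k[T;T⁻¹] W) : rk P + rk Q = rk (P ⊓ Q) + rk (P ⊔ Q) := by
  have h1 := (E.sub P).rk_map_add (Q.mkQ ∘ₗ P.subtype)
  have h2 := (E.sub (P ⊔ Q)).rk_map_add (Q.mkQ ∘ₗ (P ⊔ Q).subtype)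
  rw [LinearMap.range_comp, LinearMap.ker_comp, Submodule.ker_mkQ, Submodule.range_subtype] at h1 h2
  rw [← rk_map_inj P.subtype P.injective_subtype, Submodule.map_comap_subtype] at h1
  rw [← rk_map_inj (P ⊔ Q).subtype (P ⊔ Q).injective_subtype, Submodule.map_comap_subtype, inf_eq_right.2 le_sup_right,
    Submodule.map_sup, Submodule.mkQ_map_self, sup_bot_eq] at h2
  have : rk P = Module.finrank k[T;T⁻¹] P := rfl
  have : rk (P ⊔ Q) = Module.finrank k[T;T⁻¹] (P ⊔ Q : Submodule k[T;T⁻¹] W) := rfl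
  omega

end PB
end ss
end Stm

namespace Stm
open LaurentPolynomial

section uni
variable {k : Type u} [Field k]
variable {P : Type u} [AddCommGroup P] [Module k P] [Module k[T;T⁻¹] P] [IsScalarTower k k[T;T⁻¹] P]
variable {W : Type u} [AddCommGroup W] [Module k W] [Module k[T;T⁻¹] W] [IsScalarTower k k[T;T⁻¹] W]
variable {A : Type u} [AddCommGroup A] [Module k A] [Module k[T;T⁻¹] A] [IsScalarTower k k[T;T⁻¹] A]
variable {V : Type u} [AddCommGroup V] [Module k V] [Module k[T;T⁻¹] V] [IsScalarTower k k[T;T⁻¹] V]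

namespace PB

def Ind (E : PB k W) : Prop :=
  ∀ q : W →ₗ[k[T;T⁻¹]] W, IsHom 0 E E q → (∀ w, q (q w) = q w) → q = 0 ∨ q = LinearMap.id

theorem exists_slope (E : PB k W) (w0 : W) (hw : w0 ≠ 0) : ∃ μ : ℚ, (∀ Q, Sat Q → (E.sub Q).dl μ ≤ 0) ∧
    ∃ Q, Q ≠ ⊥ ∧ LL E μ Q := by
  classical
  set r := Module.finrank k[T;T⁻¹] W with hr
  let c : Submodule k[T;T⁻¹] W → ℕ := fun Q => Nat.factorial r / rk Q
  have hrk : ∀ Q : Submodule k[T;T⁻¹] W, Q ≠ ⊥ → 0 < rk Q ∧ c Q * rk Q = Nat.factorial r := by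
    intro Q hQ
    have h1 : 0 < rk Q := Nat.pos_of_ne_zero fun h => hQ (E.eq_bot_of_rk h)
    have h2 : rk Q ≤ r := by
      have := E.rk_mono (le_top : Q ≤ ⊤)
      rwa [rk_top] at this
    exact ⟨h1, Nat.div_mul_cancel (Nat.dvd_factorial h1 h2)⟩
  have hbd : ∃ b : ℤ, ∀ z, (∃ Q, Sat Q ∧ Q ≠ ⊥ ∧ z = (E.sub Q).D * (c Q : ℤ)) → z ≤ b := by
    refine ⟨(E.H 0 : ℤ) * (Nat.factorial r : ℤ), ?_⟩
    rintro z ⟨Q, hQ, hQ0, rfl⟩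
    have h1 := (E.sub Q).D_le 0
    have h2 := H_le (E.sub_smono Q).inj (E.sub_smono Q).isHom 0
    have h3 : (E.sub Q).D ≤ (E.H 0 : ℤ) := by
      have : ((E.sub Q).H 0 : ℤ) ≤ (E.H 0 : ℤ) := by exact_mod_cast h2
      simp only [Nat.cast_zero, mul_zero, zero_add] at h1
      exact h1.trans this
    refine mul_le_mul h3 ?_ (by positivity) (by positivity)
    exact_mod_cast Nat.div_le_self _ _
  obtain ⟨lb, ⟨Q, hQ, hQ0, hlb⟩, hmax⟩ := Int.exists_greatest_of_bdd hbd
    ⟨_, ⊤, sat_top, (fun h => hw (by have : w0 ∈ (⊤ : Submodule k[T;T⁻¹] W) := Submodule.mem_top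
                                     rw [h] at this; exact this)), rfl⟩
  have key : ∀ Q : Submodule k[T;T⁻¹] W, Q ≠ ⊥ →
      (c Q : ℚ) * (E.sub Q).dl ((lb : ℚ) / (Nat.factorial r : ℚ)) = (((E.sub Q).D * (c Q : ℤ) : ℤ) : ℚ) - lb ∧ 0 < (c Q : ℚ) := by
    intro Q hQ
    obtain ⟨h1, h2⟩ := hrk Q hQ
    have h3 : 0 < c Q := by
      rcases Nat.eq_zero_or_pos (c Q) with h | h
      · rw [h, zero_mul] at h2; exact absurd h2.symm (Nat.factorial_ne_zero _)
      · exact h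
    have h4 : (0 : ℚ) < c Q := by exact_mod_cast h3
    have h5 : (0 : ℚ) < rk Q := by exact_mod_cast h1
    refine ⟨?_, h4⟩
    unfold dl
    rw [← h2]
    push_cast
    have : ((Module.finrank k[T;T⁻¹] Q : ℕ) : ℚ) = (rk Q : ℚ) := rfl
    rw [this]
    field_simp
  refine ⟨(lb : ℚ) / (Nat.factorial r : ℚ), ?_, Q, hQ0, hQ, ?_⟩
  · intro Q hQ
    by_cases h0 : Q = ⊥
    · subst h0; rw [dl_bot]
    · obtain ⟨h1, h2⟩ := key Q h0
      have h3 := hmax _ ⟨Q, hQ, h0, rfl⟩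
      have h4 : (((E.sub Q).D * (c Q : ℤ) : ℤ) : ℚ) ≤ (lb : ℚ) := by exact_mod_cast h3
      by_contra hcon
      have := mul_pos h2 (not_le.1 hcon)
      linarith
  · obtain ⟨h1, h2⟩ := key Q hQ0
    rw [← hlb, sub_self] at h1
    exact (mul_eq_zero.1 h1).resolve_left h2.ne'

theorem Ind.ss {E : PB k W} (hE : Ind E) (w0 : W) (hw : w0 ≠ 0) : ∃ μ, SS E μ := by
  classical
  obtain ⟨μ, hle, Q0, hQ0, hQL⟩ := E.exists_slope w0 hw
  refine ⟨μ, ?_⟩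
  have hex : ∃ n, ∃ Q, Q ≠ ⊥ ∧ LL E μ Q ∧ Module.finrank k[T;T⁻¹] W - rk Q = n := ⟨_, Q0, hQ0, hQL, rfl⟩
  obtain ⟨Q, hQ, hL, hn⟩ := Nat.find_spec hex
  have hsub : ∀ X : Submodule k[T;T⁻¹] Q, Sat X → ((E.sub Q).sub X).dl μ ≤ 0 := fun X hX => by
    rw [dl_map (E.sub_smono Q) X μ]; exact hle _ (sat_map_subtype hL.sat hX)
  rcases extend_or (E.ses Q hL.sat) (IsHom.id (E.sub Q)) with ⟨χ, h1, h2⟩ | ⟨g, h1, -, h3⟩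
  · rcases hE (Q.subtype ∘ₗ χ) (h1.comp (E.sub_smono Q).isHom) (fun w => by
      simp only [LinearMap.comp_apply]
      rw [h2]; rfl) with h | h
    · exfalso
      apply hQ
      rw [Submodule.eq_bot_iff]
      intro x hx
      have h4 := LinearMap.congr_fun h x
      have h5 := h2 ⟨x, hx⟩
      simp only [LinearMap.comp_apply, LinearMap.zero_apply] at h4
      rw [show Q.subtype ⟨x, hx⟩ = x from rfl] at h5
      rw [h5] at h4
      exact h4
    · have : Q = ⊤ := by
        rw [eq_top_iff]
        intro x _
        have h4 := LinearMap.congr_fun h x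
        rw [LinearMap.id_apply] at h4
        rw [← h4]
        exact (χ x).2
      exact ⟨by rw [← dl_top, ← this]; exact hL.eq, hle⟩
  · exfalso
    set S := satc (LinearMap.range g)
    have h4 := hom_dl (Or.inr rfl) h1 μ
    have h5 := hsub _ ((E.quot Q hL.sat).sat_ker g)
    rw [hL.eq] at h4
    have h6 := ses_comap (E.ses Q hL.sat) S
    have h7 := h6.dl μ
    have h8 := hle _ (sat_comap (sat_satc (LinearMap.range g)) Q.mkQ)
    have h9 := h6.finrank
    rw [hL.eq] at h7
    have hS : 0 < rk S := by
      refine Nat.pos_of_ne_zero fun h => ?_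
      have hS0 := (E.quot Q hL.sat).eq_bot_of_rk h
      refine h3 Q hL.sat (by rw [Submodule.range_subtype]) ?_ LinearMap.id (IsHom.id _) fun x => rfl
      exact (le_satc _).trans (hS0.le.trans bot_le)
    have hLL : LL E μ (S.comap Q.mkQ) := ⟨sat_comap (sat_satc _) _, by
      change (E.sub (S.comap Q.mkQ)).dl μ = _ at h7
      change (E.sub (S.comap Q.mkQ)).dl μ ≤ 0 at h8
      change 0 ≤ _ + ((E.quot Q hL.sat).sub S).dl μ at h4
      linarith⟩
    have h10 := Nat.find_min' hex ⟨S.comap Q.mkQ, fun h => hQ (by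
      rw [eq_bot_iff, ← h]
      intro x hx
      rw [Submodule.mem_comap, Submodule.mkQ_apply, (Submodule.Quotient.mk_eq_zero Q).2 hx]
      exact S.zero_mem), hLL, rfl⟩
    rw [← hn] at h10
    have h11 := E.rk_mono (le_top : S.comap Q.mkQ ≤ ⊤)
    rw [rk_top] at h11
    have h12 : rk (S.comap Q.mkQ) = rk Q + rk S := h9
    omega

/-- complement gives retraction -/
theorem retract {EP : PB k P} {F : PB k V} {μ : ℚ} (hP : SS EP μ) (hF : SS F μ) {ι : P →ₗ[k[T;T⁻¹]] V}
    (hι : IsHom 0 EP F ι) {D : Submodule k[T;T⁻¹] V} (hD : LL F μ D) (h1 : D.comap ι = ⊥) (h2 : LinearMap.range ι ⊔ D = ⊤) :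
    ∃ χ : V →ₗ[k[T;T⁻¹]] P, IsHom 0 F EP χ ∧ (∀ p, χ (ι p) = p) ∧ ∀ d ∈ D, χ d = 0 := by
  have hh := hι.comp (F.quot_sepi D hD.sat).isHom
  have hb : Function.Bijective (D.mkQ ∘ₗ ι) := by
    constructor
    · rw [← LinearMap.ker_eq_bot, LinearMap.ker_comp, Submodule.ker_mkQ, h1]
    · rw [← LinearMap.range_eq_top, LinearMap.range_comp]
      have := congrArg (Submodule.map D.mkQ) h2
      rwa [Submodule.map_sup, Submodule.mkQ_map_self, sup_bot_eq, Submodule.map_top, Submodule.range_mkQ] at this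
  obtain ⟨g, hg, hg1, hg2⟩ := exists_inv hP (hF.quot hD) hh hb
  refine ⟨g ∘ₗ D.mkQ, (F.quot_sepi D hD.sat).isHom.comp hg, hg1, fun d hd => ?_⟩
  rw [LinearMap.comp_apply, Submodule.mkQ_apply, (Submodule.Quotient.mk_eq_zero D).2 hd, map_zero]

theorem compl_of_retract {E : PB k W} {μ : ℚ} (hE : SS E μ) {B : Submodule k[T;T⁻¹] W} (hB : LL E μ B)
    {χ : W →ₗ[k[T;T⁻¹]] B} (h1 : IsHom 0 E (E.sub B) χ) (h2 : ∀ p : B, χ p = p) :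
    ∃ Z, LL E μ Z ∧ Z ⊓ B = ⊥ ∧ Z ⊔ B = ⊤ := by
  refine ⟨LinearMap.ker χ, ker_LL hE (hE.sub hB) (Or.inl rfl) h1, ?_, ?_⟩
  · rw [Submodule.eq_bot_iff]
    rintro x ⟨hx, hxB⟩
    have := h2 ⟨x, hxB⟩
    rw [LinearMap.mem_ker.1 hx] at this
    exact (congrArg Subtype.val this).symm
  · rw [eq_top_iff]
    intro x _
    rw [Submodule.mem_sup]
    exact ⟨x - χ x, by rw [LinearMap.mem_ker, map_sub, h2, sub_self], χ x, (χ x).2, sub_add_cancel _ _⟩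

theorem u1_top {E : PB k W} {μ : ℚ} (hE : SS E μ) (B D : Submodule k[T;T⁻¹] W) : U1 (LL E μ) ⊥ B ⊤ D := by
  intro _ hB _ _ hBT hmin hch hD _ _ hDB hDT
  have hBD : B ⊔ D = ⊤ := (hmin (B ⊔ D) (hB.sup hE hD) le_sup_left le_top).resolve_left
    (fun h => hDB (h ▸ le_sup_right))
  rcases extend_or (E.ses B hB.sat) (IsHom.id (E.sub B)) with ⟨χ, h1, h2⟩ | ⟨g, h1, h3, -⟩
  · exact compl_of_retract hE hB h1 h2
  · exfalso
    have hBs := hE.sub hB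
    have hBq := hE.quot hB
    set X : Submodule k[T;T⁻¹] B := D.comap B.subtype with hX
    have hXm : X.map B.subtype = B ⊓ D := Submodule.map_comap_subtype _ _
    have hXL : LL (E.sub B) μ X := (LL_sub hB.sat X).2 (hXm ▸ hB.inf hE hD)
    have hXT : X ≠ ⊤ := by
      intro h
      have hle : B ≤ D := by
        intro b hb
        have : (⟨b, hb⟩ : B) ∈ X := h ▸ Submodule.mem_top
        exact this
      rw [sup_eq_right.2 hle] at hBD
      exact hDT hBD
    have hKL := ker_LL hBs hBq (Or.inr rfl) h1
    have hXK : X ≤ LinearMap.ker g := by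
      have hcmp : X ≤ LinearMap.ker g ∨ LinearMap.ker g ≤ X := by
        have := hch (X.map B.subtype) ((LinearMap.ker g).map B.subtype) ((LL_sub hB.sat X).1 hXL) ((LL_sub hB.sat _).1 hKL)
          bot_le (Submodule.map_subtype_le _ _) bot_le (Submodule.map_subtype_le _ _)
        rwa [Submodule.map_le_map_iff_of_injective B.injective_subtype,
          Submodule.map_le_map_iff_of_injective B.injective_subtype] at this
      rcases hcmp with h | h
      · exact h
      have hh := ((E.sub B).sub_smono X).isHom.comp' h1
      have hS := satc_LL (hBs.sub hXL) hBq (Or.inr rfl) hh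
      have hrk := rk_satc_range ((E.sub B).sub X) (E.quot B hB.sat) (g ∘ₗ X.subtype)
      have hrk2 := rk_satc_range (E.sub B) (E.quot B hB.sat) g
      rcases hmin _ ((LL_quot hB _).1 hS) (by
        intro x hx
        rw [Submodule.mem_comap, Submodule.mkQ_apply, (Submodule.Quotient.mk_eq_zero B).2 hx]
        exact Submodule.zero_mem _) le_top with h5 | h5
      · intro x hx
        have h6 : g x ∈ satc (LinearMap.range (g ∘ₗ X.subtype)) := le_satc _ ⟨⟨x, hx⟩, rfl⟩
        obtain ⟨w, hw⟩ := B.mkQ_surjective (g x)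
        rw [← hw] at h6
        have h7 : w ∈ B := by rw [← h5]; exact h6
        rw [LinearMap.mem_ker, ← hw]
        exact (Submodule.Quotient.mk_eq_zero B).2 h7
      · exfalso
        have h6 : satc (LinearMap.range (g ∘ₗ X.subtype)) = ⊤ := by
          rw [eq_top_iff]
          intro y _
          obtain ⟨w, rfl⟩ := B.mkQ_surjective y
          have : w ∈ (⊤ : Submodule k[T;T⁻¹] W) := Submodule.mem_top
          rw [← h5] at this
          exact this
        have h8 := rk_map_inj (W := X) (V := B) X.subtype X.injective_subtype ((LinearMap.ker g).comap X.subtype)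
        rw [Submodule.map_comap_subtype, inf_eq_right.2 h] at h8
        rw [h6, LinearMap.ker_comp, ← h8] at hrk
        have h7 := (E.quot B hB.sat).rk_mono (le_top : satc (LinearMap.range g) ≤ ⊤)
        apply hXT
        refine (E.sub B).eq_of_rk hXL.sat le_top ?_
        rw [rk_top]
        have : rk X = Module.finrank k[T;T⁻¹] X := rfl
        omega
    -- the map to the quotient by X
    have hq := (E.sub B).quot_sepi X hXL.sat
    have hθ : IsHom 0 ((E.sub B).quot X hXL.sat) (E.quot D hD.sat)
        (X.mapQ D B.subtype le_rfl) := by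
      refine isHom0_iff.2 ⟨?_, ?_, ?_⟩
      · rintro _ ⟨w, hw, rfl⟩; exact ⟨w, hw, rfl⟩
      · rintro j _ ⟨w, hw, rfl⟩; exact ⟨w, hw, rfl⟩
      · rintro j _ ⟨w, hw, rfl⟩; exact ⟨w, hw, rfl⟩
    have hbij : Function.Bijective (X.mapQ D B.subtype le_rfl) := by
      constructor
      · rw [← LinearMap.ker_eq_bot, LinearMap.ker_eq_bot']
        intro x hx
        obtain ⟨b, rfl⟩ := X.mkQ_surjective x
        rw [Submodule.mkQ_apply, Submodule.mapQ_apply, Submodule.Quotient.mk_eq_zero] at hx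
        rw [Submodule.mkQ_apply, Submodule.Quotient.mk_eq_zero]
        exact hx
      · intro y
        obtain ⟨w, rfl⟩ := D.mkQ_surjective y
        have : w ∈ B ⊔ D := hBD ▸ Submodule.mem_top
        obtain ⟨b, hb, d, hd, rfl⟩ := Submodule.mem_sup.1 this
        refine ⟨X.mkQ ⟨b, hb⟩, ?_⟩
        rw [Submodule.mkQ_apply, Submodule.mapQ_apply, map_add, Submodule.mkQ_apply, Submodule.mkQ_apply, (Submodule.Quotient.mk_eq_zero D).2 hd, add_zero]
        rfl
    obtain ⟨i, hi, hi1, hi2⟩ := exists_inv (hBs.quot hXL) (hE.quot hD) hθ hbij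
    refine h3 _ _ X.mkQ hq (by rw [Submodule.ker_mkQ]; exact hXK) (i ∘ₗ D.mkQ) ((E.quot_sepi D hD.sat).isHom.comp hi) fun x => ?_
    exact hi1 (X.mkQ x)

theorem u2_top {E : PB k W} {μ : ℚ} (hE : SS E μ) (B D : Submodule k[T;T⁻¹] W) : U2 (LL E μ) ⊥ B ⊤ D := by
  intro _ hB _ hB0 _ hmin hch hD _ _ hD0 hBD
  have hinf : B ⊓ D = ⊥ := (hmin _ (hB.inf hE hD) bot_le inf_le_left).resolve_right (fun h => hBD (h ▸ inf_le_right))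
  rcases extend_or (E.ses B hB.sat) (IsHom.id (E.sub B)) with ⟨χ, h1, h2⟩ | ⟨g, h1, -, h3⟩
  · exact compl_of_retract hE hB h1 h2
  · exfalso
    have hBs := hE.sub hB
    have hBq := hE.quot hB
    set Q := B ⊔ D with hQ
    have hQL := hB.sup hE hD
    have hrQ := E.rk_add B D
    rw [hinf, rk_bot, zero_add] at hrQ
    have hrD : 0 < rk D := Nat.pos_of_ne_zero fun h => hD0 (E.eq_bot_of_rk h)
    have hS := satc_LL hBs hBq (Or.inr rfl) h1
    have hS' := (LL_quot hB _).1 hS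
    set S := satc (LinearMap.range g) with hSdef
    have hBS : B ≤ S.comap B.mkQ := by
      intro x hx
      rw [Submodule.mem_comap, Submodule.mkQ_apply, (Submodule.Quotient.mk_eq_zero B).2 hx]
      exact Submodule.zero_mem _
    have hle : LinearMap.range g ≤ Q.map B.mkQ := by
      rcases hch _ _ hS' hQL hBS le_top le_sup_left le_top with h | h
      · have := Submodule.map_mono (f := B.mkQ) h
        rw [Submodule.map_comap_eq_of_surjective B.mkQ_surjective] at this
        exact (le_satc _).trans this
      · have hBQ : B ≤ Q := le_sup_left
        have hpi : IsHom 0 (E.quot B hB.sat) (E.quot Q hQL.sat) (B.mapQ Q LinearMap.id hBQ) := by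
          refine isHom0_iff.2 ⟨?_, ?_, ?_⟩
          · rintro _ ⟨w, hw, rfl⟩; exact ⟨w, hw, rfl⟩
          · rintro j _ ⟨w, hw, rfl⟩; exact ⟨w, hw, rfl⟩
          · rintro j _ ⟨w, hw, rfl⟩; exact ⟨w, hw, rfl⟩
        have hh := h1.comp hpi
        have hk := ker_LL hBs (hE.quot hQL) (Or.inr rfl) hh
        have hk' := (LL_sub hB.sat _).1 hk
        rcases hmin _ hk' bot_le (Submodule.map_subtype_le _ _) with h5 | h5
        · exfalso
          have h6 : LinearMap.ker (B.mapQ Q LinearMap.id hBQ ∘ₗ g) = ⊥ := by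
            apply Submodule.map_injective_of_injective B.injective_subtype
            rw [h5, Submodule.map_bot]
          have h7 := (E.sub B).rk_map_add (B.mapQ Q LinearMap.id hBQ ∘ₗ g)
          rw [h6, rk_bot, add_zero] at h7
          have h8 : LinearMap.range (B.mapQ Q LinearMap.id hBQ ∘ₗ g) ≤ (S.comap B.mkQ).map Q.mkQ := by
            rintro _ ⟨x, rfl⟩
            obtain ⟨w, hw⟩ := B.mkQ_surjective (g x)
            refine ⟨w, ?_, ?_⟩
            · show B.mkQ w ∈ S
              rw [hw]; exact le_satc _ ⟨x, rfl⟩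
            · rw [LinearMap.comp_apply, ← hw]; rfl
          have h9 := (E.quot Q hQL.sat).rk_mono h8
          have h10 := (E.sub (S.comap B.mkQ)).rk_map_add (Q.mkQ ∘ₗ (S.comap B.mkQ).subtype)
          rw [LinearMap.range_comp, LinearMap.ker_comp, Submodule.ker_mkQ, Submodule.range_subtype,
            ← rk_map_inj (S.comap B.mkQ).subtype (Submodule.injective_subtype _), Submodule.map_comap_subtype, inf_eq_right.2 h] at h10
          have h11 := (ses_comap (E.ses B hB.sat) S).finrank
          have h12 := rk_satc_range (E.sub B) (E.quot B hB.sat) g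
          have e1 : rk S = Module.finrank k[T;T⁻¹] S := rfl
          have e2 : rk B = Module.finrank k[T;T⁻¹] B := rfl
          rw [← hSdef] at h12
          omega
        · rintro _ ⟨x, rfl⟩
          have h6 : (x : W) ∈ (LinearMap.ker (B.mapQ Q LinearMap.id hBQ ∘ₗ g)).map B.subtype := by rw [h5]; exact x.2
          obtain ⟨y, hy, hyx⟩ := h6
          have hyx' : y = x := Subtype.ext hyx
          subst hyx'
          obtain ⟨w, hw⟩ := B.mkQ_surjective (g y)
          refine ⟨w, ?_, hw⟩
          rw [SetLike.mem_coe, LinearMap.mem_ker, LinearMap.comp_apply, ← hw] at hy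
          exact (Submodule.Quotient.mk_eq_zero Q).1 hy
    have hBQ : B ≤ Q := le_sup_left
    have hι : IsHom 0 (E.sub B) (E.sub Q) (Submodule.inclusion hBQ) :=
      isHom0_iff.2 ⟨fun _ h => h, fun _ _ h => h, fun _ _ h => h⟩
    have hDL : LL (E.sub Q) μ (D.comap Q.subtype) := by
      rw [LL_sub hQL.sat, Submodule.map_comap_subtype, inf_eq_right.2 le_sup_right]; exact hD
    obtain ⟨χ, hc1, hc2, -⟩ := retract hBs (hE.sub hQL) hι hDL (by
      rw [Submodule.eq_bot_iff]
      intro x hx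
      have : (x : W) ∈ B ⊓ D := ⟨x.2, hx⟩
      rw [hinf] at this
      exact Subtype.ext this) (by
      rw [eq_top_iff]
      rintro ⟨x, hx⟩ _
      obtain ⟨b, hb, d, hd, rfl⟩ := Submodule.mem_sup.1 hx
      rw [Submodule.mem_sup]
      exact ⟨⟨b, hBQ hb⟩, ⟨⟨b, hb⟩, rfl⟩, ⟨d, (le_sup_right : D ≤ Q) hd⟩, hd, rfl⟩)
    exact h3 Q hQL.sat (by rw [Submodule.range_subtype]; exact hBQ) hle χ hc1 fun x => hc2 x

/-- lattice transport -/
theorem chain_transport {α β : Type*} [Lattice α] [Lattice β] [BoundedOrder β] (e : β → α) (he : ∀ X Y, e X ≤ e Y ↔ X ≤ Y)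
    (LA : α → Prop) (LB : β → Prop) (hL : ∀ X, LB X ↔ LA (e X)) (hsurj : ∀ X, e ⊥ ≤ X → X ≤ e ⊤ → ∃ Y, e Y = X)
    (X Y : β) (h : ChainOn LA (e X) (e Y)) : ChainOn LB X Y := by
  intro a b ha hb h1 h2 h3 h4
  have := h (e a) (e b) ((hL _).1 ha) ((hL _).1 hb) ((he _ _).2 h1) ((he _ _).2 h2) ((he _ _).2 h3) ((he _ _).2 h4)
  rwa [he, he] at this

theorem u1_transport {α β : Type*} [Lattice α] [Lattice β] [BoundedOrder β] (e : β → α) (he : ∀ X Y, e X ≤ e Y ↔ X ≤ Y)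
    (hei : ∀ X Y, e (X ⊓ Y) = e X ⊓ e Y) (hes : ∀ X Y, e (X ⊔ Y) = e X ⊔ e Y)
    (LA : α → Prop) (LB : β → Prop) (hL : ∀ X, LB X ↔ LA (e X)) (hsurj : ∀ X, e ⊥ ≤ X → X ≤ e ⊤ → ∃ Y, e Y = X)
    (h : ∀ B D, U1 LB ⊥ B ⊤ D) (B D : α) : U1 LA (e ⊥) B (e ⊤) D := by
  intro hA hB hC hAB hBC hmin hch hD hAD hDC hDB hDne
  obtain ⟨B, rfl⟩ := hsurj B hAB hBC.le
  obtain ⟨D, rfl⟩ := hsurj D hAD hDC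
  have hinj : ∀ X Y, e X = e Y → X = Y := fun X Y h => le_antisymm ((he _ _).1 h.le) ((he _ _).1 h.ge)
  obtain ⟨Z, h1, h2, h3⟩ := h B D ((hL _).2 hA) ((hL _).2 hB) ((hL _).2 hC) bot_le
    (lt_of_le_of_ne le_top fun h => hBC.ne (congrArg e h))
    (fun X hX h1 h2 => (hmin (e X) ((hL _).1 hX) ((he _ _).2 h1) ((he _ _).2 h2)).imp (hinj _ _) (hinj _ _))
    (chain_transport e he LA LB hL hsurj _ _ hch) ((hL _).2 hD) bot_le le_top (fun h => hDB ((he _ _).2 h))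
    (fun h => hDne (congrArg e h))
  exact ⟨e Z, (hL _).1 h1, by rw [← hei, h2], by rw [← hes, h3]⟩

theorem u2_transport {α β : Type*} [Lattice α] [Lattice β] [BoundedOrder β] (e : β → α) (he : ∀ X Y, e X ≤ e Y ↔ X ≤ Y)
    (hei : ∀ X Y, e (X ⊓ Y) = e X ⊓ e Y) (hes : ∀ X Y, e (X ⊔ Y) = e X ⊔ e Y)
    (LA : α → Prop) (LB : β → Prop) (hL : ∀ X, LB X ↔ LA (e X)) (hsurj : ∀ X, e ⊥ ≤ X → X ≤ e ⊤ → ∃ Y, e Y = X)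
    (h : ∀ B D, U2 LB ⊥ B ⊤ D) (B D : α) : U2 LA (e ⊥) B (e ⊤) D := by
  intro hA hB hC hAB hBC hmin hch hD hAD hDC hDB hDne
  obtain ⟨B, rfl⟩ := hsurj B hAB.le hBC
  obtain ⟨D, rfl⟩ := hsurj D hAD hDC
  have hinj : ∀ X Y, e X = e Y → X = Y := fun X Y h => le_antisymm ((he _ _).1 h.le) ((he _ _).1 h.ge)
  obtain ⟨Z, h1, h2, h3⟩ := h B D ((hL _).2 hA) ((hL _).2 hB) ((hL _).2 hC)
    (lt_of_le_of_ne bot_le fun h => hAB.ne (congrArg e h)) le_top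
    (fun X hX h1 h2 => (hmin (e X) ((hL _).1 hX) ((he _ _).2 h1) ((he _ _).2 h2)).imp (hinj _ _) (hinj _ _))
    (chain_transport e he LA LB hL hsurj _ _ hch) ((hL _).2 hD) bot_le le_top (fun h => hDB (congrArg e h))
    (fun h => hDne ((he _ _).2 h))
  exact ⟨e Z, (hL _).1 h1, by rw [← hei, h2], by rw [← hes, h3]⟩

/-- the subquotient object -/
theorem interval {E : PB k W} {μ : ℚ} (hE : SS E μ) {A C : Submodule k[T;T⁻¹] W} (hA : LL E μ A) (hC : LL E μ C) (hAC : A ≤ C) :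
    (∀ B D, U1 (LL E μ) A B C D) ∧ (∀ B D, U2 (LL E μ) A B C D) := by
  have hA' : LL (E.sub C) μ (A.comap C.subtype) := by
    rw [LL_sub hC.sat, Submodule.map_comap_subtype, inf_eq_right.2 hAC]; exact hA
  have hS := (hE.sub hC).quot hA'
  set A' := A.comap C.subtype with hA'd
  let e : Submodule k[T;T⁻¹] (C ⧸ A') → Submodule k[T;T⁻¹] W := fun Q => (Q.comap A'.mkQ).map C.subtype
  have he : ∀ X Y, e X ≤ e Y ↔ X ≤ Y := by
    intro X Y
    show Submodule.map _ _ ≤ Submodule.map _ _ ↔ _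
    rw [Submodule.map_le_map_iff_of_injective C.injective_subtype, Submodule.comap_le_comap_iff_of_surjective A'.mkQ_surjective]
  have hbot : e ⊥ = A := by
    show Submodule.map _ (Submodule.comap _ ⊥) = _
    rw [Submodule.comap_bot, Submodule.ker_mkQ, Submodule.map_comap_subtype, inf_eq_right.2 hAC]
  have htop : e ⊤ = C := by
    show Submodule.map _ (Submodule.comap _ ⊤) = _
    rw [Submodule.comap_top, Submodule.map_subtype_top]
  have hei : ∀ X Y, e (X ⊓ Y) = e X ⊓ e Y := by
    intro X Y
    show Submodule.map _ (Submodule.comap _ _) = Submodule.map _ _ ⊓ Submodule.map _ _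
    rw [Submodule.comap_inf, Submodule.map_inf _ C.injective_subtype]
  have hes : ∀ X Y, e (X ⊔ Y) = e X ⊔ e Y := by
    intro X Y
    show Submodule.map _ (Submodule.comap _ _) = Submodule.map _ _ ⊔ Submodule.map _ _
    rw [← Submodule.map_sup]
    congr 1
    refine Submodule.map_injective_of_injective (f := (LinearMap.id : C →ₗ[k[T;T⁻¹]] C)) (fun _ _ h => h) ?_
    rw [Submodule.map_id, Submodule.map_id]
    refine le_antisymm ?_ (sup_le (Submodule.comap_mono le_sup_left) (Submodule.comap_mono le_sup_right))
    intro c hc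
    obtain ⟨x, hx, y, hy, hxy⟩ := Submodule.mem_sup.1 (Submodule.mem_comap.1 hc)
    obtain ⟨x, rfl⟩ := A'.mkQ_surjective x
    rw [Submodule.mem_sup]
    refine ⟨x, hx, c - x, ?_, add_sub_cancel _ _⟩
    rw [Submodule.mem_comap, map_sub, ← hxy, add_sub_cancel_left]
    exact hy
  have hL : ∀ X, LL ((E.sub C).quot A' hA'.sat) μ X ↔ LL E μ (e X) := fun X => by
    rw [LL_quot hA', LL_sub hC.sat]
  have hsurj : ∀ X, e ⊥ ≤ X → X ≤ e ⊤ → ∃ Y, e Y = X := by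
    intro X h1 h2
    rw [hbot] at h1
    rw [htop] at h2
    refine ⟨(X.comap C.subtype).map A'.mkQ, ?_⟩
    show Submodule.map _ (Submodule.comap _ _) = _
    rw [Submodule.comap_map_mkQ, sup_eq_right.2 (Submodule.comap_mono h1), Submodule.map_comap_subtype, inf_eq_right.2 h2]
  constructor
  · intro B D
    have := u1_transport e he hei hes (LL E μ) _ hL hsurj (u1_top hS) B D
    rwa [hbot, htop] at this
  · intro B D
    have := u2_transport e he hei hes (LL E μ) _ hL hsurj (u2_top hS) B D
    rwa [hbot, htop] at this

theorem Ind.chain {E : PB k W} (hI : Ind E) {w0 : W} (hw : w0 ≠ 0) {μ : ℚ} (hE : SS E μ) :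
    ∀ X Y, LL E μ X → LL E μ Y → X ≤ Y ∨ Y ≤ X := by
  refine lattice_chain (LL E μ) (fun X Y hX hY => hX.inf hE hY) (fun X Y hX hY => hX.sup hE hY) (LL.bot hE) (LL.top hE)
    rk (fun X Y hX _ h => E.rk_lt hX.sat h) (fun X Y _ _ => E.rk_add X Y) ?_ ?_ ?_ ?_
  · intro A B C D h1 h2 h3 h4 h5
    exact (interval hE h1 h3 (h4.trans h5.le)).1 B D h1 h2 h3 h4 h5
  · intro A B C D h1 h2 h3 h4 h5
    exact (interval hE h1 h3 (h4.le.trans h5)).2 B D h1 h2 h3 h4 h5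
  · intro h
    have : w0 ∈ (⊤ : Submodule k[T;T⁻¹] W) := Submodule.mem_top
    rw [← h] at this
    exact hw this
  · intro X Y hX hY hi hs
    obtain ⟨χ, h1, h2, h3⟩ := retract (hE.sub hX) hE (E.sub_smono X).isHom hY (by
      apply Submodule.map_injective_of_injective X.injective_subtype
      rw [Submodule.map_comap_subtype, hi, Submodule.map_bot]) (by rw [Submodule.range_subtype, hs])
    rcases hI (X.subtype ∘ₗ χ) (h1.comp (E.sub_smono X).isHom) (fun w => by
      simp only [LinearMap.comp_apply]; rw [h2]) with h | h
    · left
      rw [Submodule.eq_bot_iff]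
      intro x hx
      have h4 := LinearMap.congr_fun h x
      have h5 := h2 ⟨x, hx⟩
      simp only [LinearMap.comp_apply, LinearMap.zero_apply] at h4
      rw [show X.subtype ⟨x, hx⟩ = x from rfl] at h5
      rw [h5] at h4
      exact h4
    · right
      rw [Submodule.eq_bot_iff]
      intro y hy
      have h4 := LinearMap.congr_fun h y
      rw [LinearMap.comp_apply, h3 y hy, map_zero, LinearMap.id_apply] at h4
      exact h4.symm

theorem Ind.factor_aux {E : PB k W} (hI : Ind E) {w0 : W} (hw : w0 ≠ 0) {f g : W →ₗ[k[T;T⁻¹]] W}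
    (hf : IsHom 0 E E f) (hg : IsHom 0 E E g) (hk : LinearMap.ker f ≤ LinearMap.ker g) : ∃ h, IsHom 0 E E h ∧ ∀ w, h (f w) = g w := by
  obtain ⟨μ, hE⟩ := hI.ss w0 hw
  obtain ⟨hS, hM, hL, hN⟩ := hom_strict hE hE hf
  obtain ⟨φ, hφ⟩ := factor_through (LinearMap.ker f).subtype f.rangeRestrict f.surjective_rangeRestrict (fun w => by
    rw [LinearMap.rangeRestrict, ← LinearMap.mem_ker, LinearMap.ker_codRestrict]
    exact ⟨fun h => ⟨⟨w, h⟩, rfl⟩, fun ⟨p, hp⟩ => hp ▸ p.2⟩) g (fun p => hk p.2)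
  have hφ' : ∀ (w : W) (x : LinearMap.range f), f w = x → φ x = g w := by
    intro w x hx
    rw [← hφ w]
    congr 1
    exact Subtype.ext hx.symm
  have hφh : IsHom 0 (E.sub (LinearMap.range f)) E φ := by
    refine isHom0_iff.2 ⟨?_, ?_, ?_⟩
    · intro x hx
      obtain ⟨w, hw, h⟩ := hM x x.2 hx
      rw [hφ' w x h]; exact (isHom0_iff.1 hg).1 w hw
    · intro j x hx
      obtain ⟨w, hw, h⟩ := hL j x x.2 hx
      rw [hφ' w x h]; exact (isHom0_iff.1 hg).2.1 j w hw
    · intro j x hx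
      obtain ⟨w, hw, h⟩ := hN j x x.2 hx
      rw [hφ' w x h]; exact (isHom0_iff.1 hg).2.2 j w hw
  rcases extend_or (E.ses (LinearMap.range f) hS.sat) hφh with ⟨χ, h1, h2⟩ | ⟨q, h1, h3, -⟩
  · refine ⟨χ, h1, fun w => ?_⟩
    rw [← hφ' w ⟨f w, w, rfl⟩ rfl, ← h2]; rfl
  · exfalso
    have hK := ker_LL hE (hE.quot hS) (Or.inr rfl) h1
    have hR := (hom_strict hE hE hg).1
    have e1 := rk_satc_range E (E.quot _ hS.sat) q
    have e2 := (E.ses _ hS.sat).finrank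
    have e3 := (E.quot _ hS.sat).rk_mono (le_top : satc (LinearMap.range q) ≤ ⊤)
    rw [rk_top] at e3
    have e4 := E.rk_map_add f
    have e5 := E.rk_map_add g
    have e6 := E.rk_mono hk
    have e7 : rk (LinearMap.range f) = Module.finrank k[T;T⁻¹] (LinearMap.range f) := rfl
    have hle : LinearMap.range g ≤ LinearMap.ker q := by
      rcases hI.chain hw hE _ _ hR hK with h | h
      · exact h
      · exact (E.eq_of_rk hK.sat h (by omega)).ge
    refine h3 _ _ (LinearMap.ker q).mkQ (E.quot_sepi _ hK.sat) (by rw [Submodule.ker_mkQ]) 0 (IsHom.zero _ _) ?_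
    rintro ⟨_, w, rfl⟩
    rw [hφ' w _ rfl, LinearMap.zero_apply]
    exact ((Submodule.Quotient.mk_eq_zero _).2 (hle ⟨w, rfl⟩)).symm

theorem Ind.factor {E : PB k W} (hI : Ind E) {w0 : W} (hw : w0 ≠ 0) {f g : W →ₗ[k[T;T⁻¹]] W}
    (hf : IsHom 0 E E f) (hg : IsHom 0 E E g) : (∃ h, IsHom 0 E E h ∧ ∀ w, h (f w) = g w) ∨ (∃ h, IsHom 0 E E h ∧ ∀ w, h (g w) = f w) := by
  obtain ⟨μ, hE⟩ := hI.ss w0 hw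
  rcases hI.chain hw hE _ _ (ker_LL hE hE (Or.inl rfl) hf) (ker_LL hE hE (Or.inl rfl) hg) with h | h
  · exact Or.inl (hI.factor_aux hw hf hg h)
  · exact Or.inr (hI.factor_aux hw hg hf h)

theorem SS.neg_zero {E : PB k W} {μ : ℚ} (hE : SS E μ) {f : W →ₗ[k[T;T⁻¹]] W} (hf : IsHom 0 E E f)
    (hN : ∀ i, ∀ w ∈ E.N i, f w ∈ E.N (i + 1)) : f = 0 := by
  have hR := (hom_strict hE hE hf).2.2.2
  have hRL := (hom_strict hE hE hf).1
  have hall : ∀ (n : ℕ) (i : ℤ), ∀ v ∈ LinearMap.range f, v ∈ E.N i → v ∈ E.N (i + n) := by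
    intro n
    induction n with
    | zero => intro i v _ h; simpa using h
    | succ n ih =>
      intro i v hv h
      obtain ⟨w, hw, rfl⟩ := hR _ v hv (ih i v hv h)
      have := hN _ _ hw
      rwa [show i + ((n + 1 : ℕ) : ℤ) = i + n + 1 by push_cast; ring]
  have hall0 : ∀ v ∈ LinearMap.range f, v ∈ E.N 0 := by
    intro v hv
    obtain ⟨i, hi⟩ := E.hN.exh v
    exact E.hN.anti 0 _ (by have := Int.self_le_toNat (-i); linarith) (hall (-i).toNat i v hv hi)
  ext w
  by_contra hcon
  obtain ⟨n, b, hb⟩ := E.hN.basis E.tf 0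
  have hz : b.repr (f w) ≠ 0 := fun h => hcon (by simpa using h)
  obtain ⟨a, ha⟩ := Finsupp.ne_iff.1 hz
  rw [Finsupp.zero_apply] at ha
  have : ∃ m : ℤ, (b.repr (f w) a).coeff m ≠ 0 := by
    by_contra h
    push Not at h
    exact ha (by ext m; exact h m)
  obtain ⟨m, hm⟩ := this
  have h5 := (hb ((T (1 - m) : k[T;T⁻¹]) • f w)).1 (hall0 _ (Submodule.smul_mem _ _ ⟨w, rfl⟩)) a
  rw [map_smul, Finsupp.smul_apply, smul_eq_mul, mem_Pos (Or.inr rfl)] at h5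
  have := h5 1
  rw [coeff_T_mul, sub_sub_cancel] at this
  exact hm (this (by norm_num))

end PB
end uni
end Stm

namespace Stm
open LaurentPolynomial

section lb
variable {k : Type u} [Field k]
variable {W : Type u} [AddCommGroup W] [Module k W] [Module k[T;T⁻¹] W] [IsScalarTower k k[T;T⁻¹] W]

theorem finrank_le_succ {V : Type u} [AddCommGroup V] [Module k V] [Module k[T;T⁻¹] V] [IsScalarTower k k[T;T⁻¹] V] 
    (X Y : Submodule k V) [FiniteDimensional k X] [FiniteDimensional k Y] (f : V →ₗ[k] k)
    (h : Y ⊓ LinearMap.ker f ≤ X) : Module.finrank k Y ≤ Module.finrank k X + 1 := by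
  rw [rank_split f Y]
  have h1 := Submodule.finrank_mono h
  have h2 : Module.finrank k (Y.map f) ≤ 1 := by
    have := Submodule.finrank_le (Y.map f)
    rwa [Module.finrank_self] at this
  omega

/-- support condition -/
def cutL (a : ℤ) (j : ℤ) : Submodule k k[T;T⁻¹] where
  carrier := {r | ∀ n, a + 3 * n < j → r.coeff n = 0}
  zero_mem' := fun n _ => rfl
  add_mem' := fun {r s} hr hs n hn => by
    simp only [Set.mem_setOf_eq] at hr hs
    rw [AddMonoidAlgebra.coeff_add, Finsupp.add_apply, hr n hn, hs n hn, add_zero]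
  smul_mem' := fun c r hr n hn => by
    simp only [Set.mem_setOf_eq] at hr
    rw [AddMonoidAlgebra.coeff_smul, Finsupp.smul_apply, hr n hn, smul_zero]

def cutN (b : ℤ) (j : ℤ) : Submodule k k[T;T⁻¹] where
  carrier := {r | ∀ n, b - 6 * n < j → r.coeff n = 0}
  zero_mem' := fun n _ => rfl
  add_mem' := fun {r s} hr hs n hn => by
    simp only [Set.mem_setOf_eq] at hr hs
    rw [AddMonoidAlgebra.coeff_add, Finsupp.add_apply, hr n hn, hs n hn, add_zero]
  smul_mem' := fun c r hr n hn => by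
    simp only [Set.mem_setOf_eq] at hr
    rw [AddMonoidAlgebra.coeff_smul, Finsupp.smul_apply, hr n hn, smul_zero]

theorem mem_cutL {a j : ℤ} {r : k[T;T⁻¹]} : r ∈ cutL a j ↔ ∀ n, a + 3 * n < j → r.coeff n = 0 := Iff.rfl
theorem mem_cutN {a j : ℤ} {r : k[T;T⁻¹]} : r ∈ cutN a j ↔ ∀ n, a - 6 * n < j → r.coeff n = 0 := Iff.rfl

theorem T_coeff (m n : ℤ) : (T m : k[T;T⁻¹]).coeff n = if m = n then 1 else 0 := by
  rw [T]
  simp [Finsupp.single_apply]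

theorem span_T {e : ℤ} (he : e = 1 ∨ e = -1) (n0 : ℤ) (r : k[T;T⁻¹]) (h : ∀ n, e * (n - n0) < 0 → r.coeff n = 0) :
    r ∈ Submodule.span (Pos k e) (({T n0} : Finset k[T;T⁻¹]) : Set k[T;T⁻¹]) := by
  rw [Finset.coe_singleton, Submodule.mem_span_singleton]
  have h2 : T (-n0) * r ∈ Pos k e := by
    rw [mem_Pos he]
    intro n hn
    rw [coeff_T_mul]
    exact h _ (by rw [show n - -n0 - n0 = n by ring]; exact hn)
  refine ⟨⟨_, h2⟩, ?_⟩
  show (T (-n0) * r) * T n0 = r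
  rw [mul_comm, ← mul_assoc, ← T_add]; simp

noncomputable def Lb (a b : ℤ) : PB k k[T;T⁻¹] where
  M1 := Submodule.span k[T;T⁻¹] {1 - T 1}
  L := cutL a
  N := cutN b
  tf := fun r w h => by simpa using h
  hM := fun w => by
    rw [Submodule.mem_span_singleton]
    exact ⟨w, by rw [smul_eq_mul, smul_eq_mul, mul_comm]⟩
  hL := by
    refine ⟨Or.inl rfl, by norm_num, ?_, ?_, ?_, ?_⟩
    · intro i j hij r hr n hn
      exact hr n (by omega)
    · intro r j
      rw [mem_cutL, mem_cutL]
      constructor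
      · intro h n hn
        have := h (n + 1) (by omega)
        rw [smul_eq_mul, coeff_T_mul] at this
        simpa using this
      · intro h n hn
        rw [smul_eq_mul, coeff_T_mul]
        exact h _ (by omega)
    · intro r
      obtain ⟨m, hm⟩ := exists_T_mul_mem_Pos (e := 1) (Or.inl rfl) r
      have h1 := (mem_Pos (Or.inl rfl) _).1 (hm m le_rfl)
      refine ⟨a - 3 * m, fun n hn => ?_⟩
      have := h1 (n + m) (by omega)
      rw [coeff_T_mul] at this
      rwa [show n + (m : ℤ) - 1 * m = n by ring] at this
    · intro j
      refine ⟨{T ((j - a) / 3)}, fun r hr => span_T (Or.inl rfl) _ _ fun n hn => hr n (by omega)⟩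
  hN := by
    refine ⟨Or.inr rfl, by norm_num, ?_, ?_, ?_, ?_⟩
    · intro i j hij r hr n hn
      exact hr n (by omega)
    · intro r j
      rw [mem_cutN, mem_cutN]
      constructor
      · intro h n hn
        have := h (n - 1) (by omega)
        rw [smul_eq_mul, coeff_T_mul] at this
        simpa using this
      · intro h n hn
        rw [smul_eq_mul, coeff_T_mul]
        exact h _ (by omega)
    · intro r
      obtain ⟨m, hm⟩ := exists_T_mul_mem_Pos (e := -1) (Or.inr rfl) r
      have h1 := (mem_Pos (Or.inr rfl) _).1 (hm m le_rfl)
      refine ⟨b - 6 * m, fun n hn => ?_⟩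
      have := h1 (n - m) (by omega)
      rw [coeff_T_mul] at this
      rwa [show n - (m : ℤ) - -1 * m = n by ring] at this
    · intro j
      refine ⟨{T ((b - j) / 6)}, fun r hr => span_T (Or.inr rfl) _ _ fun n hn => hr n (by omega)⟩

theorem mem_LbM (a b : ℤ) (r : k[T;T⁻¹]) : r ∈ (Lb a b : PB k k[T;T⁻¹]).M1 ↔ ev1 r = 0 := by
  show r ∈ Submodule.span k[T;T⁻¹] {1 - T 1} ↔ _
  rw [Submodule.mem_span_singleton]
  constructor
  · rintro ⟨s, rfl⟩
    rw [smul_eq_mul, mul_comm, ev1_one_sub_mul]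
  · intro h
    obtain ⟨s, hs⟩ := dvd_sub_ev1 r
    rw [h, zero_smul, sub_zero] at hs
    exact ⟨s, by rw [hs, smul_eq_mul, mul_comm]⟩

namespace PB

theorem Mc_congr {E F : PB k W} (h : E.M1 = F.M1) (n : ℕ) : E.Mc n = F.Mc n := by
  induction n using Nat.twoStepInduction with
  | zero => rfl
  | one => exact h
  | more n ih _ => rw [Mc, Mc, ih]

theorem D_le_add {E F : PB k W} (d : ℕ) (h : ∀ m, E.H m ≤ F.H m + d) : E.D ≤ F.D + d := by
  obtain ⟨m1, h1⟩ := E.D_eq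
  obtain ⟨m2, h2⟩ := F.D_eq
  have a := h1 (m1 + m2) (by omega)
  have b := h2 (m1 + m2) (by omega)
  have := h (m1 + m2)
  zify at this
  rw [a, b] at this
  linarith

theorem Lb_N_step (a b : ℤ) : (Lb a (b + 1) : PB k k[T;T⁻¹]).D ≤ (Lb a b : PB k k[T;T⁻¹]).D + 1 := by
  refine D_le_add 1 fun m => ?_
  have key : ∀ c : ℕ, Module.finrank k ((Lb a (b + 1) : PB k k[T;T⁻¹]).Gam c m) ≤ 
      Module.finrank k ((Lb a b : PB k k[T;T⁻¹]).Gam c m) + if (b + 1 - c) % 6 = 0 then 1 else 0 := by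
    intro c
    split_ifs with h
    · refine finrank_le_succ _ _ (coeffL ((b + 1 - c) / 6 + m)) ?_
      rintro r ⟨⟨h1, h2, h3⟩, h4⟩
      refine ⟨?_, h2, ?_⟩
      · have := Mc_congr (E := (Lb a (b + 1) : PB k k[T;T⁻¹])) (F := Lb a b) rfl c
        show r ∈ (Lb a b : PB k k[T;T⁻¹]).Mc c
        rw [← this]; exact h1
      · intro n hn
        by_cases hn2 : n = (b + 1 - c) / 6 + m
        · rw [hn2]; exact h4
        · exact h3 n (by omega)
    · rw [add_zero]
      refine Submodule.finrank_mono ?_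
      rintro r ⟨h1, h2, h3⟩
      refine ⟨?_, h2, ?_⟩
      · have := Mc_congr (E := (Lb a (b + 1) : PB k k[T;T⁻¹])) (F := Lb a b) rfl c
        show r ∈ (Lb a b : PB k k[T;T⁻¹]).Mc c
        rw [← this]; exact h1
      · intro n hn
        exact h3 n (by omega)
  rw [H, H]
  refine (Finset.sum_le_sum fun c _ => key c).trans ?_
  rw [Finset.sum_add_distrib]
  refine Nat.add_le_add_left ?_ _
  simp only [Finset.sum_range_succ, Finset.sum_range_zero]
  push_cast
  split_ifs <;> omega

theorem Lb_L_step (a b : ℤ) : (Lb (a + 1) b : PB k k[T;T⁻¹]).D ≤ (Lb a b : PB k k[T;T⁻¹]).D + 2 := by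
  refine D_le_add 2 fun m => ?_
  have key : ∀ c : ℕ, Module.finrank k ((Lb (a + 1) b : PB k k[T;T⁻¹]).Gam c m) ≤ 
      Module.finrank k ((Lb a b : PB k k[T;T⁻¹]).Gam c m) + if (2 * c + a + 1) % 3 = 0 then 1 else 0 := by
    intro c
    split_ifs with h
    · refine finrank_le_succ _ _ (coeffL (-((2 * c + a + 1) / 3))) ?_
      rintro r ⟨⟨h1, h2, h3⟩, h4⟩
      refine ⟨?_, ?_, h3⟩
      · have := Mc_congr (E := (Lb (a + 1) b : PB k k[T;T⁻¹])) (F := Lb a b) rfl c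
        show r ∈ (Lb a b : PB k k[T;T⁻¹]).Mc c
        rw [← this]; exact h1
      · intro n hn
        by_cases hn2 : n = (-((2 * c + a + 1) / 3))
        · rw [hn2]; exact h4
        · exact h2 n (by omega)
    · rw [add_zero]
      refine Submodule.finrank_mono ?_
      rintro r ⟨h1, h2, h3⟩
      refine ⟨?_, ?_, h3⟩
      · have := Mc_congr (E := (Lb (a + 1) b : PB k k[T;T⁻¹])) (F := Lb a b) rfl c
        show r ∈ (Lb a b : PB k k[T;T⁻¹]).Mc c
        rw [← this]; exact h1
      · intro n hn
        exact h2 n (by omega)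
  rw [H, H]
  refine (Finset.sum_le_sum fun c _ => key c).trans ?_
  rw [Finset.sum_add_distrib]
  refine Nat.add_le_add_left ?_ _
  simp only [Finset.sum_range_succ, Finset.sum_range_zero]
  push_cast
  split_ifs <;> omega

theorem Lb_six (a b : ℤ) : (Lb a b : PB k k[T;T⁻¹]).D + 6 ≤ (Lb a (b + 6) : PB k k[T;T⁻¹]).D := by
  have key : ∀ m, (Lb a (b + 6) : PB k k[T;T⁻¹]).H m = (Lb a b : PB k k[T;T⁻¹]).H (m + 1) := by
    intro m
    rw [H, H]
    refine Finset.sum_congr rfl fun c _ => ?_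
    have : (Lb a (b + 6) : PB k k[T;T⁻¹]).Gam c m = (Lb a b : PB k k[T;T⁻¹]).Gam c (m + 1) := by
      rw [Gam, Gam, Mc_congr (E := (Lb a (b + 6) : PB k k[T;T⁻¹])) (F := Lb a b) rfl c]
      congr 2
      ext r
      show (∀ n, _) ↔ (∀ n, _)
      refine forall_congr' fun n => ?_
      push_cast
      rw [show (b + 6 - 6 * n < (c : ℤ) - 6 * m) ↔ (b - 6 * n < (c : ℤ) - 6 * (m + 1)) by omega]
    rw [this]
  obtain ⟨m1, h1⟩ := (Lb a (b + 6) : PB k k[T;T⁻¹]).D_eq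
  obtain ⟨m2, h2⟩ := (Lb a b : PB k k[T;T⁻¹]).D_eq
  have A := h1 (m1 + m2) (by omega)
  have B := h2 (m1 + m2 + 1) (by omega)
  have := key (m1 + m2)
  zify at this
  rw [A, B, Module.finrank_self] at this
  push_cast at this
  linarith

theorem Lb_N_eq (a b : ℤ) : (Lb a (b + 1) : PB k k[T;T⁻¹]).D = (Lb a b : PB k k[T;T⁻¹]).D + 1 := by
  have h0 := Lb_N_step (k := k) a b
  have h1 := Lb_N_step (k := k) a (b + 1)
  have h2 := Lb_N_step (k := k) a (b + 1 + 1)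
  have h3 := Lb_N_step (k := k) a (b + 1 + 1 + 1)
  have h4 := Lb_N_step (k := k) a (b + 1 + 1 + 1 + 1)
  have h5 := Lb_N_step (k := k) a (b + 1 + 1 + 1 + 1 + 1)
  have h6 := Lb_six (k := k) a b
  rw [show b + 6 = b + 1 + 1 + 1 + 1 + 1 + 1 by ring] at h6
  linarith

theorem Lb_N_add (a b : ℤ) (d : ℕ) : (Lb a (b + d) : PB k k[T;T⁻¹]).D = (Lb a b : PB k k[T;T⁻¹]).D + d := by
  induction d with
  | zero => simp
  | succ d ih => 
    have := Lb_N_eq (k := k) a (b + d)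
    push_cast
    rw [← add_assoc, this, ih]; ring

theorem LbD (b b' : ℤ) : (Lb 1 b' : PB k k[T;T⁻¹]).D ≤ (Lb 0 b : PB k k[T;T⁻¹]).D + 2 + (b' - b) := by
  have h := Lb_L_step (k := k) 0 b'
  rw [zero_add] at h
  rcases le_total b b' with hb | hb
  · obtain ⟨d, rfl⟩ : ∃ d : ℕ, b' = b + d := ⟨(b' - b).toNat, by omega⟩
    have := Lb_N_add (k := k) 0 b d
    linarith
  · obtain ⟨d, rfl⟩ : ∃ d : ℕ, b = b' + d := ⟨(b - b').toNat, by omega⟩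
    have := Lb_N_add (k := k) 0 b' d
    linarith

theorem SS.from_Lb {E : PB k W} {μ : ℚ} (hE : SS E μ) {a b : ℤ} (f : k[T;T⁻¹] →ₗ[k[T;T⁻¹]] W) (hf : IsHom 0 (Lb a b) E f)
    (h0 : f ≠ 0) : ((Lb a b : PB k k[T;T⁻¹]).D : ℚ) ≤ μ := by
  have h1 := hom_dl (Or.inl rfl) hf μ
  have h2 := hE.le _ (sat_satc (LinearMap.range f))
  have h3 : LinearMap.ker f = ⊥ := by
    rw [LinearMap.ker_eq_bot']
    intro r hr
    have h4 : f r = r • f 1 := by rw [← map_smul, smul_eq_mul, mul_one]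
    rw [h4] at hr
    refine (E.tf _ _ hr).resolve_right fun h5 => h0 ?_
    refine LinearMap.ext fun s => ?_
    have h4 : f s = s • f 1 := by rw [← map_smul, smul_eq_mul, mul_one]
    rw [h4, h5, smul_zero]; rfl
  rw [h3, dl_bot] at h1
  rw [dl, Module.finrank_self] at h1
  push_cast at h1
  linarith

theorem SS.to_Lb {E : PB k W} {μ : ℚ} (hE : SS E μ) {a b : ℤ} (f : W →ₗ[k[T;T⁻¹]] k[T;T⁻¹]) (hf : IsHom 0 E (Lb a b) f)
    (h0 : f ≠ 0) : μ ≤ ((Lb a b : PB k k[T;T⁻¹]).D : ℚ) := by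
  have h1 := hom_dl (Or.inl rfl) hf μ
  have h2 := hE.le _ ((Lb a b : PB k k[T;T⁻¹]).sat_ker f)
  have h3 : satc (LinearMap.range f) = ⊤ := by
    rw [eq_top_iff]
    intro r _
    obtain ⟨w, hw⟩ : ∃ w, f w ≠ 0 := by
      by_contra hcon
      push Not at hcon
      exact h0 (LinearMap.ext hcon)
    exact ⟨f w, hw, ⟨r • w, by rw [map_smul, smul_eq_mul, smul_eq_mul, mul_comm]⟩⟩
  rw [h3, dl_top, hE.eq] at h1
  have h4 : (Lb a b : PB k k[T;T⁻¹]).dl μ = (Lb a b : PB k k[T;T⁻¹]).D - μ * ((1 : ℕ) : ℚ) := by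
    rw [dl, Module.finrank_self]
  push_cast at h4
  linarith

end PB
end lb
end Stm

namespace Stm
open LaurentPolynomial

section functor
variable {k : Type u} [Field k] {𝒱 : Type u} [AddCommGroup 𝒱] [Module k 𝒱] {d : ℕ}

abbrev WW (k : Type u) [Field k] (d : ℕ) : Type u := Fin 3 × Fin d → k[T;T⁻¹]

def rs (a : ℤ) : Fin 3 := ⟨(a % 3).toNat, by omega⟩

theorem rs_eq {a a' : ℤ} : rs a = rs a' ↔ a % 3 = a' % 3 := by
  rw [rs, rs, Fin.mk.injEq]; omega

theorem rs_coe (s : Fin 3) (n : ℤ) : rs (3 * n + (s : ℕ)) = s := by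
  have := s.2
  rw [Fin.ext_iff, rs]; show ((3 * n + (s : ℕ)) % 3).toNat = _
  omega

theorem coe_rs (a : ℤ) : 3 * (a / 3) + ((rs a : Fin 3) : ℕ) = a := by
  rw [rs]; show 3 * (a / 3) + (((a % 3).toNat : ℕ) : ℤ) = a
  omega

noncomputable def cc (b : Module.Basis (Fin d) k 𝒱) (a : ℤ) : WW k d →ₗ[k] 𝒱 :=
  b.equivFun.symm.toLinearMap ∘ₗ LinearMap.pi fun x => PB.coeffL (a / 3) ∘ₗ LinearMap.proj (rs a, x)

noncomputable def et (b : Module.Basis (Fin d) k 𝒱) (a : ℤ) : 𝒱 →ₗ[k] WW k d :=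
  LinearMap.pi fun p => if p.1 = rs a then (b.coord p.2).smulRight (T (a / 3)) else 0

noncomputable def SS1 (b : Module.Basis (Fin d) k 𝒱) : WW k d →ₗ[k] 𝒱 :=
  ∑ s : Fin 3, b.equivFun.symm.toLinearMap ∘ₗ LinearMap.pi fun x => ev1 ∘ₗ LinearMap.proj (s, x)

variable (b : Module.Basis (Fin d) k 𝒱)

theorem cc_apply (a : ℤ) (w : WW k d) : cc b a w = b.equivFun.symm (fun x => (w (rs a, x)).coeff (a / 3)) := rfl

theorem cc_coord (a : ℤ) (w : WW k d) (x : Fin d) : b.equivFun (cc b a w) x = (w (rs a, x)).coeff (a / 3) := by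
  rw [cc_apply, LinearEquiv.apply_symm_apply]

theorem et_apply (a : ℤ) (v : 𝒱) (p : Fin 3 × Fin d) : et b a v p = if p.1 = rs a then b.equivFun v p.2 • T (a / 3) else 0 := by
  rw [et, LinearMap.pi_apply]
  split_ifs <;> rfl

theorem SS1_apply (w : WW k d) : SS1 b w = ∑ s : Fin 3, b.equivFun.symm (fun x => ev1 (w (s, x))) := by
  rw [SS1, LinearMap.sum_apply]; rfl

theorem cc_et (a a' : ℤ) (v : 𝒱) : cc b a (et b a' v) = if a = a' then v else 0 := by
  apply b.equivFun.injective
  funext x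
  rw [cc_coord, et_apply]
  simp only
  by_cases h : a = a'
  · subst h
    rw [if_pos rfl, if_pos rfl, AddMonoidAlgebra.coeff_smul, Finsupp.smul_apply, T_coeff, if_pos rfl, smul_eq_mul, mul_one]
  · rw [if_neg h, map_zero, Pi.zero_apply]
    split_ifs with h1
    · rw [AddMonoidAlgebra.coeff_smul, Finsupp.smul_apply, T_coeff, if_neg, smul_zero]
      rw [rs_eq] at h1
      omega
    · rfl

theorem cc_T (a n : ℤ) (w : WW k d) : cc b (a + 3 * n) ((T n : k[T;T⁻¹]) • w) = cc b a w := by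
  apply b.equivFun.injective
  funext x
  rw [cc_coord, cc_coord, Pi.smul_apply, smul_eq_mul, coeff_T_mul]
  rw [show rs (a + 3 * n) = rs a by rw [rs_eq]; omega, show (a + 3 * n) / 3 - n = a / 3 by omega]

theorem cc_T' (a n : ℤ) (w : WW k d) : cc b a ((T n : k[T;T⁻¹]) • w) = cc b (a - 3 * n) w := by
  rw [← cc_T b (a - 3 * n) n w]; congr 2; ring

theorem cc_ext {w w' : WW k d} (h : ∀ a, cc b a w = cc b a w') : w = w' := by
  funext p
  obtain ⟨s, x⟩ := p
  apply AddMonoidAlgebra.ext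
  apply Finsupp.ext
  intro n
  have := congrFun (congrArg b.equivFun (h (3 * n + (s : ℕ)))) x
  rw [cc_coord, cc_coord, rs_coe] at this
  rwa [show (3 * n + ((s : ℕ) : ℤ)) / 3 = n by have := s.2; omega] at this

theorem T_et (a n : ℤ) (v : 𝒱) : (T n : k[T;T⁻¹]) • et b a v = et b (a + 3 * n) v := by
  refine cc_ext b fun a' => ?_
  rw [cc_T', cc_et, cc_et]
  by_cases h : a' = a + 3 * n
  · rw [if_pos h, if_pos (by omega)]
  · rw [if_neg h, if_neg (by omega)]

theorem cc_finite (w : WW k d) : {a | cc b a w ≠ 0}.Finite := by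
  refine Set.Finite.subset (s := ⋃ p : Fin 3 × Fin d, (fun n : ℤ => 3 * n + ((p.1 : ℕ) : ℤ)) '' ((w p).coeff.support : Set ℤ)) ?_ ?_
  · exact Set.finite_iUnion fun p => Set.Finite.image _ (Finset.finite_toSet _)
  · intro a ha
    by_contra hcon
    refine ha ?_
    apply b.equivFun.injective
    funext x
    rw [cc_coord, map_zero, Pi.zero_apply]
    by_contra h
    refine hcon (Set.mem_iUnion.2 ⟨(rs a, x), a / 3, ?_, coe_rs a⟩)
    simpa using h

theorem decomp (w : WW k d) : ∃ F : Finset ℤ, w = ∑ a ∈ F, et b a (cc b a w) := by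
  refine ⟨(cc_finite b w).toFinset, cc_ext b fun a => ?_⟩
  rw [map_sum]
  simp only [cc_et, Finset.sum_ite_eq, Set.Finite.mem_toFinset, Set.mem_setOf_eq]
  split_ifs with h
  · rfl
  · simpa using h

theorem SS1_smul (r : k[T;T⁻¹]) (w : WW k d) : SS1 b (r • w) = ev1 r • SS1 b w := by
  induction r using LaurentPolynomial.induction_on' with
  | add r s hr hs => rw [add_smul, map_add, hr, hs, map_add, add_smul]
  | C_mul_T n a =>
    rw [← smul_eq_C_mul, smul_assoc, LinearMap.map_smul, LinearMap.map_smul ev1, ev1_T, smul_assoc, one_smul]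
    congr 1
    rw [SS1_apply, SS1_apply]
    refine Finset.sum_congr rfl fun s _ => ?_
    congr 1
    funext x
    rw [Pi.smul_apply, smul_eq_mul, ev1_T_mul]

theorem SS1_et (a : ℤ) (v : 𝒱) : SS1 b (et b a v) = v := by
  rw [SS1_apply, Finset.sum_eq_single (rs a)]
  · rw [LinearEquiv.symm_apply_eq]
    funext x
    rw [et_apply, if_pos rfl, map_smul, ev1_T, smul_eq_mul, mul_one]
  · intro s _ hs
    rw [LinearEquiv.symm_apply_eq, map_zero]
    funext x
    rw [et_apply, if_neg hs, map_zero]; rfl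
  · intro h; exact absurd (Finset.mem_univ _) h

theorem SS1_mem (Y : Submodule k 𝒱) (w : WW k d) (h : ∀ a, cc b a w ∈ Y) : SS1 b w ∈ Y := by
  obtain ⟨F, hF⟩ := decomp b w
  rw [hF, map_sum]
  refine Submodule.sum_mem _ fun a _ => ?_
  rw [SS1_et]; exact h a

structure Filt (A : ℤ → ℤ → Submodule k 𝒱) : Prop where
  mono : ∀ i j a, i ≤ j → A i a ≤ A j a
  anti : ∀ i a a', a ≤ a' → A i a' ≤ A i a
  per : ∀ i a, A i (a + 3) = A (i - 6) a
  bot : ∀ i, ∃ a0, ∀ a, a0 ≤ a → A i a = ⊥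
  top : ∀ a v, ∃ i, v ∈ A i a

theorem Filt.pern {A : ℤ → ℤ → Submodule k 𝒱} (hA : Filt A) (n : ℤ) : ∀ i a, A i (a + 3 * n) = A (i - 6 * n) a := by
  induction n using Int.induction_on with
  | zero => intro i a; simp
  | succ n ih => 
    intro i a
    rw [show a + 3 * ((n : ℤ) + 1) = (a + 3 * n) + 3 by ring, hA.per, ih]
    congr 1; ring
  | pred n ih =>
    intro i a
    have := hA.per (i + 6) (a + 3 * (-(n : ℤ) - 1))
    rw [show i + 6 - 6 = i by ring] at this
    rw [← this, show a + 3 * (-(n : ℤ) - 1) + 3 = a + 3 * (-n) by ring, ih]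
    congr 1; ring

theorem span_single {e : ℤ} (he : e = 1 ∨ e = -1) (n0 : ℤ) : ∃ S : Finset (WW k d), ∀ w : WW k d,
    (∀ p n, e * (n - n0) < 0 → (w p).coeff n = 0) → w ∈ Submodule.span (Pos k e) (S : Set (WW k d)) := by
  classical
  refine ⟨Finset.univ.image fun p : Fin 3 × Fin d => (Pi.single p (T n0) : WW k d), fun w hw => ?_⟩
  have h1 : w = ∑ p, (Pi.single p (w p) : WW k d) := (Finset.univ_sum_single w).symm
  rw [h1]
  refine Submodule.sum_mem _ fun p _ => ?_
  have h2 := span_T he n0 (w p) (hw p)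
  rw [Finset.coe_singleton, Submodule.mem_span_singleton] at h2
  obtain ⟨r, hr⟩ := h2
  have h3 : (Pi.single p (w p) : WW k d) = r • (Pi.single p (T n0) : WW k d) := by
    rw [← Pi.single_smul, hr]
  rw [h3]
  exact Submodule.smul_mem _ _ (Submodule.subset_span (by simp))

def LF (j : ℤ) : Submodule k (WW k d) where
  carrier := {w | ∀ a, a < j → cc b a w = 0}
  zero_mem' := fun a _ => map_zero _
  add_mem' := fun {r s} hr hs n hn => by
    simp only [Set.mem_setOf_eq] at hr hs
    rw [map_add, hr n hn, hs n hn, add_zero]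
  smul_mem' := fun c r hr n hn => by
    simp only [Set.mem_setOf_eq] at hr
    rw [map_smul, hr n hn, smul_zero]

def NF (A : ℤ → ℤ → Submodule k 𝒱) (i : ℤ) : Submodule k (WW k d) where
  carrier := {w | ∀ a, cc b a w ∈ A (-i) a}
  zero_mem' := fun a => by rw [map_zero]; exact Submodule.zero_mem _
  add_mem' := fun {r s} hr hs n => by
    simp only [Set.mem_setOf_eq] at hr hs
    rw [map_add]; exact Submodule.add_mem _ (hr n) (hs n)
  smul_mem' := fun c r hr n => by
    simp only [Set.mem_setOf_eq] at hr
    rw [map_smul]; exact Submodule.smul_mem _ _ (hr n)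

theorem mem_LF {j : ℤ} {w : WW k d} : w ∈ LF b j ↔ ∀ a, a < j → cc b a w = 0 := Iff.rfl
theorem mem_NF {A : ℤ → ℤ → Submodule k 𝒱} {i : ℤ} {w : WW k d} : w ∈ NF b A i ↔ ∀ a, cc b a w ∈ A (-i) a := Iff.rfl

theorem LF_et (a : ℤ) (v : 𝒱) : et b a v ∈ LF b a := by
  intro a' ha'
  rw [cc_et, if_neg (by omega)]

theorem NF_et {A : ℤ → ℤ → Submodule k 𝒱} (a i : ℤ) (v : 𝒱) (hv : v ∈ A (-i) a) : et b a v ∈ NF b A i := by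
  intro a'
  rw [cc_et]
  split_ifs with h
  · rw [h]; exact hv
  · exact Submodule.zero_mem _

theorem coeff_zero_of_cc {w : WW k d} {p : Fin 3 × Fin d} {n : ℤ} (h : cc b (3 * n + ((p.1 : ℕ) : ℤ)) w = 0) : (w p).coeff n = 0 := by
  obtain ⟨s, x⟩ := p
  have := congrFun (congrArg b.equivFun h) x
  rw [cc_coord, rs_coe, map_zero, Pi.zero_apply] at this
  rwa [show (3 * n + ((s : ℕ) : ℤ)) / 3 = n by have := s.2; omega] at this

theorem LF_anti {i j : ℤ} (h : i ≤ j) : LF b j ≤ LF b i := fun w hw a ha => hw a (by omega)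
theorem NF_anti {A : ℤ → ℤ → Submodule k 𝒱} (hA : Filt A) {i j : ℤ} (h : i ≤ j) : NF b A j ≤ NF b A i :=
  fun w hw a => hA.mono _ _ _ (by omega) (hw a)

theorem min_finset (F : Finset ℤ) (g : ℤ → ℤ) : ∃ j, ∀ a ∈ F, j ≤ g a := by
  classical
  induction F using Finset.induction_on with
  | empty => exact ⟨0, by simp⟩
  | insert a s _ ih =>
    obtain ⟨j, hj⟩ := ih
    refine ⟨min j (g a), fun a' ha' => ?_⟩
    rcases Finset.mem_insert.1 ha' with h | h
    · subst h; exact min_le_right _ _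
    · exact (min_le_left _ _).trans (hj _ h)

noncomputable def EF {A : ℤ → ℤ → Submodule k 𝒱} (hA : Filt A) : PB k (WW k d) where
  M1 := { carrier := {w | SS1 b w = 0}
          zero_mem' := map_zero _
          add_mem' := fun {x y} hx hy => by
            simp only [Set.mem_setOf_eq] at hx hy ⊢
            rw [map_add, hx, hy, add_zero]
          smul_mem' := fun c x hx => by
            simp only [Set.mem_setOf_eq] at hx ⊢
            rw [SS1_smul, hx, smul_zero] }
  L := LF b
  N := NF b A
  tf := fun r w h => by
    by_cases hr : r = 0
    · exact Or.inl hr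
    · right
      funext p
      have := congrFun h p
      rw [Pi.smul_apply, smul_eq_mul] at this
      exact (mul_eq_zero.1 this).resolve_left hr
  hM := fun w => by
    show SS1 b _ = 0
    rw [SS1_smul, ← mul_one (1 - T 1 : k[T;T⁻¹]), ev1_one_sub_mul, zero_smul]
  hL := by
    refine ⟨Or.inl rfl, by norm_num, fun i j h => LF_anti b h, ?_, ?_, ?_⟩
    · intro w j
      rw [mem_LF, mem_LF]
      constructor
      · intro h a ha
        have := h (a + 3) (by omega)
        rw [cc_T'] at this
        simpa using this
      · intro h a ha
        rw [cc_T']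
        exact h _ (by omega)
    · intro w
      obtain ⟨F, hF⟩ := decomp b w
      obtain ⟨j, hj⟩ := min_finset F id
      refine ⟨j, ?_⟩
      rw [hF]
      exact Submodule.sum_mem _ fun a ha => LF_anti b (hj a ha) (LF_et b a _)
    · intro j
      obtain ⟨S, hS⟩ := span_single (k := k) (d := d) (e := 1) (Or.inl rfl) (j / 3)
      refine ⟨S, fun w hw => hS w fun p n hn => ?_⟩
      exact coeff_zero_of_cc b (hw _ (by have := p.1.2; omega))
  hN := by
    refine ⟨Or.inr rfl, by norm_num, fun i j h => NF_anti b hA h, ?_, ?_, ?_⟩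
    · intro w j
      rw [mem_NF, mem_NF]
      constructor
      · intro h a
        have := h (a - 3)
        rw [cc_T', show -(j + 6) = -j - 6 by ring, ← hA.per] at this
        simpa using this
      · intro h a
        rw [cc_T', show -(j + 6) = -j - 6 by ring, ← hA.per]
        have := h (a + 3)
        rwa [show a - 3 * -1 = a + 3 by ring]
    · intro w
      obtain ⟨F, hF⟩ := decomp b w
      choose i hi using fun a => hA.top a (cc b a w)
      obtain ⟨j, hj⟩ := min_finset F fun a => - i a
      refine ⟨j, ?_⟩
      rw [hF]
      refine Submodule.sum_mem _ fun a ha => NF_anti b hA (hj a ha) (NF_et b a _ _ ?_)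
      rw [neg_neg]; exact hi a
    · intro j
      obtain ⟨a0, ha0⟩ := hA.bot (-j)
      obtain ⟨S, hS⟩ := span_single (k := k) (d := d) (e := -1) (Or.inr rfl) (a0 / 3 + 1)
      refine ⟨S, fun w hw => hS w fun p n hn => ?_⟩
      refine coeff_zero_of_cc b ?_
      have := hw (3 * n + ((p.1 : ℕ) : ℤ))
      rw [ha0 _ (by omega), Submodule.mem_bot] at this
      exact this

variable {A : ℤ → ℤ → Submodule k 𝒱} (hA : Filt A)

theorem mem_EFM (w : WW k d) : w ∈ (EF b hA).M1 ↔ SS1 b w = 0 := Iff.rfl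
theorem mem_EFL (j : ℤ) (w : WW k d) : w ∈ (EF b hA).L j ↔ ∀ a, a < j → cc b a w = 0 := Iff.rfl
theorem mem_EFN (j : ℤ) (w : WW k d) : w ∈ (EF b hA).N j ↔ ∀ a, cc b a w ∈ A (-j) a := Iff.rfl

/-- the fibre functor -/
noncomputable def Ph (g : WW k d →ₗ[k[T;T⁻¹]] WW k d) : 𝒱 →ₗ[k] 𝒱 := SS1 b ∘ₗ g.restrictScalars k ∘ₗ et b 0

theorem Ph_apply (g : WW k d →ₗ[k[T;T⁻¹]] WW k d) (v : 𝒱) : Ph b g v = SS1 b (g (et b 0 v)) := rfl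

theorem Ph_S {g : WW k d →ₗ[k[T;T⁻¹]] WW k d} (hg : PB.IsHom 0 (EF b hA) (EF b hA) g) (w : WW k d) :
    SS1 b (g w) = Ph b g (SS1 b w) := by
  rw [Ph_apply, ← sub_eq_zero, ← map_sub, ← map_sub]
  refine (PB.isHom0_iff.1 hg).1 _ ?_
  show SS1 b _ = 0
  rw [map_sub, SS1_et, sub_self]

theorem Ph_comp {g h : WW k d →ₗ[k[T;T⁻¹]] WW k d} (hg : PB.IsHom 0 (EF b hA) (EF b hA) g) :
    Ph b (g ∘ₗ h) = Ph b g ∘ₗ Ph b h := by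
  ext v
  rw [Ph_apply, LinearMap.comp_apply, Ph_S b hA hg]; rfl

theorem Ph_filt {g : WW k d →ₗ[k[T;T⁻¹]] WW k d} (hg : PB.IsHom 0 (EF b hA) (EF b hA) g) (i c : ℤ) (v : 𝒱) (hv : v ∈ A i c) :
    Ph b g v ∈ A i c := by
  rw [← SS1_et b c v, ← Ph_S b hA hg]
  have h1 := (PB.isHom0_iff.1 hg).2.1 c _ (LF_et b c v)
  have h2 := (PB.isHom0_iff.1 hg).2.2 (-i) _ (NF_et b c (-i) v (by rwa [neg_neg]))
  rw [mem_EFL] at h1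
  rw [mem_EFN, neg_neg] at h2
  refine SS1_mem b _ _ fun a => ?_
  rcases lt_or_ge a c with h | h
  · rw [h1 a h]; exact Submodule.zero_mem _
  · exact hA.anti _ _ _ h (h2 a)

noncomputable def Ps (f : 𝒱 →ₗ[k] 𝒱) : WW k d →ₗ[k[T;T⁻¹]] WW k d :=
  LinearMap.pi fun p => ∑ y, (C (b.equivFun (f (b y)) p.2) : k[T;T⁻¹]) • LinearMap.proj (p.1, y)

theorem cc_Ps (f : 𝒱 →ₗ[k] 𝒱) (a : ℤ) (w : WW k d) : cc b a (Ps b f w) = f (cc b a w) := by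
  apply b.equivFun.injective
  funext x
  have h1 : cc b a w = ∑ y, (w (rs a, y)).coeff (a / 3) • b y := by
    rw [cc_apply, Module.Basis.equivFun_symm_apply]
  rw [cc_coord, h1, map_sum, map_sum, Finset.sum_apply, Ps, LinearMap.pi_apply, LinearMap.sum_apply]
  have h2 : ∀ (s : Finset (Fin d)) (g : Fin d → k[T;T⁻¹]) (n : ℤ), (∑ y ∈ s, g y).coeff n = ∑ y ∈ s, (g y).coeff n := by
    intro s g n
    exact map_sum (PB.coeffL (k := k) n) g s
  rw [h2]
  refine Finset.sum_congr rfl fun y _ => ?_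
  rw [LinearMap.smul_apply, LinearMap.proj_apply, smul_eq_mul, ← smul_eq_C_mul, AddMonoidAlgebra.coeff_smul, Finsupp.smul_apply, 
    map_smul, map_smul, Pi.smul_apply, smul_eq_mul, smul_eq_mul, mul_comm]

theorem Ps_et (f : 𝒱 →ₗ[k] 𝒱) (a : ℤ) (v : 𝒱) : Ps b f (et b a v) = et b a (f v) := by
  refine cc_ext b fun a' => ?_
  rw [cc_Ps, cc_et, cc_et]
  split_ifs <;> simp

theorem SS1_Ps (f : 𝒱 →ₗ[k] 𝒱) (w : WW k d) : SS1 b (Ps b f w) = f (SS1 b w) := by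
  obtain ⟨F, hF⟩ := decomp b w
  rw [hF]
  simp only [map_sum, Ps_et, SS1_et]

theorem Ph_Ps (f : 𝒱 →ₗ[k] 𝒱) : Ph b (Ps b f) = f := by
  ext v
  rw [Ph_apply, SS1_Ps, SS1_et]

theorem Ps_filt (hA : Filt A) {f : 𝒱 →ₗ[k] 𝒱} {e : ℤ} (h : ∀ i c, 0 ≤ c → c < 3 → ∀ v ∈ A i c, f v ∈ A (i - e) c) (i c : ℤ) (v : 𝒱) (hv : v ∈ A i c) :
    f v ∈ A (i - e) c := by
  have h1 := hA.pern (c / 3) 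
  have h2 : c % 3 + 3 * (c / 3) = c := by omega
  rw [← h2, h1] at hv ⊢
  have := h _ _ (by omega) (by omega) v hv
  rwa [show i - 6 * (c / 3) - e = i - e - 6 * (c / 3) by ring] at this

theorem Ps_isHom {f : 𝒱 →ₗ[k] 𝒱} (h : ∀ i c, 0 ≤ c → c < 3 → ∀ v ∈ A i c, f v ∈ A i c) :
    PB.IsHom 0 (EF b hA) (EF b hA) (Ps b f) := by
  rw [PB.isHom0_iff]
  refine ⟨?_, ?_, ?_⟩
  · intro w hw
    rw [mem_EFM] at hw ⊢
    rw [SS1_Ps, hw, map_zero]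
  · intro j w hw a ha
    rw [cc_Ps, hw a ha, map_zero]
  · intro i w hw a
    rw [cc_Ps]
    have := Ps_filt hA (f := f) (e := 0) (by simpa using h) (-i) a _ (hw a)
    simpa using this

theorem Ps_low {f : 𝒱 →ₗ[k] 𝒱} (h : ∀ i c, 0 ≤ c → c < 3 → ∀ v ∈ A i c, f v ∈ A (i - 1) c) (i : ℤ) :
    ∀ w ∈ (EF b hA).N i, Ps b f w ∈ (EF b hA).N (i + 1) := by
  intro w hw a
  rw [cc_Ps]
  have := Ps_filt hA (f := f) h (-i) a _ (hw a)
  rwa [show -(i + 1) = -i - 1 by ring]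

theorem cc_smul_et (r : k[T;T⁻¹]) (v : 𝒱) (a : ℤ) : cc b a (r • et b 0 v) = if a % 3 = 0 then r.coeff (a / 3) • v else 0 := by
  apply b.equivFun.injective
  funext x
  rw [cc_coord, Pi.smul_apply, et_apply]
  simp only
  by_cases h : a % 3 = 0
  · rw [if_pos h, if_pos (by rw [rs_eq, h]; rfl)]
    simp [mul_comm]
  · rw [if_neg h, if_neg (by rw [rs_eq]; exact h), smul_zero]; simp

theorem from_isHom {i : ℤ} {v : 𝒱} (hv : v ∈ A i 0) :
    PB.IsHom 0 (Lb 0 (-i)) (EF b hA) (LinearMap.toSpanSingleton k[T;T⁻¹] (WW k d) (et b 0 v)) := by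
  rw [PB.isHom0_iff]
  refine ⟨?_, ?_, ?_⟩
  · intro r hr
    rw [mem_LbM] at hr
    rw [LinearMap.toSpanSingleton_apply, mem_EFM, SS1_smul, hr, zero_smul]
  · intro j r hr a ha
    rw [LinearMap.toSpanSingleton_apply, cc_smul_et]
    split_ifs with h
    · rw [hr (a / 3) (by omega), zero_smul]
    · rfl
  · intro j r hr a
    rw [LinearMap.toSpanSingleton_apply, cc_smul_et]
    split_ifs with h
    · by_cases h2 : -i - 6 * (a / 3) < j
      · rw [hr (a / 3) h2, zero_smul]; exact Submodule.zero_mem _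
      · have := hA.pern (a / 3) (-j) 0
        rw [show 0 + 3 * (a / 3) = a by omega] at this
        rw [this]
        exact Submodule.smul_mem _ _ (hA.mono _ _ _ (by omega) hv)
    · exact Submodule.zero_mem _

noncomputable def al (Λ : 𝒱 →ₗ[k] k) : WW k d →ₗ[k[T;T⁻¹]] k[T;T⁻¹] :=
  ∑ p : Fin 3 × Fin d, (Λ (b p.2) • T ((((p.1 : ℕ) : ℤ) + 1) / 3) : k[T;T⁻¹]) • LinearMap.proj p

theorem al_et (Λ : 𝒱 →ₗ[k] k) (a : ℤ) (v : 𝒱) : al b Λ (et b a v) = Λ v • T ((a + 1) / 3) := by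
  rw [al, LinearMap.sum_apply, Fintype.sum_prod_type, Finset.sum_eq_single (rs a)]
  · have h1 : v = ∑ y, b.equivFun v y • b y := (b.sum_equivFun v).symm
    conv_rhs => rw [h1, map_sum, Finset.sum_smul]
    refine Finset.sum_congr rfl fun x _ => ?_
    rw [LinearMap.smul_apply, LinearMap.proj_apply, et_apply]
    simp only [if_true]
    rw [map_smul, smul_eq_mul, smul_mul_smul_comm, ← T_add, smul_eq_mul, mul_comm (Λ (b x))]
    congr 2
    have := coe_rs a
    omega
  · intro s _ hs
    refine Finset.sum_eq_zero fun x _ => ?_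
    rw [LinearMap.smul_apply, LinearMap.proj_apply, et_apply]
    simp only
    rw [if_neg hs, smul_zero]
  · intro h; exact absurd (Finset.mem_univ _) h

theorem al_ev (Λ : 𝒱 →ₗ[k] k) (w : WW k d) : ev1 (al b Λ w) = Λ (SS1 b w) := by
  obtain ⟨F, hF⟩ := decomp b w
  rw [hF]
  simp only [map_sum, al_et, SS1_et, map_smul, ev1_T, smul_eq_mul, mul_one]

theorem to_isHom {Λ : 𝒱 →ₗ[k] k} {β : ℤ} (h : ∀ m c, 0 ≤ c → c < 3 → ∀ v ∈ A m c, Λ v ≠ 0 → -m ≤ β - 6 * ((c + 1) / 3)) :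
    PB.IsHom 0 (EF b hA) (Lb 1 β) (al b Λ) := by
  rw [PB.isHom0_iff]
  refine ⟨?_, ?_, ?_⟩
  · intro w hw
    rw [mem_EFM] at hw
    rw [mem_LbM, al_ev, hw, map_zero]
  · intro j w hw
    obtain ⟨F, hF⟩ := decomp b w
    rw [hF, map_sum]
    refine Submodule.sum_mem _ fun a _ => ?_
    intro n hn
    rw [al_et, AddMonoidAlgebra.coeff_smul, Finsupp.smul_apply, T_coeff]
    split_ifs with h1
    · rw [hw a (by omega), map_zero, zero_smul]
    · rw [smul_zero]
  · intro j w hw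
    obtain ⟨F, hF⟩ := decomp b w
    rw [hF, map_sum]
    refine Submodule.sum_mem _ fun a _ => ?_
    intro n hn
    rw [al_et, AddMonoidAlgebra.coeff_smul, Finsupp.smul_apply, T_coeff]
    split_ifs with h1
    · have h2 := hw a
      by_cases h3 : Λ (cc b a w) = 0
      · rw [h3, zero_smul]
      · exfalso
        have h4 := hA.pern (a / 3) (-j) (a % 3)
        rw [show a % 3 + 3 * (a / 3) = a by omega] at h4
        rw [h4] at h2
        have := h _ _ (by omega) (by omega) _ h2 h3
        omega
    · rw [smul_zero]

end functor
end Stm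

namespace Stm
open LaurentPolynomial

section cover
variable {k : Type u} [Field k] {V : Type u} [AddCommGroup V] [Module k V]

noncomputable def sing (i : ℤ) : V →ₗ[k] (Fin 17 → V) :=
  LinearMap.pi fun j => if ((j : ℕ) : ℤ) = i then LinearMap.id else 0

theorem sing_apply (i : ℤ) (x : V) (j : Fin 17) : sing (k := k) i x j = if ((j : ℕ) : ℤ) = i then x else 0 := by
  rw [sing, LinearMap.pi_apply]; split_ifs <;> rfl

noncomputable def sg (t : Module.End k V) (i : ℤ) : (Fin 17 → V) →ₗ[k] V :=
  ∑ j : Fin 17, (if ((j : ℕ) : ℤ) ≤ i then t ^ (i - ((j : ℕ) : ℤ)).toNat else 0) ∘ₗ LinearMap.proj j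

variable (t : Module.End k V)

theorem sg_apply (i : ℤ) (v : Fin 17 → V) : sg t i v = ∑ j : Fin 17, if ((j : ℕ) : ℤ) ≤ i then (t ^ (i - ((j : ℕ) : ℤ)).toNat) (v j) else 0 := by
  rw [sg, LinearMap.sum_apply]
  refine Finset.sum_congr rfl fun j _ => ?_
  rw [LinearMap.comp_apply, LinearMap.proj_apply]
  split_ifs <;> rfl

theorem sing_out {i : ℤ} (hi : i < 0 ∨ 16 < i) : sing (k := k) (V := V) i = 0 := by
  refine LinearMap.ext fun x => funext fun j => ?_
  rw [sing_apply, if_neg]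
  · rfl
  · have := j.2; omega

theorem sg_sing {j : ℤ} (h0 : 0 ≤ j) (h1 : j ≤ 16) (i : ℤ) (x : V) :
    sg t i (sing (k := k) j x) = if j ≤ i then (t ^ (i - j).toNat) x else 0 := by
  obtain ⟨j, rfl⟩ := Int.eq_ofNat_of_zero_le h0
  rw [sg_apply, Finset.sum_eq_single (⟨j, by omega⟩ : Fin 17)]
  · rw [sing_apply, if_pos rfl]
  · intro j' _ hj'
    have hz : sing (k := k) (V := V) (j : ℤ) x j' = 0 := by
      rw [sing_apply, if_neg]
      rw [Ne, Fin.ext_iff] at hj'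
      simpa using hj'
    rw [hz, map_zero, ite_self]
  · intro h; exact absurd (Finset.mem_univ _) h

theorem sg_sing_self {i : ℤ} (h0 : 0 ≤ i) (h1 : i ≤ 16) (x : V) : sg t i (sing (k := k) i x) = x := by
  rw [sg_sing t h0 h1, if_pos le_rfl]; simp

variable (k V) in
def KK (m : ℤ) : Submodule k (Fin 17 → V) where
  carrier := {v | ∀ j : Fin 17, m < ((j : ℕ) : ℤ) → v j = 0}
  zero_mem' := fun j _ => rfl
  add_mem' := fun {x y} hx hy j hj => by
    rw [Pi.add_apply, hx j hj, hy j hj, add_zero]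
  smul_mem' := fun c x hx j hj => by
    rw [Pi.smul_apply, hx j hj, smul_zero]

theorem mem_KK {m : ℤ} {v : Fin 17 → V} : v ∈ KK k V m ↔ ∀ j : Fin 17, m < ((j : ℕ) : ℤ) → v j = 0 := Iff.rfl

theorem KK_mono {m n : ℤ} (h : m ≤ n) : KK k V m ≤ KK k V n := fun v hv j hj => hv j (by omega)

theorem KK_bot {m : ℤ} (h : m < 0) : KK k V m = ⊥ := by
  rw [eq_bot_iff]
  intro v hv
  rw [Submodule.mem_bot]
  funext j
  exact hv j (by omega)

theorem KK_top {m : ℤ} (h : 16 ≤ m) (v : Fin 17 → V) : v ∈ KK k V m := fun j hj => by have := j.2; omega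

theorem sing_KK (i : ℤ) (x : V) : sing (k := k) i x ∈ KK k V i := by
  intro j hj
  rw [sing_apply, if_neg (by omega)]

theorem sg_step {m i : ℤ} (h : m ≤ i) {v : Fin 17 → V} (hv : v ∈ KK k V m) : sg t i v = (t ^ (i - m).toNat) (sg t m v) := by
  rw [sg_apply, sg_apply, map_sum]
  refine Finset.sum_congr rfl fun j _ => ?_
  by_cases h1 : ((j : ℕ) : ℤ) ≤ m
  · rw [if_pos h1, if_pos (by omega), ← Module.End.mul_apply, ← pow_add]
    congr 2
    omega
  · rw [if_neg h1, hv j (by omega)]; simp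

variable (U : Submodule k V)

noncomputable def AA (m a : ℤ) : Submodule k (Fin 17 → V) :=
  KK k V (m - 6 * (a / 3)) ⊓ if a % 3 = 0 then ⊤ else if a % 3 = 1 then U.comap (sg t (m - 6 * (a / 3))) else LinearMap.ker (sg t (m - 6 * (a / 3)))

theorem mem_AA0 {m : ℤ} {v : Fin 17 → V} : v ∈ AA t U m 0 ↔ v ∈ KK k V m := by
  rw [AA]; simp

theorem mem_AA1 {m : ℤ} {v : Fin 17 → V} : v ∈ AA t U m 1 ↔ v ∈ KK k V m ∧ sg t m v ∈ U := by
  rw [AA]; simp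

theorem mem_AA2 {m : ℤ} {v : Fin 17 → V} : v ∈ AA t U m 2 ↔ v ∈ KK k V m ∧ sg t m v = 0 := by
  rw [AA]; simp

theorem AA_per (m a : ℤ) : AA t U m (a + 3) = AA t U (m - 6) a := by
  rw [AA, AA, show m - 6 * ((a + 3) / 3) = m - 6 - 6 * (a / 3) by omega, show (a + 3) % 3 = a % 3 by omega]

theorem AA_red (m a : ℤ) : AA t U m a = AA t U (m - 6 * (a / 3)) (a % 3) := by
  rw [AA, AA, show m - 6 * (a / 3) - 6 * (a % 3 / 3) = m - 6 * (a / 3) by omega, show a % 3 % 3 = a % 3 by omega]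

variable {t U}
theorem pow_U (hU : ∀ x ∈ U, t x ∈ U) (n : ℕ) : ∀ x ∈ U, (t ^ n) x ∈ U := by
  induction n with
  | zero => intro x hx; simpa using hx
  | succ n ih =>
    intro x hx
    rw [pow_succ', Module.End.mul_apply]
    exact hU _ (ih x hx)

theorem pow_zero6 (ht : t ^ 6 = 0) {n : ℕ} (hn : 6 ≤ n) : t ^ n = 0 := pow_eq_zero_of_le hn ht

theorem AA_filt (ht : t ^ 6 = 0) (hU : ∀ x ∈ U, t x ∈ U) : Filt (AA t U) := by
  have hmono : ∀ i j a, i ≤ j → AA t U i a ≤ AA t U j a := by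
    intro i j a hij v hv
    rw [AA_red] at hv ⊢
    have h3 : a % 3 = 0 ∨ a % 3 = 1 ∨ a % 3 = 2 := by omega
    have h4 : i - 6 * (a / 3) ≤ j - 6 * (a / 3) := by omega
    rcases h3 with h | h | h <;> rw [h] at hv ⊢
    · rw [mem_AA0] at hv ⊢
      exact KK_mono h4 hv
    · rw [mem_AA1] at hv ⊢
      refine ⟨KK_mono h4 hv.1, ?_⟩
      rw [sg_step t h4 hv.1]
      exact pow_U hU _ _ hv.2
    · rw [mem_AA2] at hv ⊢
      refine ⟨KK_mono h4 hv.1, ?_⟩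
      rw [sg_step t h4 hv.1, hv.2, map_zero]
  have hanti1 : ∀ i a, AA t U i (a + 1) ≤ AA t U i a := by
    intro i a v hv
    rw [AA_red] at hv ⊢
    have h3 : a % 3 = 0 ∨ a % 3 = 1 ∨ a % 3 = 2 := by omega
    rcases h3 with h | h | h
    · rw [h, mem_AA0]
      rw [show (a + 1) / 3 = a / 3 by omega, show (a + 1) % 3 = 1 by omega, mem_AA1] at hv
      exact hv.1
    · rw [h, mem_AA1]
      rw [show (a + 1) / 3 = a / 3 by omega, show (a + 1) % 3 = 2 by omega, mem_AA2] at hv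
      exact ⟨hv.1, by rw [hv.2]; exact Submodule.zero_mem _⟩
    · rw [h, mem_AA2]
      rw [show (a + 1) / 3 = a / 3 + 1 by omega, show (a + 1) % 3 = 0 by omega, mem_AA0] at hv
      refine ⟨KK_mono (by omega) hv, ?_⟩
      rw [sg_step t (by omega) hv, pow_zero6 ht (by omega)]; rfl
  have hanti : ∀ i a a', a ≤ a' → AA t U i a' ≤ AA t U i a := by
    intro i a a' h
    obtain ⟨n, rfl⟩ : ∃ n : ℕ, a' = a + n := ⟨(a' - a).toNat, by omega⟩
    clear h
    induction n with
    | zero => simp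
    | succ n ih =>
      refine le_trans ?_ ih
      push_cast
      rw [← add_assoc]
      exact hanti1 _ _
  refine ⟨hmono, hanti, AA_per t U, ?_, ?_⟩
  · intro i
    refine ⟨3 * (i + 1) ^ 2, fun a ha => ?_⟩
    rw [eq_bot_iff, ← KK_bot (k := k) (V := V) (m := i - 6 * (a / 3))]
    · exact inf_le_left
    · have : (i + 1) ^ 2 ≤ a / 3 := by omega
      nlinarith
  · intro a v
    refine ⟨16 + 6 * (a / 3) + 6, hanti _ _ (3 * (a / 3) + 3) (by omega) ?_⟩
    rw [AA_red, show (3 * (a / 3) + 3) % 3 = 0 by omega, mem_AA0]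
    exact KK_top (by omega) v

/-- graded families -/
noncomputable def fam (h : ℤ → Module.End k V) (e : ℤ) : (Fin 17 → V) →ₗ[k] (Fin 17 → V) :=
  ∑ j : Fin 17, sing (k := k) (((j : ℕ) : ℤ) - e) ∘ₗ h ((j : ℕ) : ℤ) ∘ₗ LinearMap.proj j

theorem fam_apply (h : ℤ → Module.End k V) (e : ℤ) (v : Fin 17 → V) : fam h e v =
    ∑ j : Fin 17, sing (k := k) (((j : ℕ) : ℤ) - e) (h ((j : ℕ) : ℤ) (v j)) := by
  rw [fam, LinearMap.sum_apply]; rfl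

structure GF (t : Module.End k V) (U : Submodule k V) (h : ℤ → Module.End k V) (e : ℤ) : Prop where
  ht : ∀ i, h (i + 1) * t = t * h i
  hU : ∀ i, ∀ x ∈ U, h i x ∈ U
  z1 : ∀ i, (i < 0 ∨ 16 < i) → h i = 0
  z2 : ∀ i, (i - e < 0 ∨ 16 < i - e) → h i = 0

theorem GF.pow {h : ℤ → Module.End k V} {e : ℤ} (H : GF t U h e) (n : ℕ) (i : ℤ) : h (i + n) * t ^ n = t ^ n * h i := by
  induction n with
  | zero => simp
  | succ n ih =>
    rw [pow_succ', ← mul_assoc]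
    push_cast
    rw [← add_assoc, H.ht, mul_assoc, ih, mul_assoc]

theorem sg_fam {h : ℤ → Module.End k V} {e : ℤ} (H : GF t U h e) (i : ℤ) (v : Fin 17 → V) :
    sg t i (fam h e v) = h (i + e) (sg t (i + e) v) := by
  rw [fam_apply, map_sum, sg_apply, map_sum]
  refine Finset.sum_congr rfl fun j _ => ?_
  by_cases h1 : ((j : ℕ) : ℤ) - e < 0 ∨ 16 < ((j : ℕ) : ℤ) - e
  · rw [H.z2 _ h1]
    split_ifs with h2
    · have := H.pow (i + e - ((j : ℕ) : ℤ)).toNat ((j : ℕ) : ℤ)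
      rw [show ((j : ℕ) : ℤ) + ((i + e - ((j : ℕ) : ℤ)).toNat : ℤ) = i + e by omega, H.z2 _ h1, mul_zero] at this
      have h3 := LinearMap.congr_fun this (v j)
      rw [Module.End.mul_apply] at h3
      rw [h3]; simp
    · simp
  · rw [sg_sing t (by omega) (by omega)]
    by_cases h2 : ((j : ℕ) : ℤ) ≤ i + e
    · rw [if_pos h2, if_pos (by omega)]
      have := H.pow (i + e - ((j : ℕ) : ℤ)).toNat ((j : ℕ) : ℤ)
      rw [show ((j : ℕ) : ℤ) + ((i + e - ((j : ℕ) : ℤ)).toNat : ℤ) = i + e by omega] at this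
      have h3 := LinearMap.congr_fun this (v j)
      rw [Module.End.mul_apply, Module.End.mul_apply] at h3
      rw [h3]
      congr 3
      omega
    · rw [if_neg h2, if_neg (by omega), map_zero]

theorem fam_KK {h : ℤ → Module.End k V} {e : ℤ} {m : ℤ} {v : Fin 17 → V} (hv : v ∈ KK k V m) : fam h e v ∈ KK k V (m - e) := by
  rw [fam_apply]
  refine Submodule.sum_mem _ fun j _ => ?_
  by_cases h1 : m < ((j : ℕ) : ℤ)
  · rw [hv j h1, map_zero, map_zero]; exact Submodule.zero_mem _
  · exact KK_mono (by omega) (sing_KK _ _)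

theorem fam_AA {h : ℤ → Module.End k V} {e : ℤ} (H : GF t U h e) (i c : ℤ) (h0 : 0 ≤ c) (h3 : c < 3) : ∀ v ∈ AA t U i c, fam h e v ∈ AA t U (i - e) c := by
  intro v hv
  have : c = 0 ∨ c = 1 ∨ c = 2 := by omega
  rcases this with rfl | rfl | rfl
  · rw [mem_AA0] at hv ⊢
    exact fam_KK hv
  · rw [mem_AA1] at hv ⊢
    refine ⟨fam_KK hv.1, ?_⟩
    rw [sg_fam H, sub_add_cancel]
    exact H.hU _ _ hv.2
  · rw [mem_AA2] at hv ⊢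
    refine ⟨fam_KK hv.1, ?_⟩
    rw [sg_fam H, sub_add_cancel, hv.2, map_zero]

end cover
end Stm

namespace Stm
open LaurentPolynomial

section cover2
variable {k : Type u} [Field k] {V : Type u} [AddCommGroup V] [Module k V]
variable {t : Module.End k V} {U : Submodule k V} {d : ℕ} (b : Module.Basis (Fin d) k (Fin 17 → V)) (hA : Filt (AA t U))


variable (t) in
noncomputable def indf (g : WW k d →ₗ[k[T;T⁻¹]] WW k d) (i : ℤ) : Module.End k V := sg t i ∘ₗ Ph b g ∘ₗ sing i

theorem indf_apply (g : WW k d →ₗ[k[T;T⁻¹]] WW k d) (i : ℤ) (x : V) : indf t b g i x = sg t i (Ph b g (sing (k := k) i x)) := rfl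

theorem indf_out (g : WW k d →ₗ[k[T;T⁻¹]] WW k d) {i : ℤ} (hi : i < 0 ∨ 16 < i) : indf t b g i = 0 := by
  rw [indf, sing_out hi]; simp

theorem indf_sg {g : WW k d →ₗ[k[T;T⁻¹]] WW k d} (hg : PB.IsHom 0 (EF b hA) (EF b hA) g) {i : ℤ} (h0 : 0 ≤ i) (h1 : i ≤ 16) {v : Fin 17 → V}
    (hv : v ∈ KK k V i) : indf t b g i (sg t i v) = sg t i (Ph b g v) := by
  have h2 : v - sing (k := k) i (sg t i v) ∈ AA t U i 2 := by
    rw [mem_AA2]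
    refine ⟨Submodule.sub_mem _ hv (sing_KK _ _), ?_⟩
    rw [map_sub, sg_sing_self t h0 h1, sub_self]
  have h3 := Ph_filt b hA hg _ _ _ h2
  rw [mem_AA2] at h3
  have h4 := h3.2
  rw [map_sub, map_sub, sub_eq_zero] at h4
  rw [h4, indf_apply]

theorem Ph_KK {g : WW k d →ₗ[k[T;T⁻¹]] WW k d} (hg : PB.IsHom 0 (EF b hA) (EF b hA) g) {i : ℤ} {v : Fin 17 → V}
    (hv : v ∈ KK k V i) : Ph b g v ∈ KK k V i := by
  rw [← mem_AA0 t U] at hv ⊢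
  exact Ph_filt b hA hg _ _ _ hv

theorem indf_comp {g h : WW k d →ₗ[k[T;T⁻¹]] WW k d} (hg : PB.IsHom 0 (EF b hA) (EF b hA) g) (hh : PB.IsHom 0 (EF b hA) (EF b hA) h) (i : ℤ) :
    indf t b (g ∘ₗ h) i = indf t b g i * indf t b h i := by
  by_cases hi : i < 0 ∨ 16 < i
  · rw [indf_out b _ hi, indf_out b _ hi, zero_mul]
  · ext x
    rw [Module.End.mul_apply, indf_apply b h, indf_sg b hA hg (by omega) (by omega) (Ph_KK b hA hh (sing_KK _ _)), indf_apply, Ph_comp b hA hg]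
    rfl

theorem indf_id {i : ℤ} (h0 : 0 ≤ i) (h1 : i ≤ 16) : indf t b LinearMap.id i = 1 := by
  ext x
  rw [indf_apply, Ph_apply, LinearMap.id_apply, SS1_et, sg_sing_self t h0 h1]; rfl

theorem indf_zero (i : ℤ) : indf t b 0 i = 0 := by
  ext x
  rw [indf_apply, Ph_apply]; simp

theorem indf_add (g h : WW k d →ₗ[k[T;T⁻¹]] WW k d) (i : ℤ) : indf t b (g + h) i = indf t b g i + indf t b h i := by
  ext x
  rw [LinearMap.add_apply, indf_apply, indf_apply, indf_apply, Ph_apply, Ph_apply, Ph_apply, LinearMap.add_apply, map_add, map_add]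

theorem indf_t {g : WW k d →ₗ[k[T;T⁻¹]] WW k d} (hg : PB.IsHom 0 (EF b hA) (EF b hA) g) {i : ℤ} (h0 : 0 ≤ i) (h1 : i ≤ 15) :
    indf t b g (i + 1) * t = t * indf t b g i := by
  ext x
  have h2 : t x = sg t (i + 1) (sing (k := k) i x) := by
    rw [sg_sing t h0 (by omega), if_pos (by omega)]
    rw [show (i + 1 - i).toNat = 1 by omega, pow_one]
  rw [Module.End.mul_apply, Module.End.mul_apply, h2, indf_sg b hA hg (by omega) (by omega) (KK_mono (by omega) (sing_KK _ _)),
    sg_step t (by omega : i ≤ i + 1) (Ph_KK b hA hg (sing_KK _ _)), show (i + 1 - i).toNat = 1 by omega, pow_one, indf_apply]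

theorem indf_U {g : WW k d →ₗ[k[T;T⁻¹]] WW k d} (hg : PB.IsHom 0 (EF b hA) (EF b hA) g) (i : ℤ) : ∀ x ∈ U, indf t b g i x ∈ U := by
  intro x hx
  by_cases hi : i < 0 ∨ 16 < i
  · rw [indf_out b _ hi]; exact Submodule.zero_mem _
  · have h2 : sing (k := k) i x ∈ AA t U i 1 := by
      rw [mem_AA1, sg_sing_self t (by omega) (by omega)]
      exact ⟨sing_KK _ _, hx⟩
    have h3 := Ph_filt b hA hg _ _ _ h2
    rw [mem_AA1] at h3
    exact h3.2

theorem indf_Ps {h : ℤ → Module.End k V} (H : GF t U h 0) (i : ℤ) : indf t b (Ps b (fam h 0)) i = h i := by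
  by_cases hi : i < 0 ∨ 16 < i
  · rw [indf_out b _ hi, H.z1 _ hi]
  · ext x
    rw [indf_apply, Ph_Ps, sg_fam H, add_zero, sg_sing_self t (by omega) (by omega)]

theorem fam_isHom {h : ℤ → Module.End k V} (H : GF t U h 0) : PB.IsHom 0 (EF b hA) (EF b hA) (Ps b (fam h 0)) :=
  Ps_isHom b hA (fun i c h0 h3 v hv => by simpa using fam_AA H i c h0 h3 v hv)

section idem
variable {g : WW k d →ₗ[k[T;T⁻¹]] WW k d}

theorem rr_isHom (hg : PB.IsHom 0 (EF b hA) (EF b hA) g) : PB.IsHom 0 (EF b hA) ((EF b hA).sub (LinearMap.range g)) g.rangeRestrict :=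
  PB.isHom0_iff.2 ⟨fun w hw => (PB.isHom0_iff.1 hg).1 w hw, fun j w hw => (PB.isHom0_iff.1 hg).2.1 j w hw, fun j w hw => (PB.isHom0_iff.1 hg).2.2 j w hw⟩

theorem st_isHom : PB.IsHom 0 ((EF b hA).sub (LinearMap.range g)) (EF b hA) (LinearMap.range g).subtype :=
  ((EF b hA).sub_smono _).isHom

theorem wid1 (hg : PB.IsHom 0 (EF b hA) (EF b hA) g) {μ : ℚ} (hS : PB.SS ((EF b hA).sub (LinearMap.range g)) μ) {i : ℤ} (hi : indf t b g i ≠ 0) :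
    ((Lb 0 (-i) : PB k k[T;T⁻¹]).D : ℚ) ≤ μ := by
  obtain ⟨x, hx⟩ : ∃ x, indf t b g i x ≠ 0 := by
    by_contra hcon
    push Not at hcon
    exact hi (LinearMap.ext hcon)
  have h1 := from_isHom b hA (v := sing (k := k) i x) ((mem_AA0 t U).2 (sing_KK i x))
  refine hS.from_Lb _ (h1.comp (rr_isHom b hA hg)) fun h0 => hx ?_
  have h2 := congrArg Subtype.val (LinearMap.congr_fun h0 1)
  rw [LinearMap.comp_apply, LinearMap.toSpanSingleton_apply, one_smul] at h2
  have h3 : g (et b 0 (sing (k := k) i x)) = 0 := h2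
  rw [indf_apply, Ph_apply, h3, map_zero, map_zero]

theorem wid2 (ht : t ^ 6 = 0) (hg : PB.IsHom 0 (EF b hA) (EF b hA) g) {μ : ℚ} (hS : PB.SS ((EF b hA).sub (LinearMap.range g)) μ) {i : ℤ} (hi : indf t b g i ≠ 0) :
    μ ≤ ((Lb 1 (5 - i) : PB k k[T;T⁻¹]).D : ℚ) := by
  obtain ⟨x, hx⟩ : ∃ x, indf t b g i x ≠ 0 := by
    by_contra hcon
    push Not at hcon
    exact hi (LinearMap.ext hcon)
  obtain ⟨l, hl⟩ : ∃ l : V →ₗ[k] k, l (indf t b g i x) ≠ 0 := by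
    by_contra hcon
    push Not at hcon
    exact hx ((Module.forall_dual_apply_eq_zero_iff k _).1 hcon)
  have h1 : PB.IsHom 0 (EF b hA) (Lb 1 (5 - i)) (al b (l ∘ₗ sg t i)) := by
    refine to_isHom b hA ?_
    intro m c h0 h3 v hv hne
    by_contra hcon
    refine hne ?_
    rw [LinearMap.comp_apply]
    have : c = 0 ∨ c = 1 ∨ c = 2 := by omega
    rcases this with rfl | rfl | rfl
    · rw [mem_AA0] at hv
      rw [sg_step t (by omega) hv, pow_zero6 ht (by omega)]; simp
    · rw [mem_AA1] at hv
      rw [sg_step t (by omega) hv.1, pow_zero6 ht (by omega)]; simp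
    · rw [mem_AA2] at hv
      rw [sg_step t (by omega) hv.1, hv.2, map_zero, map_zero]
  refine hS.to_Lb _ ((st_isHom b hA).comp h1) fun h0 => hl ?_
  have h2 := LinearMap.congr_fun h0 (g.rangeRestrict (et b 0 (sing (k := k) i x)))
  have h3 : al b (l ∘ₗ sg t i) (g (et b 0 (sing (k := k) i x))) = 0 := h2
  have h4 := al_ev b (l ∘ₗ sg t i) (g (et b 0 (sing (k := k) i x)))
  rw [h3, map_zero, LinearMap.comp_apply] at h4
  exact h4.symm

theorem wid (ht : t ^ 6 = 0) (hg : PB.IsHom 0 (EF b hA) (EF b hA) g) {μ : ℚ} (hS : PB.SS ((EF b hA).sub (LinearMap.range g)) μ) {i j : ℤ}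
    (hi : indf t b g i ≠ 0) (hj : indf t b g j ≠ 0) : i ≤ j + 7 := by
  have h1 := wid1 b hA hg hS hj
  have h2 := wid2 b hA ht hg hS hi
  have h3 := PB.LbD (k := k) (-j) (5 - i)
  have h4 : (Lb 0 (-j) : PB k k[T;T⁻¹]).D ≤ (Lb 1 (5 - i) : PB k k[T;T⁻¹]).D := by
    exact_mod_cast h1.trans h2
  omega

/-- existence of an indecomposable summand through degree 8 -/
theorem exists_idem (hV : ∃ x : V, x ≠ 0) : ∃ g, PB.IsHom 0 (EF b hA) (EF b hA) g ∧ (∀ w, g (g w) = g w) ∧ indf t b g 8 ≠ 0 ∧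
    PB.Ind ((EF b hA).sub (LinearMap.range g)) := by
  classical
  let P : ℕ → Prop := fun n => ∃ g, PB.IsHom 0 (EF b hA) (EF b hA) g ∧ (∀ w, g (g w) = g w) ∧ indf t b g 8 ≠ 0 ∧ PB.rk (LinearMap.range g) = n
  have hP : ∃ n, P n := by
    refine ⟨_, LinearMap.id, PB.IsHom.id _, fun w => rfl, ?_, rfl⟩
    rw [indf_id b (by norm_num) (by norm_num)]
    intro h
    obtain ⟨x, hx⟩ := hV
    exact hx (LinearMap.congr_fun h x)
  obtain ⟨g, hg, hgg, h8, hr⟩ := Nat.find_spec hP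
  have hmin : ∀ g', PB.IsHom 0 (EF b hA) (EF b hA) g' → (∀ w, g' (g' w) = g' w) → indf t b g' 8 ≠ 0 → LinearMap.range g' ≤ LinearMap.range g →
      LinearMap.range g' = LinearMap.range g := by
    intro g' h1 h2 h3 h4
    have h5 : PB.rk (LinearMap.range g) ≤ PB.rk (LinearMap.range g') := by
      rw [hr]
      exact Nat.find_min' hP ⟨g', h1, h2, h3, rfl⟩
    refine (EF b hA).eq_of_rk ?_ h4 h5
    have : LinearMap.range g' = LinearMap.ker (g' - LinearMap.id) := by
      ext w
      rw [LinearMap.mem_ker, LinearMap.sub_apply, sub_eq_zero, LinearMap.id_apply]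
      constructor
      · rintro ⟨w, rfl⟩; exact h2 w
      · intro h; exact ⟨w, h⟩
    rw [this]
    exact PB.sat_ker (EF b hA) _
  refine ⟨g, hg, hgg, h8, ?_⟩
  intro q hq hqq
  have hp : ∀ x : LinearMap.range g, g.rangeRestrict (x : WW k d) = x := by
    rintro ⟨_, w, rfl⟩
    exact Subtype.ext (hgg w)
  -- a common construction
  have key : ∀ q : LinearMap.range g →ₗ[k[T;T⁻¹]] LinearMap.range g, PB.IsHom 0 ((EF b hA).sub (LinearMap.range g)) ((EF b hA).sub (LinearMap.range g)) q →
      (∀ w, q (q w) = q w) → indf t b ((LinearMap.range g).subtype ∘ₗ q ∘ₗ g.rangeRestrict) 8 ≠ 0 → q = LinearMap.id := by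
    intro q hq hqq h8
    have h1 := hmin ((LinearMap.range g).subtype ∘ₗ q ∘ₗ g.rangeRestrict) (((rr_isHom b hA hg).comp hq).comp (st_isHom b hA)) ?_ h8 ?_
    · refine LinearMap.ext fun x => ?_
      have h2 : (x : WW k d) ∈ LinearMap.range g := x.2
      replace h2 := h1.ge h2
      obtain ⟨w, hw⟩ := h2
      have h3 : q (g.rangeRestrict w) = x := Subtype.ext hw
      rw [← h3, hqq]; rfl
    · intro w
      show ((q (g.rangeRestrict ((q (g.rangeRestrict w) : LinearMap.range g) : WW k d)) : LinearMap.range g) : WW k d) = (q (g.rangeRestrict w) : LinearMap.range g)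
      rw [hp, hqq]
    · rintro _ ⟨w, rfl⟩
      exact (q (g.rangeRestrict w)).2
  have hsum : (LinearMap.range g).subtype ∘ₗ q ∘ₗ g.rangeRestrict + (LinearMap.range g).subtype ∘ₗ (LinearMap.id - q) ∘ₗ g.rangeRestrict = g := by
    rw [LinearMap.sub_comp, LinearMap.comp_sub, add_sub_cancel]
    rfl
  by_cases h1 : indf t b ((LinearMap.range g).subtype ∘ₗ q ∘ₗ g.rangeRestrict) 8 = 0
  · left
    have h2 : LinearMap.id - q = LinearMap.id := by
      refine key _ ?_ ?_ ?_
      · rw [PB.isHom0_iff] at hq ⊢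
        refine ⟨?_, ?_, ?_⟩
        · intro w hw
          exact Submodule.sub_mem _ hw (hq.1 w hw)
        · intro j w hw
          exact Submodule.sub_mem _ hw (hq.2.1 j w hw)
        · intro j w hw
          exact Submodule.sub_mem _ hw (hq.2.2 j w hw)
      · intro w
        simp only [LinearMap.sub_apply, LinearMap.id_apply, map_sub, hqq]
        abel
      · intro h3
        refine h8 ?_
        rw [← hsum, indf_add, h1, h3, add_zero]
    refine LinearMap.ext fun x => ?_
    have h3 := LinearMap.congr_fun h2 x
    rw [LinearMap.sub_apply, LinearMap.id_apply] at h3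
    exact sub_eq_self.1 h3
  · right
    exact key q hq hqq h1

end idem
end cover2
end Stm

namespace Stm
open LaurentPolynomial

section cover3
variable {k : Type u} [Field k] {V : Type u} [AddCommGroup V] [Module k V]

structure CD (t : Module.End k V) (U : Submodule k V) (e : ℤ → Module.End k V) : Prop where
  z : ∀ i, (i < 1 ∨ 15 < i) → e i = 0
  ht : ∀ i, e (i + 1) * t = t * e i
  hU : ∀ i, ∀ x ∈ U, e i x ∈ U
  idem : ∀ i, e i * e i = e i
  ne : e 8 ≠ 0
  wid : ∀ i j, e i ≠ 0 → e j ≠ 0 → i ≤ j + 7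
  low : ∀ f : Module.End k V, f * t = t * f → (∀ x ∈ U, f x ∈ U) → ∀ i j, i < j → e i * f * e j = 0
  fac : ∀ f g : Module.End k V, f * t = t * f → (∀ x ∈ U, f x ∈ U) → g * t = t * g → (∀ x ∈ U, g x ∈ U) →
    (∃ c : ℤ → Module.End k V, (∀ i, 0 ≤ i → i ≤ 15 → c (i + 1) * t = t * c i) ∧ (∀ i, ∀ x ∈ U, c i x ∈ U) ∧
      ∀ i, c i * (e i * f * e i) = e i * g * e i) ∨
    (∃ c : ℤ → Module.End k V, (∀ i, 0 ≤ i → i ≤ 15 → c (i + 1) * t = t * c i) ∧ (∀ i, ∀ x ∈ U, c i x ∈ U) ∧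
      ∀ i, c i * (e i * g * e i) = e i * f * e i)

variable {t : Module.End k V} {U : Submodule k V} {d : ℕ} (b : Module.Basis (Fin d) k (Fin 17 → V)) (hA : Filt (AA t U))
variable {g : WW k d →ₗ[k[T;T⁻¹]] WW k d}

theorem cd_low {μ : ℚ} (hg : PB.IsHom 0 (EF b hA) (EF b hA) g) (hS : PB.SS ((EF b hA).sub (LinearMap.range g)) μ)
    (z : ∀ i, (i < 1 ∨ 15 < i) → indf t b g i = 0) (ht : ∀ i, indf t b g (i + 1) * t = t * indf t b g i) (idem : ∀ i, indf t b g i * indf t b g i = indf t b g i)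
    (f : Module.End k V) (hf : f * t = t * f) (hfU : ∀ x ∈ U, f x ∈ U) (i j : ℤ) (hij : i < j) : indf t b g i * f * indf t b g j = 0 := by
  set e := indf t b g with he
  by_cases hi : i < 1 ∨ 15 < i
  · rw [z i hi, zero_mul, zero_mul]
  by_cases hj : j < 1 ∨ 15 < j
  · rw [z j hj, mul_zero]
  obtain ⟨δ, rfl⟩ : ∃ δ, i = j - δ := ⟨j - i, by ring⟩
  have H : GF t U (fun m => e (m - δ) * f * e m) δ := by
    refine ⟨?_, ?_, ?_, ?_⟩
    · intro m
      show e (m + 1 - δ) * f * e (m + 1) * t = t * (e (m - δ) * f * e m)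
      rw [mul_assoc _ _ t, ht, ← mul_assoc, mul_assoc _ f t, hf, ← mul_assoc, show m + 1 - δ = m - δ + 1 by ring, ht]
      simp only [mul_assoc]
    · intro m x hx
      exact indf_U b hA hg _ _ (hfU _ (indf_U b hA hg _ _ hx))
    · intro m hm
      show e (m - δ) * f * e m = 0
      rw [z m (by omega), mul_zero]
    · intro m hm
      show e (m - δ) * f * e m = 0
      rw [z (m - δ) (by omega), zero_mul, zero_mul]
  set h := fun m => e (m - δ) * f * e m with hh
  have hF : PB.IsHom 0 (EF b hA) (EF b hA) (Ps b (fam h δ)) :=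
    Ps_isHom b hA (fun i c h0 h3 v hv => hA.mono _ _ _ (by omega) (fam_AA H i c h0 h3 v hv))
  have hL := Ps_low b hA (f := fam h δ) (fun i c h0 h3 v hv => hA.mono _ _ _ (by omega) (fam_AA H i c h0 h3 v hv))
  have hq : PB.IsHom 0 ((EF b hA).sub (LinearMap.range g)) ((EF b hA).sub (LinearMap.range g))
      (g.rangeRestrict ∘ₗ Ps b (fam h δ) ∘ₗ (LinearMap.range g).subtype) :=
    ((st_isHom b hA).comp hF).comp (rr_isHom b hA hg)
  have h0 := hS.neg_zero hq (fun i w hw => (PB.isHom0_iff.1 hg).2.2 _ _ (hL i _ hw))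
  have h1 : g ∘ₗ Ps b (fam h δ) ∘ₗ g = 0 := by
    refine LinearMap.ext fun w => ?_
    have h2 := congrArg Subtype.val (LinearMap.congr_fun h0 (g.rangeRestrict w))
    exact h2
  refine LinearMap.ext fun x => ?_
  have h2 : Ph b g (fam h δ (Ph b g (sing (k := k) j x))) = 0 := by
    have h3 : Ph b (g ∘ₗ Ps b (fam h δ) ∘ₗ g) (sing (k := k) j x) = 0 := by
      rw [h1, Ph_apply]; simp
    rw [Ph_comp b hA hg, LinearMap.comp_apply, Ph_comp b hA hF, LinearMap.comp_apply, Ph_Ps] at h3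
    exact h3
  have h3 := congrArg (sg t (j - δ)) h2
  have hK := Ph_KK b hA hg (sing_KK (k := k) j x)
  have h5 := indf_sg b hA hg (i := j - δ) (by omega) (by omega) (fam_KK (h := h) (e := δ) hK)
  have h6 := sg_fam H (j - δ) (Ph b g (sing (k := k) j x))
  rw [show j - δ + δ = j from by ring] at h6
  rw [h6] at h5
  rw [map_zero] at h3
  rw [h3] at h5
  have h4 : e (j - δ) * (e (j - δ) * f * e j) * e j = e (j - δ) * f * e j := by
    rw [← mul_assoc, ← mul_assoc, idem, mul_assoc, idem]
  have h7 : e j x = sg t j (Ph b g (sing (k := k) j x)) := indf_apply b g j x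
  rw [← h4, Module.End.mul_apply, Module.End.mul_apply, LinearMap.zero_apply, h7]
  exact h5

theorem cd_fac (hg : PB.IsHom 0 (EF b hA) (EF b hA) g) (hgg : ∀ w, g (g w) = g w) (hI : PB.Ind ((EF b hA).sub (LinearMap.range g)))
    {w0 : LinearMap.range g} (hw : w0 ≠ 0)
    (z : ∀ i, (i < 1 ∨ 15 < i) → indf t b g i = 0) (ht : ∀ i, indf t b g (i + 1) * t = t * indf t b g i) (idem : ∀ i, indf t b g i * indf t b g i = indf t b g i)
    (f g' : Module.End k V) (hf : f * t = t * f) (hfU : ∀ x ∈ U, f x ∈ U) (hg' : g' * t = t * g') (hgU' : ∀ x ∈ U, g' x ∈ U) :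
    (∃ c : ℤ → Module.End k V, (∀ i, 0 ≤ i → i ≤ 15 → c (i + 1) * t = t * c i) ∧ (∀ i, ∀ x ∈ U, c i x ∈ U) ∧
      ∀ i, c i * (indf t b g i * f * indf t b g i) = indf t b g i * g' * indf t b g i) ∨
    (∃ c : ℤ → Module.End k V, (∀ i, 0 ≤ i → i ≤ 15 → c (i + 1) * t = t * c i) ∧ (∀ i, ∀ x ∈ U, c i x ∈ U) ∧
      ∀ i, c i * (indf t b g i * g' * indf t b g i) = indf t b g i * f * indf t b g i) := by
  set e := indf t b g with he
  have H : ∀ f : Module.End k V, f * t = t * f → (∀ x ∈ U, f x ∈ U) → GF t U (fun m => e m * f * e m) 0 := by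
    intro f hf hfU
    refine ⟨?_, ?_, ?_, ?_⟩
    · intro m
      show e (m + 1) * f * e (m + 1) * t = t * (e m * f * e m)
      rw [mul_assoc _ _ t, ht, ← mul_assoc, mul_assoc _ f t, hf, ← mul_assoc, ht]
      simp only [mul_assoc]
    · intro m x hx
      exact indf_U b hA hg _ _ (hfU _ (indf_U b hA hg _ _ hx))
    · intro m hm
      show e m * f * e m = 0
      rw [z m (by omega), mul_zero]
    · intro m hm
      show e m * f * e m = 0
      rw [z m (by omega), mul_zero]
  have key : ∀ f g' : Module.End k V, f * t = t * f → (∀ x ∈ U, f x ∈ U) → g' * t = t * g' → (∀ x ∈ U, g' x ∈ U) →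
      (∃ q, PB.IsHom 0 ((EF b hA).sub (LinearMap.range g)) ((EF b hA).sub (LinearMap.range g)) q ∧
        ∀ w, q ((g.rangeRestrict ∘ₗ Ps b (fam (fun m => e m * f * e m) 0) ∘ₗ (LinearMap.range g).subtype) w) = (g.rangeRestrict ∘ₗ Ps b (fam (fun m => e m * g' * e m) 0) ∘ₗ (LinearMap.range g).subtype) w) →
      (∃ c : ℤ → Module.End k V, (∀ i, 0 ≤ i → i ≤ 15 → c (i + 1) * t = t * c i) ∧ (∀ i, ∀ x ∈ U, c i x ∈ U) ∧
        ∀ i, c i * (e i * f * e i) = e i * g' * e i) := by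
    rintro f g' hf hfU hg' hgU' ⟨q, hq, hqe⟩
    have hc : PB.IsHom 0 (EF b hA) (EF b hA) ((LinearMap.range g).subtype ∘ₗ q ∘ₗ g.rangeRestrict) :=
      ((rr_isHom b hA hg).comp hq).comp (st_isHom b hA)
    have hF := fam_isHom b hA (H f hf hfU)
    have hG := fam_isHom b hA (H g' hg' hgU')
    refine ⟨indf t b ((LinearMap.range g).subtype ∘ₗ q ∘ₗ g.rangeRestrict), fun i h0 h1 => indf_t b hA hc h0 h1, indf_U b hA hc, ?_⟩
    intro i
    have h1 : ((LinearMap.range g).subtype ∘ₗ q ∘ₗ g.rangeRestrict) ∘ₗ (Ps b (fam (fun m => e m * f * e m) 0) ∘ₗ g) =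
        g ∘ₗ (Ps b (fam (fun m => e m * g' * e m) 0) ∘ₗ g) := by
      refine LinearMap.ext fun w => ?_
      exact congrArg Subtype.val (hqe (g.rangeRestrict w))
    have h2 := congrArg (fun x => indf t b x i) h1
    rw [indf_comp b hA hc (hg.comp hF), indf_comp b hA hF hg, indf_Ps b (H f hf hfU), indf_comp b hA hg (hg.comp hG), indf_comp b hA hG hg,
      indf_Ps b (H g' hg' hgU'), ← he] at h2
    rw [mul_assoc _ (e i) (e i), idem] at h2
    rw [h2, mul_assoc _ (e i) (e i), idem, ← mul_assoc, ← mul_assoc, idem]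
  rcases hI.factor hw (((st_isHom b hA).comp (fam_isHom b hA (H f hf hfU))).comp (rr_isHom b hA hg))
    (((st_isHom b hA).comp (fam_isHom b hA (H g' hg' hgU'))).comp (rr_isHom b hA hg)) with h | h
  · exact Or.inl (key f g' hf hfU hg' hgU' h)
  · exact Or.inr (key g' f hg' hgU' hf hfU h)

theorem exists_CD [FiniteDimensional k V] (ht6 : t ^ 6 = 0) (hU : ∀ x ∈ U, t x ∈ U) (hV : ∃ x : V, x ≠ 0) : ∃ e, CD t U e := by
  have hA := AA_filt ht6 hU
  let b := Module.finBasis k (Fin 17 → V)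
  obtain ⟨g, hg, hgg, h8, hI⟩ := exists_idem b hA hV
  obtain ⟨w0, hw⟩ : ∃ w0 : LinearMap.range g, w0 ≠ 0 := by
    by_contra hcon
    push Not at hcon
    refine h8 ?_
    have h1 : g = 0 := LinearMap.ext fun w => congrArg Subtype.val (hcon (g.rangeRestrict w))
    rw [h1, indf_zero]
  obtain ⟨μ, hS⟩ := hI.ss w0 hw
  have hwid : ∀ i j, indf t b g i ≠ 0 → indf t b g j ≠ 0 → i ≤ j + 7 := fun i j hi hj => wid b hA ht6 hg hS hi hj
  have z : ∀ i, (i < 1 ∨ 15 < i) → indf t b g i = 0 := by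
    intro i hi
    by_contra hne
    have h1 := hwid _ _ hne h8
    have h2 := hwid _ _ h8 hne
    omega
  have ht : ∀ i, indf t b g (i + 1) * t = t * indf t b g i := by
    intro i
    by_cases hi : 0 ≤ i ∧ i ≤ 15
    · exact indf_t b hA hg hi.1 hi.2
    · rw [z i (by omega), z (i + 1) (by omega), zero_mul, mul_zero]
  have idem : ∀ i, indf t b g i * indf t b g i = indf t b g i := by
    intro i
    rw [← indf_comp b hA hg hg]
    congr 1
    exact LinearMap.ext hgg
  exact ⟨indf t b g, z, ht, indf_U b hA hg, idem, h8, hwid, cd_low b hA hg hS z ht idem,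
    fun f g' h1 h2 h3 h4 => cd_fac b hA hg hgg hI hw z ht idem f g' h1 h2 h3 h4⟩

end cover3
end Stm

namespace Stm

section asm
variable {k : Type u} [Field k] {X : SObj k 6} {e : ℤ → Module.End k X.carrier}

theorem mem_endAlg {f : Module.End k X.carrier} : f ∈ X.endAlg ↔ (∀ x ∈ X.U, f x ∈ X.U) ∧ f * X.T = X.T * f := Iff.rfl

theorem sum_mem_endAlg (h : ℤ → Module.End k X.carrier) (z : ∀ i, (i < 1 ∨ 15 < i) → h i = 0)
    (ht : ∀ i, h (i + 1) * X.T = X.T * h i) (hU : ∀ i, ∀ x ∈ X.U, h i x ∈ X.U) : ∑ i ∈ Finset.Icc (0 : ℤ) 16, h i ∈ X.endAlg := by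
  refine ⟨fun x hx => ?_, ?_⟩
  · rw [LinearMap.sum_apply]
    exact Submodule.sum_mem _ fun i _ => hU i x hx
  · have h1 : ∑ i ∈ Finset.Icc (0 : ℤ) 16, h i = ∑ i ∈ Finset.Icc (-1 : ℤ) 16, h i := by
      refine Finset.sum_subset (fun i hi => ?_) (fun i hi hi' => z i ?_)
      · rw [Finset.mem_Icc] at hi ⊢; omega
      · rw [Finset.mem_Icc] at hi hi'; omega
    have h2 : ∑ i ∈ Finset.Icc (-1 : ℤ) 15, h i = ∑ i ∈ Finset.Icc (-1 : ℤ) 16, h i := by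
      refine Finset.sum_subset (fun i hi => ?_) (fun i hi hi' => z i ?_)
      · rw [Finset.mem_Icc] at hi ⊢; omega
      · rw [Finset.mem_Icc] at hi hi'; omega
    conv_rhs => rw [h1, ← h2, Finset.mul_sum]
    rw [Finset.sum_mul]
    refine Finset.sum_nbij (fun i => i - 1) ?_ ?_ ?_ ?_
    · intro i hi
      rw [Finset.mem_Icc] at hi ⊢; omega
    · intro i _ j _ hij
      simpa using hij
    · intro i hi
      refine ⟨i + 1, ?_, by simp⟩
      simp only [Finset.coe_Icc, Set.mem_Icc] at hi ⊢; omega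
    · intro i _
      rw [← ht, sub_add_cancel]

theorem sum_single {h : ℤ → Module.End k X.carrier} {j : ℤ} (z : j < 1 ∨ 15 < j → h j = 0) (hj : ∀ i, i ≠ j → h i = 0) :
    ∑ i ∈ Finset.Icc (0 : ℤ) 16, h i = h j := by
  refine Finset.sum_eq_single j (fun i _ hi => hj i hi) (fun hh => z ?_)
  rw [Finset.mem_Icc] at hh; omega

/-- Fitting -/
theorem fitting (hX : X.Indec) {f : Module.End k X.carrier} (hf : f ∈ X.endAlg) (hn : ∀ n, f ^ n ≠ 0) :
    ∃ g ∈ X.endAlg, f * g = 1 ∧ g * f = 1 := by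
  obtain ⟨hfU, hft⟩ := hf
  have hinj : Function.Injective f := by
    let fU := f.restrict hfU
    obtain ⟨n, h1, h2⟩ := ((f.eventually_isCompl_ker_pow_range_pow).and ((fU.eventually_isCompl_ker_pow_range_pow).and (Filter.eventually_ge_atTop 1))).exists
    obtain ⟨h2, hn1⟩ := h2
    have hfn : f ^ n * X.T = X.T * f ^ n := (show Commute f X.T from hft).pow_left n
    have hres : ∀ x : X.U, ((fU ^ n) x : X.carrier) = (f ^ n) x := by
      intro x
      have h3 : ∀ m : ℕ, ((fU ^ m) x : X.carrier) = (f ^ m) x := by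
        intro m
        induction m with
        | zero => simp
        | succ m ih =>
          rw [pow_succ', pow_succ', Module.End.mul_apply, Module.End.mul_apply, ← ih]
          rfl
      exact h3 n
    have hk : LinearMap.ker (f ^ n) = ⊥ := by
      by_contra hk
      refine hX.2 ⟨LinearMap.ker (f ^ n), LinearMap.range (f ^ n), hk, ?_, h1, ?_, ?_, ?_⟩
      · intro hr
        exact hn n (LinearMap.range_eq_bot.1 hr)
      · intro x hx
        rw [LinearMap.mem_ker] at hx ⊢
        rw [← Module.End.mul_apply, hfn, Module.End.mul_apply, hx, map_zero]
      · rintro _ ⟨x, rfl⟩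
        exact ⟨X.T x, by rw [← Module.End.mul_apply, hfn]; rfl⟩
      · refine le_antisymm (fun x hx => ?_) (sup_le inf_le_left inf_le_left)
        have h3 : (⟨x, hx⟩ : X.U) ∈ LinearMap.ker (fU ^ n) ⊔ LinearMap.range (fU ^ n) := by
          rw [h2.sup_eq_top]; trivial
        obtain ⟨y, hy, w, ⟨w, rfl⟩, hyz⟩ := Submodule.mem_sup.1 h3
        have h4 : x = (y : X.carrier) + (f ^ n) w := by
          rw [← hres, ← Submodule.coe_add, hyz]
        rw [h4]
        refine Submodule.add_mem_sup ⟨y.2, ?_⟩ ⟨?_, ⟨_, rfl⟩⟩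
        · rw [SetLike.mem_coe, LinearMap.mem_ker, ← hres, LinearMap.mem_ker.1 hy]; rfl
        · rw [← hres]; exact Subtype.property _
    rw [LinearMap.ker_eq_bot] at hk
    intro x y hxy
    refine hk ?_
    obtain ⟨m, rfl⟩ : ∃ m, n = m + 1 := ⟨n - 1, by omega⟩
    rw [pow_succ, Module.End.mul_apply, Module.End.mul_apply, hxy]
  let E := LinearEquiv.ofInjectiveEndo f hinj
  have h1 : f * (E.symm : Module.End k X.carrier) = 1 := LinearMap.ext fun x => E.apply_symm_apply x
  have h2 : (E.symm : Module.End k X.carrier) * f = 1 := LinearMap.ext fun x => E.symm_apply_apply x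
  refine ⟨E.symm, ⟨?_, ?_⟩, h1, h2⟩
  · intro x hx
    have h3 : Function.Injective (f.restrict hfU) := fun a b hab => Subtype.ext (hinj (congrArg Subtype.val hab))
    obtain ⟨y, hy⟩ := LinearMap.surjective_of_injective h3 ⟨x, hx⟩
    have h4 : f y = x := congrArg Subtype.val hy
    have h5 : (E.symm : Module.End k X.carrier) x = y := by
      rw [← h4, ← Module.End.mul_apply, h2]; rfl
    rw [h5]; exact y.2
  · calc (E.symm : Module.End k X.carrier) * X.T = E.symm * X.T * (f * E.symm) := by rw [h1, mul_one]
      _ = E.symm * (X.T * f) * E.symm := by simp only [mul_assoc]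
      _ = (E.symm * f) * X.T * E.symm := by rw [← hft]; simp only [mul_assoc]
      _ = X.T * E.symm := by rw [h2, one_mul]

structure PD (X : SObj k 6) (π : ℤ → Module.End k X.carrier) : Prop where
  z : ∀ i, (i < 1 ∨ 15 < i) → π i = 0
  ht : ∀ i, π (i + 1) * X.T = X.T * π i
  hU : ∀ i, ∀ x ∈ X.U, π i x ∈ X.U
  sum : ∑ i ∈ Finset.Icc (0 : ℤ) 16, π i = 1
  idem : ∀ i, π i * π i = π i
  orth : ∀ i j, i ≠ j → π i * π j = 0
  wid : ∀ i j, π i ≠ 0 → π j ≠ 0 → i ≤ j + 7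
  low : ∀ f ∈ X.endAlg, ∀ i j, i < j → π i * f * π j = 0
  fac : ∀ f ∈ X.endAlg, ∀ g ∈ X.endAlg,
    (∃ c : ℤ → Module.End k X.carrier, (∀ i, 0 ≤ i → i ≤ 15 → c (i + 1) * X.T = X.T * c i) ∧ (∀ i, ∀ x ∈ X.U, c i x ∈ X.U) ∧
      ∀ i, c i * (π i * f * π i) = π i * g * π i) ∨
    (∃ c : ℤ → Module.End k X.carrier, (∀ i, 0 ≤ i → i ≤ 15 → c (i + 1) * X.T = X.T * c i) ∧ (∀ i, ∀ x ∈ X.U, c i x ∈ X.U) ∧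
      ∀ i, c i * (π i * g * π i) = π i * f * π i)

theorem exists_PD (hX : X.Indec) : ∃ π, PD X π := by
  obtain ⟨e, he⟩ := exists_CD X.pow_eq_zero X.maps_U hX.1
  have low : ∀ f ∈ X.endAlg, ∀ i j, i < j → e i * f * e j = 0 := fun f hf => he.low f hf.2 hf.1
  have low1 : ∀ i j, i < j → e i * e j = 0 := by
    intro i j hij
    have := low 1 (one_mem _) i j hij
    rwa [mul_one] at this
  obtain ⟨θ, hθ⟩ : ∃ θ, θ = ∑ i ∈ Finset.Icc (0 : ℤ) 16, e i := ⟨_, rfl⟩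
  have hθm : θ ∈ X.endAlg := by
    rw [hθ]; exact sum_mem_endAlg e he.z he.ht he.hU
  have L1 : ∀ f ∈ X.endAlg, ∀ i, e i * f * θ * e i = e i * f * e i := by
    intro f hf i
    rw [hθ, Finset.mul_sum, Finset.sum_mul, sum_single (j := i)]
    · rw [mul_assoc _ (e i) (e i), he.idem]
    · intro hi; rw [he.z i hi, mul_zero]
    · intro j hj
      rcases lt_or_gt_of_ne hj with h | h
      · rw [mul_assoc, low1 j i h, mul_zero]
      · rw [low f hf i j h, zero_mul]
  have L2 : ∀ n i, e i * θ ^ n * e i = e i := by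
    intro n i
    induction n with
    | zero => rw [pow_zero, mul_one, he.idem]
    | succ n ih => rw [pow_succ, ← mul_assoc, L1 _ (pow_mem hθm n), ih]
  obtain ⟨τ, hτ, h1, h2⟩ := fitting hX hθm (fun n hn => he.ne (by rw [← L2 n 8, hn, mul_zero, zero_mul]))
  have L3 : ∀ i, e i * τ * e i = e i := by
    intro i
    rw [← L1 τ hτ, mul_assoc (e i) τ θ, h2, mul_one, he.idem]
  have plow : ∀ f ∈ X.endAlg, ∀ i j, i < j → (e i * τ) * f * (e j * τ) = 0 := by
    intro f hf i j hij
    have h3 := low (τ * f) (mul_mem hτ hf) i j hij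
    calc (e i * τ) * f * (e j * τ) = (e i * (τ * f) * e j) * τ := by simp only [mul_assoc]
      _ = 0 := by rw [h3, zero_mul]
  have pidem : ∀ i, (e i * τ) * (e i * τ) = e i * τ := by
    intro i
    rw [← mul_assoc, L3]
  have psum : ∑ i ∈ Finset.Icc (0 : ℤ) 16, e i * τ = 1 := by
    rw [← Finset.sum_mul, ← hθ, h1]
  have pz : ∀ i, (i < 1 ∨ 15 < i) → e i * τ = 0 := by
    intro i hi; rw [he.z i hi, zero_mul]
  have po1 : ∀ i j, i < j → (e i * τ) * (e j * τ) = 0 := by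
    intro i j hij
    have := plow 1 (one_mem _) i j hij
    rwa [mul_one] at this
  obtain ⟨π, hπ⟩ : ∃ π : ℤ → Module.End k X.carrier, π = fun i => e i * τ := ⟨_, rfl⟩
  have hπ' : ∀ i, e i * τ = π i := fun i => by rw [hπ]
  simp only [hπ'] at plow pidem psum pz po1
  have po2 : ∀ (n : ℕ) (l j : ℤ), j < l → l ≤ j + n → π l * π j = 0 := by
    intro n
    induction n with
    | zero => intro l j h1 h2; omega
    | succ n ih =>
      intro l j h1 h2
      have h3 : π l * ((∑ i ∈ Finset.Icc (0 : ℤ) 16, π i) - π j) * π j = 0 := by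
        rw [psum, mul_sub, sub_mul, mul_one, mul_assoc, pidem, sub_self]
      have h4 : π l * (∑ i ∈ Finset.Icc (0 : ℤ) 16, π i) * π j = π l * π j * π j + π l * π l * π j := by
        have hne : j ≠ l := by omega
        have h5 : ∀ i, i ≠ j ∧ i ≠ l → π l * π i * π j = 0 := by
          rintro i ⟨hij, hil⟩
          rcases lt_or_gt_of_ne hil with h | h
          · rcases lt_or_gt_of_ne hij with h' | h'
            · rw [mul_assoc, po1 _ _ h', mul_zero]
            · rw [mul_assoc, ih i j h' (by push_cast at h2; omega), mul_zero]
          · rw [po1 _ _ h, zero_mul]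
        rw [Finset.mul_sum, Finset.sum_mul]
        refine Finset.sum_eq_add j l hne (fun i _ hi => h5 i hi) ?_ ?_
        · intro hh
          rw [pz j (by rw [Finset.mem_Icc] at hh; omega), mul_zero]
        · intro hh
          rw [pz l (by rw [Finset.mem_Icc] at hh; omega), mul_zero, zero_mul]
      rw [mul_sub, sub_mul, h4, pidem, add_sub_cancel_left] at h3
      exact h3
  refine ⟨π, pz, ?_, ?_, psum, pidem, ?_, ?_, plow, ?_⟩
  · intro i
    rw [← hπ', ← hπ', mul_assoc, hτ.2, ← mul_assoc, he.ht, mul_assoc]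
  · intro i x hx
    rw [← hπ']
    exact he.hU _ _ (hτ.1 _ hx)
  · intro i j hij
    rcases lt_or_gt_of_ne hij with h | h
    · exact po1 i j h
    · exact po2 (i - j).toNat i j h (by omega)
  · intro i j hi hj
    rw [← hπ'] at hi hj
    exact he.wid i j (left_ne_zero_of_mul hi) (left_ne_zero_of_mul hj)
  · have key : ∀ (f g : Module.End k X.carrier), (∃ c : ℤ → Module.End k X.carrier, (∀ i, 0 ≤ i → i ≤ 15 → c (i + 1) * X.T = X.T * c i) ∧ (∀ i, ∀ x ∈ X.U, c i x ∈ X.U) ∧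
        ∀ i, c i * (e i * (τ * f) * e i) = e i * (τ * g) * e i) → (∃ c : ℤ → Module.End k X.carrier, (∀ i, 0 ≤ i → i ≤ 15 → c (i + 1) * X.T = X.T * c i) ∧ (∀ i, ∀ x ∈ X.U, c i x ∈ X.U) ∧
        ∀ i, c i * (π i * f * π i) = π i * g * π i) := by
      rintro f g ⟨c, hc1, hc2, hc3⟩
      refine ⟨c, hc1, hc2, fun i => ?_⟩
      have := congrArg (· * τ) (hc3 i)
      rw [← hπ']
      simpa only [mul_assoc] using this
    intro f hf g hg
    have h3 := mul_mem hτ hf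
    have h4 := mul_mem hτ hg
    rcases he.fac (τ * f) (τ * g) h3.2 h3.1 h4.2 h4.1 with h | h
    · exact Or.inl (key f g h)
    · exact Or.inr (key g f h)

end asm
end Stm

namespace Stm

section asm2
variable {k : Type u} [Field k] {X : SObj k 6} {π : ℤ → Module.End k X.carrier}

theorem PD.phi_mem (H : PD X π) (f : Module.End k X.carrier) (hf : f ∈ X.endAlg) : ∑ i ∈ Finset.Icc (0 : ℤ) 16, π i * f * π i ∈ X.endAlg := by
  refine sum_mem_endAlg (fun i => π i * f * π i) ?_ ?_ ?_
  · intro i hi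
    show π i * f * π i = 0
    rw [H.z i hi, mul_zero]
  · intro i
    show π (i + 1) * f * π (i + 1) * X.T = X.T * (π i * f * π i)
    rw [mul_assoc _ _ X.T, H.ht, ← mul_assoc, mul_assoc _ f X.T, hf.2, ← mul_assoc, H.ht]
    simp only [mul_assoc]
  · intro i x hx
    exact H.hU _ _ (hf.1 _ (H.hU _ _ hx))

theorem PD.mid (H : PD X π) (f g : Module.End k X.carrier) (i j : ℤ) :
    π i * (f * g) * π j = ∑ l ∈ Finset.Icc (0 : ℤ) 16, (π i * f * π l) * (π l * g * π j) := by
  calc π i * (f * g) * π j = π i * f * (∑ l ∈ Finset.Icc (0 : ℤ) 16, π l) * (g * π j) := by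
        rw [H.sum, mul_one]; simp only [mul_assoc]
    _ = _ := by
        rw [Finset.mul_sum, Finset.sum_mul]
        refine Finset.sum_congr rfl fun l _ => ?_
        conv_lhs => rw [← H.idem l]
        simp only [mul_assoc]

theorem PD.pick (H : PD X π) (c : ℤ → Module.End k X.carrier) (i : ℤ) :
    π i * (∑ l ∈ Finset.Icc (0 : ℤ) 16, π l * c l * π l) * π i = π i * c i * π i := by
  rw [Finset.mul_sum, Finset.sum_mul, sum_single (j := i)]
  · calc π i * (π i * c i * π i) * π i = (π i * π i) * c i * (π i * π i) := by simp only [mul_assoc]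
      _ = _ := by rw [H.idem]
  · intro hi
    rw [H.z i hi, zero_mul, zero_mul]
  · intro l hl
    rw [mul_assoc (π l), ← mul_assoc (π i), H.orth i l (Ne.symm hl), zero_mul, zero_mul]

theorem PD.diag_mul (H : PD X π) (c c' : ℤ → Module.End k X.carrier) :
    (∑ l ∈ Finset.Icc (0 : ℤ) 16, π l * c l * π l) * (∑ l ∈ Finset.Icc (0 : ℤ) 16, π l * c' l * π l) =
      ∑ l ∈ Finset.Icc (0 : ℤ) 16, π l * (c l * π l * c' l) * π l := by
  rw [Finset.sum_mul]
  refine Finset.sum_congr rfl fun i _ => ?_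
  rw [Finset.mul_sum, sum_single (j := i)]
  · calc π i * c i * π i * (π i * c' i * π i) = π i * c i * (π i * π i) * c' i * π i := by simp only [mul_assoc]
      _ = _ := by rw [H.idem]; simp only [mul_assoc]
  · intro hi
    rw [H.z i hi, mul_zero, zero_mul]
  · intro l hl
    calc π i * c i * π i * (π l * c' l * π l) = π i * c i * (π i * π l) * c' l * π l := by simp only [mul_assoc]
      _ = _ := by rw [H.orth i l (Ne.symm hl)]; simp

theorem PD.diag (H : PD X π) {f g : Module.End k X.carrier} (hf : f ∈ X.endAlg) (hg : g ∈ X.endAlg) (i : ℤ) :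
    π i * (f * g) * π i = (π i * f * π i) * (π i * g * π i) := by
  rw [H.mid, sum_single (j := i)]
  · intro hi
    rw [H.z i hi, mul_zero, zero_mul]
  · intro l hl
    rcases lt_or_gt_of_ne hl with h | h
    · rw [H.low g hg l i h, mul_zero]
    · rw [H.low f hf i l h, zero_mul]

noncomputable def psi (H : PD X π) : X.endAlg →+* X.endAlg where
  toFun f := ⟨∑ i ∈ Finset.Icc (0 : ℤ) 16, π i * (f : Module.End k X.carrier) * π i, H.phi_mem f f.2⟩
  map_one' := by
    refine Subtype.ext ?_
    show ∑ i ∈ Finset.Icc (0 : ℤ) 16, π i * 1 * π i = 1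
    simp only [mul_one, H.idem, H.sum]
  map_mul' f g := by
    refine Subtype.ext ?_
    show ∑ i ∈ Finset.Icc (0 : ℤ) 16, π i * (f * g : Module.End k X.carrier) * π i =
      (∑ i ∈ Finset.Icc (0 : ℤ) 16, π i * (f : Module.End k X.carrier) * π i) * (∑ i ∈ Finset.Icc (0 : ℤ) 16, π i * (g : Module.End k X.carrier) * π i)
    rw [H.diag_mul (fun _ => f) (fun _ => g)]
    refine Finset.sum_congr rfl fun i _ => ?_
    rw [H.diag f.2 g.2]
    calc (π i * (f : Module.End k X.carrier) * π i) * (π i * g * π i) = π i * f * (π i * π i) * g * π i := by simp only [mul_assoc]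
      _ = _ := by rw [H.idem]; simp only [mul_assoc]
  map_zero' := by
    refine Subtype.ext ?_
    show ∑ i ∈ Finset.Icc (0 : ℤ) 16, π i * 0 * π i = 0
    simp
  map_add' f g := by
    refine Subtype.ext ?_
    show ∑ i ∈ Finset.Icc (0 : ℤ) 16, π i * (f + g : Module.End k X.carrier) * π i =
      (∑ i ∈ Finset.Icc (0 : ℤ) 16, π i * (f : Module.End k X.carrier) * π i) + (∑ i ∈ Finset.Icc (0 : ℤ) 16, π i * (g : Module.End k X.carrier) * π i)
    rw [← Finset.sum_add_distrib]
    refine Finset.sum_congr rfl fun i _ => ?_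
    rw [mul_add, add_mul]

theorem psi_coe (H : PD X π) (f : X.endAlg) : (psi H f : Module.End k X.carrier) = ∑ i ∈ Finset.Icc (0 : ℤ) 16, π i * (f : Module.End k X.carrier) * π i := rfl

def Rs (π : ℤ → Module.End k X.carrier) (n : ℤ) (f : Module.End k X.carrier) : Prop := ∀ i j, i < j + n → π i * f * π j = 0

theorem Rs.mul (H : PD X π) {n m : ℤ} {f g : Module.End k X.carrier} (hf : Rs π n f) (hg : Rs π m g) : Rs π (n + m) (f * g) := by
  intro i j hij
  rw [H.mid]
  refine Finset.sum_eq_zero fun l _ => ?_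
  by_cases h : i < l + n
  · rw [hf i l h, zero_mul]
  · rw [hg l j (by omega), mul_zero]

theorem Rs.zero (H : PD X π) {f : Module.End k X.carrier} (hf : Rs π 8 f) : f = 0 := by
  have h1 : f = (∑ i ∈ Finset.Icc (0 : ℤ) 16, π i) * f * (∑ i ∈ Finset.Icc (0 : ℤ) 16, π i) := by
    rw [H.sum, one_mul, mul_one]
  rw [h1, Finset.sum_mul, Finset.sum_mul]
  refine Finset.sum_eq_zero fun i _ => ?_
  rw [Finset.mul_sum]
  refine Finset.sum_eq_zero fun j _ => ?_
  by_cases hi : π i = 0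
  · rw [hi, zero_mul, zero_mul]
  by_cases hj : π j = 0
  · rw [hj, mul_zero]
  have := H.wid i j hi hj
  exact hf i j (by omega)

theorem psi_ker (H : PD X π) {f : X.endAlg} (hf : psi H f = 0) : Rs π 1 (f : Module.End k X.carrier) := by
  intro i j hij
  rcases (show i < j ∨ i = j by omega) with h | rfl
  · exact H.low f f.2 i j h
  · have h1 := H.pick (fun _ => (f : Module.End k X.carrier)) i
    rw [← psi_coe H f, hf] at h1
    rw [← h1]; simp

theorem psi_chain_aux (H : PD X π) (f g : X.endAlg)
    (h : ∃ c : ℤ → Module.End k X.carrier, (∀ i, 0 ≤ i → i ≤ 15 → c (i + 1) * X.T = X.T * c i) ∧ (∀ i, ∀ x ∈ X.U, c i x ∈ X.U) ∧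
      ∀ i, c i * (π i * f * π i) = π i * g * π i) : ∃ c, psi H c * psi H f = psi H g := by
  obtain ⟨c, hc1, hc2, hc3⟩ := h
  have hm : ∑ i ∈ Finset.Icc (0 : ℤ) 16, π i * c i * π i ∈ X.endAlg := by
    refine sum_mem_endAlg (fun i => π i * c i * π i) ?_ ?_ ?_
    · intro i hi
      show π i * c i * π i = 0
      rw [H.z i hi, mul_zero]
    · intro i
      show π (i + 1) * c (i + 1) * π (i + 1) * X.T = X.T * (π i * c i * π i)
      by_cases hi : 0 ≤ i ∧ i ≤ 15
      · rw [mul_assoc _ _ X.T, H.ht, ← mul_assoc, mul_assoc _ _ X.T, hc1 i hi.1 hi.2, ← mul_assoc, H.ht]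
        simp only [mul_assoc]
      · rw [H.z i (by omega), H.z (i + 1) (by omega)]; simp
    · intro i x hx
      exact H.hU _ _ (hc2 _ _ (H.hU _ _ hx))
  refine ⟨⟨_, hm⟩, Subtype.ext ?_⟩
  show (psi H ⟨_, hm⟩ : Module.End k X.carrier) * (psi H f : Module.End k X.carrier) = psi H g
  have h1 : (psi H ⟨_, hm⟩ : Module.End k X.carrier) = ∑ i ∈ Finset.Icc (0 : ℤ) 16, π i * c i * π i := by
    rw [psi_coe]
    exact Finset.sum_congr rfl fun i _ => H.pick c i
  rw [h1, psi_coe, psi_coe, H.diag_mul c (fun _ => f)]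
  refine Finset.sum_congr rfl fun i _ => ?_
  calc π i * (c i * π i * f) * π i = π i * (c i * (π i * f * π i)) := by simp only [mul_assoc]
    _ = π i * g * π i := by rw [hc3, ← mul_assoc, ← mul_assoc, H.idem]

theorem psi_chain (H : PD X π) (f g : X.endAlg) : (∃ c, psi H c * psi H f = psi H g) ∨ (∃ c, psi H c * psi H g = psi H f) := by
  rcases H.fac f f.2 g g.2 with h | h
  · exact Or.inl (psi_chain_aux H f g h)
  · exact Or.inr (psi_chain_aux H g f h)

theorem chain_ideals {R : Type u} [Ring R] (h : ∀ a b : R, (∃ c, c * a = b) ∨ (∃ c, c * b = a)) (J J' : Ideal R) : J ≤ J' ∨ J' ≤ J := by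
  by_contra hcon
  push Not at hcon
  obtain ⟨a, ha, ha'⟩ := SetLike.not_le_iff_exists.1 hcon.1
  obtain ⟨b, hb, hb'⟩ := SetLike.not_le_iff_exists.1 hcon.2
  rcases h a b with ⟨c, hc⟩ | ⟨c, hc⟩
  · exact hb' (hc ▸ J.mul_mem_left c ha)
  · exact ha' (hc ▸ J'.mul_mem_left c hb)

theorem chain_local {R : Type u} [Ring R] [Nontrivial R] (h : ∀ a b : R, (∃ c, c * a = b) ∨ (∃ c, c * b = a))
    (hc : ∀ a b : R, a * b = 1 → b * a = 1) : IsLocalRing R := by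
  refine ⟨fun {a b} hab => ?_⟩
  have key : ∀ a b c : R, a + b = 1 → c * a = b → IsUnit a := by
    intro a b c hab hca
    have h1 : (c + 1) * a = 1 := by rw [add_mul, one_mul, hca, add_comm, hab]
    exact ⟨⟨a, c + 1, hc _ _ h1, h1⟩, rfl⟩
  rcases h a b with ⟨c, hc⟩ | ⟨c, hc⟩
  · exact Or.inl (key a b c hab hc)
  · exact Or.inr (key b a c (by rw [add_comm, hab]) hc)

theorem main (hX : X.Indec) :
    ∃ (R : Type u) (_ : Ring R) (φ : X.endAlg →+* R),
      Function.Surjective φ ∧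
      (∀ f : Fin 8 → X.endAlg, (∀ i, φ (f i) = 0) →
        f 0 * f 1 * f 2 * f 3 * f 4 * f 5 * f 6 * f 7 = 0) ∧
      IsLocalRing R ∧
      ∀ J J' : Ideal R, J ≤ J' ∨ J' ≤ J := by
  obtain ⟨π, H⟩ := exists_PD hX
  have hch : ∀ a b : (psi H).range, (∃ c, c * a = b) ∨ (∃ c, c * b = a) := by
    rintro ⟨_, f, rfl⟩ ⟨_, g, rfl⟩
    rcases psi_chain H f g with ⟨c, hc⟩ | ⟨c, hc⟩
    · exact Or.inl ⟨⟨_, c, rfl⟩, Subtype.ext hc⟩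
    · exact Or.inr ⟨⟨_, c, rfl⟩, Subtype.ext hc⟩
  have hnt : Nontrivial (psi H).range := by
    refine ⟨⟨1, 0, fun h => ?_⟩⟩
    obtain ⟨v, hv⟩ := hX.1
    have h1 : (1 : Module.End k X.carrier) = 0 := congrArg (fun x : (psi H).range => ((x : X.endAlg) : Module.End k X.carrier)) h
    exact hv (LinearMap.congr_fun h1 v)
  refine ⟨(psi H).range, inferInstance, (psi H).rangeRestrict, (psi H).rangeRestrict_surjective, ?_, ?_, chain_ideals hch⟩
  · intro f hf
    have h1 : ∀ i, Rs π 1 (f i : Module.End k X.carrier) := fun i => psi_ker H (congrArg Subtype.val (hf i))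
    refine Subtype.ext (Rs.zero H ?_)
    have h2 := ((((((((h1 0).mul H (h1 1)).mul H (h1 2)).mul H (h1 3)).mul H (h1 4)).mul H (h1 5)).mul H (h1 6)).mul H (h1 7))
    exact h2
  · refine chain_local hch ?_
    intro a b hab
    have h1 : ((a : X.endAlg) : Module.End k X.carrier) * ((b : X.endAlg) : Module.End k X.carrier) = 1 :=
      congrArg (fun x : (psi H).range => ((x : X.endAlg) : Module.End k X.carrier)) hab
    exact Subtype.ext (Subtype.ext (mul_eq_one_comm.1 h1))

end asm2
end Stm

/-- (0.1.5) For every indecomposable object `X` of `S_k(6)` there is a two-sided ideal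
`I` of `End(X)` with `I^8 = 0` such that `End(X)/I` is a local uniserial ring. This is
phrased via a surjective ring homomorphism `φ : End(X) → R` (so `R ≅ End(X)/I` with
`I = ker φ`): every product of eight elements of the kernel vanishes, `R` is local,
and the ideals of `R` are totally ordered by inclusion. -/
theorem stmt4 (k : Type u) [Field k] (X : SObj k 6) (hX : X.Indec) :
    ∃ (R : Type u) (_ : Ring R) (φ : X.endAlg →+* R),
      Function.Surjective φ ∧
      (∀ f : Fin 8 → X.endAlg, (∀ i, φ (f i) = 0) →
        f 0 * f 1 * f 2 * f 3 * f 4 * f 5 * f 6 * f 7 = 0) ∧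
      IsLocalRing R ∧
      ∀ J J' : Ideal R, J ≤ J' ∨ J' ≤ J := by
  exact Stm.main hX
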